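/- Let a=(a_ij) be a continuous map from [0,T]×ℝ^d into the symmetric positive definite d×d matrices with each a_ij locally Hölder continuous on [0,T)×ℝ^d and |a_ij(t,x)| ≤ c₁(1+|x|²). Let 0=t_0<t_1<⋯<t_N=T and let h:(ℝ^d)^{N+1}→ℝ be locally Lipschitz with polynomially growing Lipschitz constant: there exist p≥0 and L≥0 such that |h(x_0,…,x_N)−h(y_0,…,y_N)| ≤ (1+m^p) L Σ_{i=0}^N |x_i−y_i| whenever |x_i|,|y_i| ≤ m for all i. Set v_N(t,x_0,…,x_N,x) := h(x_0,…,x_N) for t∈[0,T] and x∈ℝ^d. Then the following recursive scheme is well-defined: for k=N−1,N−2,…,0, the function f_{k+1}(x) := v_{k+1}(t_{k+1},x_0,…,x_k,x,x) is continuous and of at most polynomial growth in x, and there exists a unique (within the class of functions of at most polynomial growth uniformly in t) function v_k:[t_k,t_{k+1}]×(ℝ^d)^{k+1}×ℝ^d→ℝ such that for each fixed (x_0,…,x_k), (t,x)↦v_k(t,x_0,…,x_k,x) belongs to C^{1,2}([t_k,t_{k+1})×ℝ^d)∩C([t_k,t_{k+1}]×ℝ^d), satisfies ∂v_k/∂t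 + ℒv_k = 0 on [t_k,t_{k+1})×ℝ^d, and v_k(t_{k+1},x_0,…,x_k,x) = f_{k+1}(x). -/

import Mathlib

open Finset Filter Topology Set

noncomputable section

/-- The successor `s'` of `s` in the partition `P` of `[0,T]` (equal to `T` if there is none). -/
def succOf (T : ℝ) (P : Finset ℝ) (s : ℝ) : ℝ :=
  if h : (P.filter (fun u => s < u)).Nonempty then (P.filter (fun u => s < u)).min' h else T

/-- A refining sequence of partitions of `[0,T]` whose meshes tend to zero. -/
structure PartitionSeq (T : ℝ) where
  part : ℕ → Finset ℝ
  subset_Icc : ∀ n, ↑(part n) ⊆ Set.Icc (0 : ℝ) T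
  zero_mem : ∀ n, (0 : ℝ) ∈ part n
  top_mem : ∀ n, T ∈ part n
  refining : ∀ n, part n ⊆ part (n + 1)
  mesh_to_zero : ∀ ε > 0, ∃ N, ∀ n ≥ N, ∀ s ∈ part n, succOf T (part n) s - s < ε
/-- Approximating sums for the covariation `⟨S_i,S_j⟩(t)` along the `n`-th partition. -/
def covSum (T : ℝ) (𝕋 : PartitionSeq T) {d : ℕ} (S : ℝ → Fin d → ℝ) (i j : Fin d)
    (t : ℝ) (n : ℕ) : ℝ :=
  ∑ s ∈ (𝕋.part n).filter (fun s => s ≤ t),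
    (S (succOf T (𝕋.part n) s) i - S s i) * (S (succOf T (𝕋.part n) s) j - S s j)

/-- The Föllmer integral `∫_r^t ξ(s)·dS(s)` exists along `(𝕋_n)` with value `I`. -/
def HasFollmerIntegral (T : ℝ) (𝕋 : PartitionSeq T) {d : ℕ} (ξ S : ℝ → Fin d → ℝ)
    (r t I : ℝ) : Prop :=
  Tendsto (fun n => ∑ s ∈ (𝕋.part n).filter (fun s => r ≤ s ∧ s ≤ t),
    ∑ k, ξ s k * (S (succOf T (𝕋.part n) s) k - S s k)) atTop (𝓝 I)

/-- The open positive orthant `ℝ_+^d`. -/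
def posOrth (d : ℕ) : Set (Fin d → ℝ) := {x | ∀ i, 0 < x i}

/-- The class `𝒮_a`: continuous trajectories whose covariations are `∫_0^t a_ij(s,S(s)) ds`. -/
def SclassA (T : ℝ) (𝕋 : PartitionSeq T) {d : ℕ}
    (a : ℝ → (Fin d → ℝ) → Fin d → Fin d → ℝ) : Set (ℝ → Fin d → ℝ) :=
  {S | ContinuousOn S (Set.Icc 0 T) ∧
    ∀ i j : Fin d, ∀ t ∈ Set.Icc (0 : ℝ) T,
      Tendsto (fun n => covSum T 𝕋 S i j t n) atTop (𝓝 (∫ s in (0 : ℝ)..t, a s (S s) i j))}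

/-- The class `𝒮_a^+`: positive continuous trajectories whose covariations are
`∫_0^t a_ij(s,S(s)) S_i(s) S_j(s) ds`. -/
def SclassAPos (T : ℝ) (𝕋 : PartitionSeq T) {d : ℕ}
    (a : ℝ → (Fin d → ℝ) → Fin d → Fin d → ℝ) : Set (ℝ → Fin d → ℝ) :=
  {S | ContinuousOn S (Set.Icc 0 T) ∧ (∀ t ∈ Set.Icc (0 : ℝ) T, ∀ i, 0 < S t i) ∧
    ∀ i j : Fin d, ∀ t ∈ Set.Icc (0 : ℝ) T,
      Tendsto (fun n => covSum T 𝕋 S i j t n) atTop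
        (𝓝 (∫ s in (0 : ℝ)..t, a s (S s) i j * S s i * S s j))}

/-- First partial derivative in the `i`-th space direction. -/
def pd1 {d : ℕ} (f : (Fin d → ℝ) → ℝ) (i : Fin d) (x : Fin d → ℝ) : ℝ :=
  fderiv ℝ f x (Pi.single i 1)

/-- Second partial derivative in the space directions `i, j`. -/
def pd2 {d : ℕ} (f : (Fin d → ℝ) → ℝ) (i j : Fin d) (x : Fin d → ℝ) : ℝ :=
  fderiv ℝ (fun y => pd1 f j y) x (Pi.single i 1)

/-- Time derivative (within the time interval `I`). -/
def tderiv {d : ℕ} (I : Set ℝ) (v : ℝ → (Fin d → ℝ) → ℝ) (t : ℝ) (x : Fin d → ℝ) : ℝ :=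
  derivWithin (fun τ => v τ x) I t

/-- `v` is of class `C^{1,2}(I × D)`: continuous on `I × D`, continuously differentiable in
`(t,x)` and twice continuously differentiable in `x` on `(int I) × D`, with all derivatives
admitting continuous extensions to `I × D`. -/
structure IsC12 {d : ℕ} (I : Set ℝ) (D : Set (Fin d → ℝ)) (v : ℝ → (Fin d → ℝ) → ℝ) : Prop where
  cont : ContinuousOn (fun p : ℝ × (Fin d → ℝ) => v p.1 p.2) (I ×ˢ D)
  diff : ∀ t ∈ interior I, ∀ x ∈ D,
    DifferentiableAt ℝ (fun p : ℝ × (Fin d → ℝ) => v p.1 p.2) (t, x)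
  diff2 : ∀ t ∈ interior I, ∀ x ∈ D, ∀ j : Fin d, DifferentiableAt ℝ (pd1 (v t) j) x
  derivs_extend : ∃ (gt : ℝ × (Fin d → ℝ) → ℝ) (gx : Fin d → ℝ × (Fin d → ℝ) → ℝ)
      (gxx : Fin d → Fin d → ℝ × (Fin d → ℝ) → ℝ),
    ContinuousOn gt (I ×ˢ D) ∧ (∀ i, ContinuousOn (gx i) (I ×ˢ D)) ∧
    (∀ i j, ContinuousOn (gxx i j) (I ×ˢ D)) ∧
    ∀ t ∈ interior I, ∀ x ∈ D,
      gt (t, x) = deriv (fun τ => v τ x) t ∧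
      (∀ i, gx i (t, x) = pd1 (v t) i x) ∧
      ∀ i j, gxx i j (t, x) = pd2 (v t) i j x

/-- Local Hölder continuity on a set. -/
def LocallyHolderOn {E : Type*} [PseudoMetricSpace E] (f : E → ℝ) (s : Set E) : Prop :=
  ∀ p ∈ s, ∃ U ∈ 𝓝[s] p, ∃ α C : ℝ, 0 < α ∧ α ≤ 1 ∧ 0 ≤ C ∧
    ∀ q ∈ U, ∀ q' ∈ U, |f q - f q'| ≤ C * dist q q' ^ α

section

open scoped BoundedContinuousFunction

/-- Space variables. -/
abbrev Sp (d : ℕ) := Fin d → ℝ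

/-- The space of bounded continuous functions of `(t, x)` that are uniformly `β`-Hölder in `x`
and vanish for `t ≤ 0`, encoded through their Hölder difference quotients. -/
def holderSub (d : ℕ) (β : ℝ) : Submodule ℝ
    ((ℝ × Sp d →ᵇ ℝ) × (ℝ × Sp d × {z : Sp d // z ≠ 0} →ᵇ ℝ)) where
  carrier := {p | (∀ X : ℝ × Sp d, X.1 ≤ 0 → p.1 X = 0) ∧
    ∀ (t : ℝ) (x : Sp d) (z : {z : Sp d // z ≠ 0}),
      p.1 (t, x + z.1) - p.1 (t, x) = p.2 (t, x, z) * ‖z.1‖ ^ β}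
  add_mem' := by
    rintro p q ⟨hp, hp'⟩ ⟨hq, hq'⟩
    refine ⟨fun X hX => by simp [hp X hX, hq X hX], fun t x z => ?_⟩
    have h1 := hp' t x z
    have h2 := hq' t x z
    simp only [Prod.fst_add, Prod.snd_add, BoundedContinuousFunction.coe_add, Pi.add_apply]
    linear_combination h1 + h2
  zero_mem' := by simp
  smul_mem' := by
    rintro c p ⟨hp, hp'⟩
    refine ⟨fun X hX => by simp [hp X hX], fun t x z => ?_⟩
    have h1 := hp' t x z
    simp only [Prod.smul_fst, Prod.smul_snd, BoundedContinuousFunction.coe_smul, smul_eq_mul]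
    linear_combination c * h1

/-- The Banach space of parabolic right-hand sides. -/
def HY (d : ℕ) (β : ℝ) := ↥(holderSub d β)

instance (d : ℕ) (β : ℝ) : NormedAddCommGroup (HY d β) :=
  inferInstanceAs (NormedAddCommGroup ↥(holderSub d β))

instance (d : ℕ) (β : ℝ) : NormedSpace ℝ (HY d β) :=
  inferInstanceAs (NormedSpace ℝ ↥(holderSub d β))

theorem isClosed_holderSub (d : ℕ) (β : ℝ) :
    IsClosed (holderSub d β : Set ((ℝ × Sp d →ᵇ ℝ) × (ℝ × Sp d × {z : Sp d // z ≠ 0} →ᵇ ℝ))) := by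
  have e1 (X : ℝ × Sp d) : Continuous fun p : (ℝ × Sp d →ᵇ ℝ) ×
      (ℝ × Sp d × {z : Sp d // z ≠ 0} →ᵇ ℝ) => p.1 X :=
    (BoundedContinuousFunction.lipschitz_eval_const X).continuous.comp continuous_fst
  have e2 (X : ℝ × Sp d × {z : Sp d // z ≠ 0}) : Continuous fun p : (ℝ × Sp d →ᵇ ℝ) ×
      (ℝ × Sp d × {z : Sp d // z ≠ 0} →ᵇ ℝ) => p.2 X :=
    (BoundedContinuousFunction.lipschitz_eval_const X).continuous.comp continuous_snd
  have : (holderSub d β : Set ((ℝ × Sp d →ᵇ ℝ) × (ℝ × Sp d × {z : Sp d // z ≠ 0} →ᵇ ℝ))) =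
      (⋂ (X : ℝ × Sp d) (_ : X.1 ≤ 0), {p | p.1 X = 0}) ∩
      ⋂ (t : ℝ) (x : Sp d) (z : {z : Sp d // z ≠ 0}),
        {p | p.1 (t, x + z.1) - p.1 (t, x) = p.2 (t, x, z) * ‖z.1‖ ^ β} := by
    ext p
    simp only [holderSub, SetLike.mem_coe, Set.mem_inter_iff, Set.mem_iInter, Set.mem_ofPred_eq]
    exact Iff.rfl
  rw [this]
  refine IsClosed.inter (isClosed_iInter fun X => isClosed_iInter fun _ => ?_)
    (isClosed_iInter fun t => isClosed_iInter fun x => isClosed_iInter fun z => ?_)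
  · exact isClosed_eq (e1 X) continuous_const
  · exact isClosed_eq ((e1 _).sub (e1 _)) ((e2 _).mul continuous_const)

instance (d : ℕ) (β : ℝ) : CompleteSpace (HY d β) :=
  (isClosed_holderSub d β).completeSpace_coe

namespace HY

variable {d : ℕ} {β : ℝ}

/-- Evaluation. -/
def ev (g : HY d β) (t : ℝ) (x : Sp d) : ℝ := g.1.1 (t, x)

@[simp] theorem ev_add (f g : HY d β) (t : ℝ) (x : Sp d) : ev (f + g) t x = ev f t x + ev g t x :=
  rfl
@[simp] theorem ev_sub (f g : HY d β) (t : ℝ) (x : Sp d) : ev (f - g) t x = ev f t x - ev g t x :=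
  rfl
@[simp] theorem ev_smul (c : ℝ) (f : HY d β) (t : ℝ) (x : Sp d) : ev (c • f) t x = c * ev f t x :=
  rfl
@[simp] theorem ev_neg (f : HY d β) (t : ℝ) (x : Sp d) : ev (-f) t x = -ev f t x := rfl
@[simp] theorem ev_zero (t : ℝ) (x : Sp d) : ev (0 : HY d β) t x = 0 := rfl

@[simp] theorem ev_sum {ι : Type*} (s : Finset ι) (f : ι → HY d β) (t : ℝ) (x : Sp d) :
    ev (∑ i ∈ s, f i) t x = ∑ i ∈ s, ev (f i) t x := by
  classical
  induction s using Finset.induction_on with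
  | empty => simp
  | insert a s ha ih => rw [Finset.sum_insert ha, Finset.sum_insert ha, ev_add, ih]

theorem ev_nonpos (g : HY d β) {t : ℝ} (ht : t ≤ 0) (x : Sp d) : ev g t x = 0 := g.2.1 (t, x) ht

theorem continuous_ev (g : HY d β) : Continuous fun p : ℝ × Sp d => ev g p.1 p.2 :=
  g.1.1.continuous

theorem abs_ev_le (g : HY d β) (t : ℝ) (x : Sp d) : |ev g t x| ≤ ‖g‖ :=
  (g.1.1.norm_coe_le_norm (t, x)).trans (norm_fst_le g.1)

theorem abs_ev_sub_le (hβ : 0 < β) (g : HY d β) (t : ℝ) (x y : Sp d) :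
    |ev g t x - ev g t y| ≤ ‖g‖ * ‖x - y‖ ^ β := by
  by_cases h : x - y = 0
  · rw [sub_eq_zero.1 h]; simp [Real.zero_rpow hβ.ne']
  · have := g.2.2 t y ⟨x - y, h⟩
    simp only [add_sub_cancel] at this
    unfold ev
    rw [this, abs_mul, abs_of_nonneg (Real.rpow_nonneg (norm_nonneg _) _)]
    gcongr
    exact (g.1.2.norm_coe_le_norm _).trans (norm_snd_le g.1)

@[ext] theorem ext_ev {f g : HY d β} (h : ∀ t x, ev f t x = ev g t x) : f = g := by
  have h1 : f.1.1 = g.1.1 := by ext ⟨t, x⟩; exact h t x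
  refine Subtype.ext (Prod.ext h1 ?_)
  ext ⟨t, x, z⟩
  have hf := f.2.2 t x z
  have hg := g.2.2 t x z
  rw [h1, hg] at hf
  exact (mul_right_cancel₀ (Real.rpow_pos_of_pos (norm_pos_iff.2 z.2) _).ne' hf).symm

/-- Construction of an element with norm at most `M`. -/
theorem exists_mk {f : ℝ → Sp d → ℝ} (hc : Continuous fun p : ℝ × Sp d => f p.1 p.2) {M : ℝ}
    (hM : 0 ≤ M) (hb : ∀ t x, |f t x| ≤ M) (hh : ∀ t x y, |f t x - f t y| ≤ M * ‖x - y‖ ^ β)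
    (h0 : ∀ t ≤ 0, ∀ x, f t x = 0) :
    ∃ g : HY d β, (∀ t x, ev g t x = f t x) ∧ ‖g‖ ≤ M := by
  let q : ℝ × Sp d × {z : Sp d // z ≠ 0} → ℝ :=
    fun p => (f p.1 (p.2.1 + p.2.2.1) - f p.1 p.2.1) / ‖p.2.2.1‖ ^ β
  have hpos (z : {z : Sp d // z ≠ 0}) : 0 < ‖z.1‖ ^ β :=
    Real.rpow_pos_of_pos (norm_pos_iff.2 z.2) _
  have hq : Continuous q := by
    refine Continuous.div (Continuous.sub ?_ ?_) ?_ fun p => (hpos _).ne'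
    · exact hc.comp (f := fun p : ℝ × Sp d × {z : Sp d // z ≠ 0} => (p.1, p.2.1 + p.2.2.1))
        (by fun_prop)
    · exact hc.comp (f := fun p : ℝ × Sp d × {z : Sp d // z ≠ 0} => (p.1, p.2.1)) (by fun_prop)
    · refine Continuous.rpow_const (by fun_prop) fun p => Or.inl ?_
      exact (norm_pos_iff.2 p.2.2.2).ne'
  have hqb (p) : ‖q p‖ ≤ M := by
    rw [Real.norm_eq_abs, abs_div, abs_of_pos (hpos _), div_le_iff₀ (hpos _)]
    simpa using hh p.1 (p.2.1 + p.2.2.1) p.2.1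
  let F : ℝ × Sp d →ᵇ ℝ := BoundedContinuousFunction.ofNormedAddCommGroup _ hc M
    fun p => hb p.1 p.2
  let G : ℝ × Sp d × {z : Sp d // z ≠ 0} →ᵇ ℝ :=
    BoundedContinuousFunction.ofNormedAddCommGroup q hq M hqb
  refine ⟨⟨(F, G), fun X hX => h0 _ hX _, fun t x z => ?_⟩, fun t x => rfl, ?_⟩
  · change f t (x + z.1) - f t x = (f t (x + z.1) - f t x) / ‖z.1‖ ^ β * ‖z.1‖ ^ β
    rw [div_mul_cancel₀ _ (hpos z).ne']
  · exact max_le (BoundedContinuousFunction.norm_ofNormedAddCommGroup_le hc hM fun p => hb p.1 p.2)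
      (BoundedContinuousFunction.norm_ofNormedAddCommGroup_le hq hM hqb)

/-- Construction of a bounded operator. -/
theorem exists_op {F : HY d β → ℝ → Sp d → ℝ} {C : ℝ} (hC : 0 ≤ C)
    (hc : ∀ g, Continuous fun p : ℝ × Sp d => F g p.1 p.2)
    (hb : ∀ g t x, |F g t x| ≤ C * ‖g‖)
    (hh : ∀ g t x y, |F g t x - F g t y| ≤ C * ‖g‖ * ‖x - y‖ ^ β)
    (h0 : ∀ g, ∀ t ≤ 0, ∀ x, F g t x = 0)
    (hadd : ∀ f g t x, F (f + g) t x = F f t x + F g t x)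
    (hsmul : ∀ (c : ℝ) f t x, F (c • f) t x = c * F f t x) :
    ∃ T : HY d β →L[ℝ] HY d β, (∀ g t x, ev (T g) t x = F g t x) ∧ ‖T‖ ≤ C := by
  choose T hT hTn using fun g => exists_mk (hc g) (mul_nonneg hC (norm_nonneg g)) (hb g) (hh g)
    (h0 g)
  let L : HY d β →ₗ[ℝ] HY d β :=
    { toFun := T
      map_add' := fun f g => by ext t x; rw [ev_add, hT, hT, hT, hadd]
      map_smul' := fun c f => by
        ext t x; rw [hT, hsmul, RingHom.id_apply, ev_smul, hT] }
  exact ⟨L.mkContinuous C hTn, hT, L.mkContinuous_norm_le hC hTn⟩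

/-- Multiplication by a bounded function that is Hölder in space. -/
theorem exists_mul (hβ : 0 < β) {m : ℝ → Sp d → ℝ}
    (hc : Continuous fun p : ℝ × Sp d => m p.1 p.2) {M : ℝ} (hM : 0 ≤ M)
    (hb : ∀ t x, |m t x| ≤ M) (hh : ∀ t x y, |m t x - m t y| ≤ M * ‖x - y‖ ^ β) :
    ∃ T : HY d β →L[ℝ] HY d β, (∀ g t x, ev (T g) t x = m t x * ev g t x) ∧ ‖T‖ ≤ 2 * M := by
  refine exists_op (F := fun g t x => m t x * ev g t x) (by positivity)
    (fun g => hc.mul (continuous_ev g)) (fun g t x => ?_) (fun g t x y => ?_)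
    (fun g t ht x => by simp [ev_nonpos g ht]) (fun f g t x => by simp; ring)
    (fun c f t x => by simp; ring)
  · rw [abs_mul]
    have := mul_le_mul (hb t x) (abs_ev_le g t x) (abs_nonneg _) hM
    nlinarith [mul_nonneg hM (norm_nonneg g)]
  · have e : m t x * ev g t x - m t y * ev g t y =
      m t x * (ev g t x - ev g t y) + (m t x - m t y) * ev g t y := by ring
    rw [e]
    refine (abs_add_le _ _).trans ?_
    rw [abs_mul, abs_mul]
    have h1 := mul_le_mul (hb t x) (abs_ev_sub_le hβ g t x y) (abs_nonneg _) hM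
    have h2 := mul_le_mul (hh t x y) (abs_ev_le g t y) (abs_nonneg _)
      (mul_nonneg hM (Real.rpow_nonneg (norm_nonneg (x - y)) β))
    linarith

/-- A small perturbation of the identity is invertible, with inverse bounded by `2`. -/
theorem exists_inverse (B : HY d β →L[ℝ] HY d β) (hB : ‖B‖ ≤ 1 / 2) :
    ∃ J : HY d β →L[ℝ] HY d β, (∀ g, J g - B (J g) = g) ∧ ‖J‖ ≤ 2 := by
  have hlt : ‖B‖ < 1 := by linarith
  let u := Units.oneSub B hlt
  have hJ (g) : (↑u⁻¹ : HY d β →L[ℝ] HY d β) g - B ((↑u⁻¹ : HY d β →L[ℝ] HY d β) g) = g := by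
    have := congrArg (fun T : HY d β →L[ℝ] HY d β => T g) u.mul_inv
    simpa [u] using this
  refine ⟨↑u⁻¹, hJ, ContinuousLinearMap.opNorm_le_bound _ (by norm_num) fun g => ?_⟩
  have h1 : (↑u⁻¹ : HY d β →L[ℝ] HY d β) g = g + B ((↑u⁻¹ : HY d β →L[ℝ] HY d β) g) := by
    rw [← sub_eq_iff_eq_add]; exact hJ g
  have h2 := norm_add_le g (B ((↑u⁻¹ : HY d β →L[ℝ] HY d β) g))
  rw [← h1] at h2
  have h3 := B.le_opNorm ((↑u⁻¹ : HY d β →L[ℝ] HY d β) g)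
  nlinarith [norm_nonneg ((↑u⁻¹ : HY d β →L[ℝ] HY d β) g)]

end HY

open MeasureTheory

variable {d : ℕ} {β : ℝ}

/-- The linear form with coefficients `c`. -/
def lin (c : Fin d → ℝ) : Sp d →L[ℝ] ℝ := ∑ i, c i • ContinuousLinearMap.proj i

theorem lin_apply (c : Fin d → ℝ) (x : Sp d) : lin c x = ∑ i, c i * x i := by
  simp [lin, _root_.sum_apply]

@[simp] theorem lin_single (c : Fin d → ℝ) (i : Fin d) : lin c (Pi.single i 1) = c i := by
  rw [lin_apply]; simp [Pi.single_apply]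

theorem norm_lin_le (c : Fin d → ℝ) : ‖lin c‖ ≤ ∑ i, |c i| := by
  refine ContinuousLinearMap.opNorm_le_bound _ (Finset.sum_nonneg fun i _ => abs_nonneg _) fun x => ?_
  rw [lin_apply, Finset.sum_mul, Real.norm_eq_abs]
  refine (Finset.abs_sum_le_sum_abs _ _).trans (Finset.sum_le_sum fun i _ => ?_)
  rw [abs_mul]
  exact mul_le_mul_of_nonneg_left (norm_le_pi_norm x i) (abs_nonneg _)

theorem lin_add (c e : Fin d → ℝ) : lin (fun i => c i + e i) = lin c + lin e := by
  ext x; simp [lin_apply, add_mul, Finset.sum_add_distrib]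

theorem lin_smul (a : ℝ) (c : Fin d → ℝ) : lin (fun i => a * c i) = a • lin c := by
  ext x; simp [lin_apply, Finset.mul_sum, mul_assoc]

theorem lin_neg (c : Fin d → ℝ) : lin (fun i => - c i) = - lin c := by
  ext x; simp [lin_apply]

theorem lin_eq_of_apply_single (L : Sp d →L[ℝ] ℝ) : L = lin fun i => L (Pi.single i 1) := by
  ext x
  rw [lin_apply]
  conv_lhs => rw [pi_eq_sum_univ' x]
  simp [map_sum, mul_comm]

theorem continuous_lin {X : Type*} [TopologicalSpace X] {c : X → Fin d → ℝ}
    (h : ∀ i, Continuous fun p => c p i) : Continuous fun p => lin (c p) := by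
  unfold lin
  exact continuous_finsetSum _ fun i _ => (h i).smul continuous_const

/-- Continuous kernels decaying faster than any power. -/
def IsKer (ψ : Sp d → ℝ) : Prop :=
  Continuous ψ ∧ ∀ N : ℕ, ∃ C, ∀ z, (1 + ‖z‖) ^ N * |ψ z| ≤ C

theorem integrable_decay : Integrable fun z : Sp d => ((1 + ‖z‖) ^ (d + 1))⁻¹ := by
  have := integrable_one_add_norm (E := Sp d) (μ := volume) (r := (d + 1 : ℕ)) (by simp)
  refine this.congr (Eventually.of_forall fun z => ?_)
  simp only
  rw [Real.rpow_neg (by positivity), Real.rpow_natCast]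

theorem IsKer.exists_bound {ψ : Sp d → ℝ} (h : IsKer ψ) (k : ℕ) :
    ∃ b : Sp d → ℝ, Integrable b ∧ ∀ z e : Sp d, ‖e‖ ≤ 1 → (1 + ‖z‖) ^ k * |ψ (z - e)| ≤ b z := by
  obtain ⟨C, hC⟩ := h.2 (k + (d + 1))
  refine ⟨fun z => 2 ^ (k + (d + 1)) * C * ((1 + ‖z‖) ^ (d + 1))⁻¹, integrable_decay.const_mul _,
    fun z e he => ?_⟩
  have h1 : 1 + ‖z‖ ≤ 2 * (1 + ‖z - e‖) := by
    have := norm_add_le (z - e) e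
    rw [sub_add_cancel] at this
    linarith [norm_nonneg (z - e)]
  rw [le_mul_inv_iff₀ (by positivity)]
  calc (1 + ‖z‖) ^ k * |ψ (z - e)| * (1 + ‖z‖) ^ (d + 1)
      = (1 + ‖z‖) ^ (k + (d + 1)) * |ψ (z - e)| := by ring
    _ ≤ (2 * (1 + ‖z - e‖)) ^ (k + (d + 1)) * |ψ (z - e)| := by gcongr
    _ = 2 ^ (k + (d + 1)) * ((1 + ‖z - e‖) ^ (k + (d + 1)) * |ψ (z - e)|) := by rw [mul_pow]; ring
    _ ≤ _ := by gcongr; exact hC _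

theorem IsKer.integrable_pow {ψ : Sp d → ℝ} (h : IsKer ψ) (k : ℕ) :
    Integrable fun z => (1 + ‖z‖) ^ k * |ψ z| := by
  obtain ⟨b, hb, hb'⟩ := h.exists_bound k
  refine hb.mono' ?_ (Eventually.of_forall fun z => ?_)
  · have := h.1
    exact Continuous.aestronglyMeasurable (by fun_prop)
  · have := hb' z 0 (by simp)
    rw [sub_zero] at this
    rwa [Real.norm_eq_abs, abs_of_nonneg (by positivity)]

theorem IsKer.integrable {ψ : Sp d → ℝ} (h : IsKer ψ) : Integrable ψ := by
  have := h.integrable_pow 0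
  simp only [pow_zero, one_mul] at this
  exact (integrable_norm_iff h.1.aestronglyMeasurable).1 this

theorem IsKer.integrable_rpow {ψ : Sp d → ℝ} (h : IsKer ψ) (h0 : 0 < β) (h1 : β < 1) :
    Integrable fun z => ‖z‖ ^ β * |ψ z| := by
  refine (h.integrable_pow 1).mono' ?_ (Eventually.of_forall fun z => ?_)
  · have := h.1
    refine Continuous.aestronglyMeasurable (Continuous.mul ?_ (by fun_prop))
    exact Continuous.rpow_const (by fun_prop) fun _ => Or.inr h0.le
  · rw [Real.norm_eq_abs, abs_of_nonneg (by positivity), pow_one]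
    gcongr
    calc ‖z‖ ^ β ≤ (1 + ‖z‖) ^ β := by gcongr; linarith
      _ ≤ (1 + ‖z‖) ^ (1 : ℝ) :=
        Real.rpow_le_rpow_of_exponent_le (by linarith [norm_nonneg z]) h1.le
      _ = _ := Real.rpow_one _

theorem IsKer.add {ψ φ : Sp d → ℝ} (h : IsKer ψ) (h' : IsKer φ) : IsKer fun z => ψ z + φ z := by
  refine ⟨h.1.add h'.1, fun N => ?_⟩
  obtain ⟨C, hC⟩ := h.2 N
  obtain ⟨C', hC'⟩ := h'.2 N
  refine ⟨C + C', fun z => ?_⟩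
  have := mul_le_mul_of_nonneg_left (abs_add_le (ψ z) (φ z)) (by positivity : 0 ≤ (1 + ‖z‖) ^ N)
  linarith [hC z, hC' z]

theorem IsKer.smul {ψ : Sp d → ℝ} (h : IsKer ψ) (c : ℝ) : IsKer fun z => c * ψ z := by
  refine ⟨continuous_const.mul h.1, fun N => ?_⟩
  obtain ⟨C, hC⟩ := h.2 N
  refine ⟨|c| * C, fun z => ?_⟩
  rw [abs_mul]
  calc _ = |c| * ((1 + ‖z‖) ^ N * |ψ z|) := by ring
    _ ≤ _ := by gcongr; exact hC z

theorem isKer_zero : IsKer (fun _ : Sp d => (0 : ℝ)) :=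
  ⟨continuous_const, fun N => ⟨0, fun z => by simp⟩⟩

theorem IsKer.sum {ι : Type*} (s : Finset ι) {ψ : ι → Sp d → ℝ} (h : ∀ i, IsKer (ψ i)) :
    IsKer fun z => ∑ i ∈ s, ψ i z := by
  classical
  induction s using Finset.induction_on with
  | empty => simpa using isKer_zero
  | insert a s ha ih => simp only [Finset.sum_insert ha]; exact (h a).add ih

theorem IsKer.coord_mul {ψ : Sp d → ℝ} (h : IsKer ψ) (i : Fin d) : IsKer fun z => z i * ψ z := by
  have := h.1
  refine ⟨by fun_prop, fun N => ?_⟩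
  obtain ⟨C, hC⟩ := h.2 (N + 1)
  refine ⟨C, fun z => (le_trans ?_ (hC z))⟩
  rw [abs_mul, pow_succ, mul_assoc]
  gcongr
  have := norm_le_pi_norm z i
  rw [Real.norm_eq_abs] at this
  linarith

/-- `ψ` is a kernel whose partial derivatives are the kernels `ψ' i`. -/
structure HasKerDeriv (ψ : Sp d → ℝ) (ψ' : Fin d → Sp d → ℝ) : Prop where
  ker : IsKer ψ
  ker' : ∀ i, IsKer (ψ' i)
  deriv : ∀ z, HasFDerivAt ψ (lin fun i => ψ' i z) z

theorem HasKerDeriv.translate {ψ : Sp d → ℝ} {ψ' : Fin d → Sp d → ℝ} (h : HasKerDeriv ψ ψ')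
    {G : Sp d → ℝ} (hG : Continuous G) {M : ℝ} (hM : ∀ z, |G z| ≤ M) :
    HasFDerivAt (fun e => ∫ z, G z * ψ (z - e)) (lin fun i => -∫ z, G z * ψ' i z) 0 := by
  have hM0 : 0 ≤ M := (abs_nonneg _).trans (hM 0)
  choose b hb hb' using fun i => (h.ker' i).exists_bound 0
  have hInt (i) : Integrable fun z => G z * ψ' i z :=
    (h.ker' i).integrable.bdd_mul hG.aestronglyMeasurable (Eventually.of_forall hM)
  have hInt0 : Integrable fun z => G z * ψ z :=
    h.ker.integrable.bdd_mul hG.aestronglyMeasurable (Eventually.of_forall hM)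
  have key := hasFDerivAt_integral_of_dominated_of_fderiv_le (𝕜 := ℝ) (μ := volume)
    (F := fun e z => G z * ψ (z - e)) (F' := fun e z => lin fun i => -(G z * ψ' i (z - e)))
    (x₀ := (0 : Sp d)) (bound := fun z => M * ∑ i, b i z) (Metric.ball_mem_nhds 0 one_pos)
    (Eventually.of_forall fun e => by
      have := h.ker.1
      exact Continuous.aestronglyMeasurable (by fun_prop))
    (by simpa using hInt0)
    (by
      refine Continuous.aestronglyMeasurable (continuous_lin fun i => ?_)
      have := (h.ker' i).1
      fun_prop)
    (Eventually.of_forall fun z e he => by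
      refine (norm_lin_le _).trans ?_
      rw [Finset.mul_sum]
      refine Finset.sum_le_sum fun i _ => ?_
      rw [abs_neg, abs_mul]
      have := hb' i z e (by simpa using (mem_ball_zero_iff.1 he).le)
      rw [pow_zero, one_mul] at this
      exact mul_le_mul (hM z) this (abs_nonneg _) hM0)
    ((integrable_finsetSum _ fun i _ => hb i).const_mul M)
    (Eventually.of_forall fun z e _ => by
      have h1 : HasFDerivAt (fun e : Sp d => z - e) (-ContinuousLinearMap.id ℝ (Sp d)) e := by
        exact (hasFDerivAt_id (𝕜 := ℝ) e).const_sub z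
      have h2 := ((h.deriv (z - e)).comp e h1).const_mul (G z)
      refine h2.congr_fderiv ?_
      ext x
      simp [lin_apply, Finset.mul_sum]
      exact Finset.sum_congr rfl fun i _ => by ring)
  refine key.congr_fderiv ?_
  have : (fun z => lin fun i => -(G z * ψ' i (z - 0))) =
      fun z => ∑ i, (-(G z * ψ' i z)) • (ContinuousLinearMap.proj i : Sp d →L[ℝ] ℝ) := by
    simp [lin]
  have hi (i) : Integrable fun z => (-(G z * ψ' i z)) •
      (ContinuousLinearMap.proj i : Sp d →L[ℝ] ℝ) := (hInt i).neg.smul_const _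
  rw [this, integral_finsetSum _ fun i _ => hi i]
  unfold lin
  refine Finset.sum_congr rfl fun i _ => ?_
  rw [integral_smul_const, integral_neg]

theorem HasKerDeriv.integral_eq_zero {ψ : Sp d → ℝ} {ψ' : Fin d → Sp d → ℝ}
    (h : HasKerDeriv ψ ψ') (i : Fin d) : ∫ z, ψ' i z = 0 := by
  have h1 := h.translate (G := fun _ => 1) continuous_const (M := 1) (by simp)
  have h2 : (fun e => ∫ z, (1 : ℝ) * ψ (z - e)) = fun _ => ∫ z, ψ z := by
    ext e
    simp only [one_mul]
    exact integral_sub_right_eq_self ψ e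
  rw [h2] at h1
  have h3 := congrArg (fun L : Sp d →L[ℝ] ℝ => L (Pi.single i 1))
    (h1.unique (hasFDerivAt_const _ _))
  simpa using h3

/-- The rescaled convolution of `G` with the kernel `ψ`. -/
def Qk (ψ : Sp d → ℝ) (G : Sp d → ℝ) (s : ℝ) (x : Sp d) : ℝ := ∫ z, G (x + √s • z) * ψ z

theorem integrable_Qk {ψ : Sp d → ℝ} (h : IsKer ψ) {G : Sp d → ℝ} (hG : Continuous G) {M : ℝ}
    (hM : ∀ z, |G z| ≤ M) (s : ℝ) (x : Sp d) : Integrable fun z => G (x + √s • z) * ψ z :=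
  h.integrable.bdd_mul (Continuous.aestronglyMeasurable (by fun_prop))
    (Eventually.of_forall fun z => hM _)

theorem HasKerDeriv.hasFDerivAt_Qk {ψ : Sp d → ℝ} {ψ' : Fin d → Sp d → ℝ} (h : HasKerDeriv ψ ψ')
    {G : Sp d → ℝ} (hG : Continuous G) {M : ℝ} (hM : ∀ z, |G z| ≤ M) {s : ℝ} (hs : 0 < s)
    (x : Sp d) :
    HasFDerivAt (Qk ψ G s) (lin fun i => -((√s)⁻¹ * Qk (ψ' i) G s x)) x := by
  have hs' : √s ≠ 0 := (Real.sqrt_pos.2 hs).ne'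
  have h1 := h.translate (G := fun z => G (x + √s • z)) (by fun_prop) (M := M) fun z => hM _
  have h2 : Qk ψ G s = (fun e => ∫ z, G (x + √s • z) * ψ (z - e)) ∘
      fun y => (√s)⁻¹ • (y - x) := by
    ext y
    simp only [Qk, Function.comp]
    rw [← integral_sub_right_eq_self (fun z => G (y + √s • z) * ψ z) ((√s)⁻¹ • (y - x))]
    congr 1
    ext z
    rw [smul_sub, smul_inv_smul₀ hs']
    congr 2
    abel
  have h3 : HasFDerivAt (fun y : Sp d => (√s)⁻¹ • (y - x))
      ((√s)⁻¹ • ContinuousLinearMap.id ℝ (Sp d)) x :=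
    ((hasFDerivAt_id (𝕜 := ℝ) x).sub_const x).const_smul (√s)⁻¹
  rw [h2]
  have h1' : HasFDerivAt (fun e => ∫ z, G (x + √s • z) * ψ (z - e))
    (lin fun i => -∫ z, G (x + √s • z) * ψ' i z) ((√s)⁻¹ • (x - x)) := by simpa using h1
  refine (h1'.comp x h3).congr_fderiv ?_
  ext y
  simp [lin_apply, Qk, Finset.mul_sum]
  exact Finset.sum_congr rfl fun i _ => by ring

open HY

theorem continuous_Qk {ψ : Sp d → ℝ} (h : IsKer ψ) (g : HY d β) :
    Continuous fun p : ℝ × ℝ × Sp d => Qk ψ (ev g p.2.1) p.1 p.2.2 := by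
  have hψ := h.1
  refine continuous_of_dominated (bound := fun z => ‖g‖ * |ψ z|) (fun p => ?_)
    (fun p => Eventually.of_forall fun z => ?_) (h.integrable.abs.const_mul _)
    (Eventually.of_forall fun z => ?_)
  · refine Continuous.aestronglyMeasurable (Continuous.mul ?_ hψ)
    exact (continuous_ev g).comp (f := fun z : Sp d => (p.2.1, p.2.2 + √p.1 • z)) (by fun_prop)
  · rw [Real.norm_eq_abs, abs_mul]
    exact mul_le_mul_of_nonneg_right (abs_ev_le _ _ _) (abs_nonneg _)
  · refine Continuous.mul ?_ continuous_const
    exact (continuous_ev g).comp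
      (f := fun p : ℝ × ℝ × Sp d => (p.2.1, p.2.2 + √p.1 • z)) (by fun_prop)

theorem continuous_ev_right (g : HY d β) (t : ℝ) : Continuous (ev g t) :=
  (continuous_ev g).comp (f := fun z : Sp d => (t, z)) (by fun_prop)

theorem abs_Qk_le {ψ : Sp d → ℝ} (h : IsKer ψ) (g : HY d β) (s r : ℝ) (x : Sp d) :
    |Qk ψ (ev g r) s x| ≤ (∫ z, |ψ z|) * ‖g‖ := by
  rw [mul_comm, ← integral_const_mul, ← Real.norm_eq_abs]
  refine norm_integral_le_of_norm_le (h.integrable.abs.const_mul _) (Eventually.of_forall fun z => ?_)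
  rw [Real.norm_eq_abs, abs_mul]
  exact mul_le_mul_of_nonneg_right (abs_ev_le _ _ _) (abs_nonneg _)

theorem abs_Qk_sub_le (hβ : 0 < β) {ψ : Sp d → ℝ} (h : IsKer ψ) (g : HY d β) (s r : ℝ)
    (x y : Sp d) :
    |Qk ψ (ev g r) s x - Qk ψ (ev g r) s y| ≤ (∫ z, |ψ z|) * ‖g‖ * ‖x - y‖ ^ β := by
  have e : (∫ z, |ψ z|) * ‖g‖ * ‖x - y‖ ^ β = ∫ z, (‖g‖ * ‖x - y‖ ^ β) * |ψ z| := by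
    rw [integral_const_mul]; ring
  unfold Qk
  rw [e, ← integral_sub (integrable_Qk h (continuous_ev_right g r) (abs_ev_le g r) s x)
    (integrable_Qk h (continuous_ev_right g r) (abs_ev_le g r) s y), ← Real.norm_eq_abs]
  refine norm_integral_le_of_norm_le (h.integrable.abs.const_mul _) (Eventually.of_forall fun z => ?_)
  rw [Real.norm_eq_abs, ← sub_mul, abs_mul]
  refine mul_le_mul_of_nonneg_right ?_ (abs_nonneg _)
  simpa using abs_ev_sub_le hβ g r (x + √s • z) (y + √s • z)

theorem abs_Qk_le_of_integral_eq_zero (h0 : 0 < β) (h1 : β < 1) {ψ : Sp d → ℝ} (h : IsKer ψ)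
    (hψ : ∫ z, ψ z = 0) (g : HY d β) {s : ℝ} (hs : 0 < s) (r : ℝ) (x : Sp d) :
    |Qk ψ (ev g r) s x| ≤ (∫ z, ‖z‖ ^ β * |ψ z|) * s ^ (β / 2) * ‖g‖ := by
  have e : Qk ψ (ev g r) s x = ∫ z, (ev g r (x + √s • z) - ev g r x) * ψ z := by
    simp only [sub_mul]
    rw [integral_sub (integrable_Qk h (continuous_ev_right g r) (abs_ev_le g r) s x)
      (h.integrable.const_mul _), integral_const_mul, hψ, mul_zero, sub_zero]
    rfl
  have e2 : (∫ z, ‖z‖ ^ β * |ψ z|) * s ^ (β / 2) * ‖g‖ =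
      ∫ z, (s ^ (β / 2) * ‖g‖) * (‖z‖ ^ β * |ψ z|) := by
    rw [integral_const_mul]; ring
  rw [e, e2, ← Real.norm_eq_abs]
  refine norm_integral_le_of_norm_le ((h.integrable_rpow h0 h1).const_mul _)
    (Eventually.of_forall fun z => ?_)
  rw [Real.norm_eq_abs, abs_mul, ← mul_assoc]
  refine mul_le_mul_of_nonneg_right ?_ (abs_nonneg _)
  have h2 : √s ^ β = s ^ (β / 2) := by
    rw [Real.sqrt_eq_rpow, ← Real.rpow_mul hs.le, show 1 / 2 * β = β / 2 by ring]
  have := abs_ev_sub_le h0 g r (x + √s • z) x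
  rw [add_sub_cancel_left, norm_smul, Real.norm_of_nonneg (Real.sqrt_nonneg _),
    Real.mul_rpow (Real.sqrt_nonneg _) (norm_nonneg _), h2] at this
  linarith

/-- The weight of the parabolic potentials. -/
def wt (lam δ s : ℝ) : ℝ := s ^ δ * Real.exp (-(lam * s))

theorem wt_nonneg (lam δ : ℝ) {s : ℝ} (hs : 0 < s) : 0 ≤ wt lam δ s := by
  unfold wt; positivity

theorem wt_mul (lam δ γ : ℝ) {s : ℝ} (hs : 0 < s) : wt lam δ s * s ^ γ = wt lam (γ + δ) s := by
  unfold wt; rw [Real.rpow_add hs]; ring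

theorem integrableOn_wt {lam δ : ℝ} (hl : 0 < lam) (hδ : -1 < δ) :
    IntegrableOn (wt lam δ) (Ioi 0) := by
  have := integrableOn_rpow_mul_exp_neg_mul_rpow hδ one_pos hl
  refine this.congr_fun (fun s _ => ?_) measurableSet_Ioi
  simp [wt]

theorem integral_wt {lam δ : ℝ} (hl : 0 < lam) (hδ : -1 < δ) :
    ∫ s in Ioi 0, wt lam δ s = (1 / lam) ^ (δ + 1) * Real.Gamma (δ + 1) := by
  rw [← Real.integral_rpow_mul_exp_neg_mul_Ioi (by linarith) hl]
  simp [wt]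

theorem continuousOn_wt (lam δ : ℝ) : ContinuousOn (wt lam δ) (Ioi 0) := by
  refine ContinuousOn.mul (fun s hs => ?_) (by fun_prop)
  exact (Real.continuousAt_rpow_const s δ (Or.inl (ne_of_gt hs))).continuousWithinAt

/-- The parabolic potential with kernel `ψ`. -/
def Pot (κ : ℝ) (ψ : Sp d → ℝ) (lam : ℝ) (g : HY d β) (t : ℝ) (x : Sp d) : ℝ :=
  ∫ s in Ioi 0, wt lam (-κ) s * Qk ψ (ev g (t - s)) s x

/-- Power bound for the rescaled convolutions with a kernel. -/
structure QBound (β : ℝ) (ψ : Sp d → ℝ) (D γ : ℝ) : Prop where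
  ker : IsKer ψ
  nonneg : 0 ≤ D
  bound : ∀ (g : HY d β) {s : ℝ}, 0 < s → ∀ r x, |Qk ψ (ev g r) s x| ≤ D * s ^ γ * ‖g‖

theorem IsKer.qBound {ψ : Sp d → ℝ} (h : IsKer ψ) : QBound β ψ (∫ z, |ψ z|) 0 where
  ker := h
  nonneg := integral_nonneg fun _ => abs_nonneg _
  bound g s hs r x := by simpa using abs_Qk_le h g s r x

theorem IsKer.qBound' {ψ : Sp d → ℝ} (h : IsKer ψ) (h0 : 0 < β) (h1 : β < 1)
    (hψ : ∫ z, ψ z = 0) : QBound β ψ (∫ z, ‖z‖ ^ β * |ψ z|) (β / 2) where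
  ker := h
  nonneg := integral_nonneg fun _ => by positivity
  bound g s hs r x := abs_Qk_le_of_integral_eq_zero h0 h1 h hψ g hs r x

section

variable {ψ : Sp d → ℝ} {D γ κ lam : ℝ}

theorem aestronglyMeasurable_pot (h : IsKer ψ) (g : HY d β) (κ lam t : ℝ) (x : Sp d) :
    AEStronglyMeasurable (fun s => wt lam (-κ) s * Qk ψ (ev g (t - s)) s x)
      (volume.restrict (Ioi 0)) := by
  refine ContinuousOn.aestronglyMeasurable ((continuousOn_wt _ _).mul ?_) measurableSet_Ioi
  exact ((continuous_Qk h g).comp (f := fun s : ℝ => (s, t - s, x)) (by fun_prop)).continuousOn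

theorem QBound.pot_le (h : QBound β ψ D γ) (g : HY d β) (κ lam t : ℝ) (x : Sp d) {s : ℝ}
    (hs : s ∈ Ioi (0 : ℝ)) :
    ‖wt lam (-κ) s * Qk ψ (ev g (t - s)) s x‖ ≤ D * ‖g‖ * wt lam (γ - κ) s := by
  have e : wt lam (γ - κ) s = wt lam (-κ) s * s ^ γ := by rw [wt_mul _ _ _ hs, sub_eq_add_neg]
  rw [norm_mul, Real.norm_of_nonneg (wt_nonneg _ _ hs), Real.norm_eq_abs, e]
  calc _ ≤ wt lam (-κ) s * (D * s ^ γ * ‖g‖) :=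
        mul_le_mul_of_nonneg_left (h.bound g hs _ _) (wt_nonneg _ _ hs)
    _ = _ := by ring

theorem QBound.integrableOn (h : QBound β ψ D γ) (hl : 0 < lam) (hκ : -1 < γ - κ) (g : HY d β)
    (t : ℝ) (x : Sp d) :
    IntegrableOn (fun s => wt lam (-κ) s * Qk ψ (ev g (t - s)) s x) (Ioi 0) :=
  ((integrableOn_wt hl hκ).const_mul (D * ‖g‖)).mono' (aestronglyMeasurable_pot h.ker g _ _ _ _)
    ((ae_restrict_mem measurableSet_Ioi).mono fun _ hs => h.pot_le g _ _ _ _ hs)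

theorem QBound.continuous_pot (h : QBound β ψ D γ) (hl : 0 < lam) (hκ : -1 < γ - κ)
    (g : HY d β) : Continuous fun p : ℝ × Sp d => Pot κ ψ lam g p.1 p.2 := by
  refine continuous_of_dominated (bound := fun s => D * ‖g‖ * wt lam (γ - κ) s)
    (fun p => aestronglyMeasurable_pot h.ker g _ _ _ _)
    (fun p => (ae_restrict_mem measurableSet_Ioi).mono fun _ hs => h.pot_le g _ _ _ _ hs)
    ((integrableOn_wt hl hκ).const_mul _)
    (Eventually.of_forall fun s => continuous_const.mul ?_)
  exact (continuous_Qk h.ker g).comp (f := fun p : ℝ × Sp d => (s, p.1 - s, p.2)) (by fun_prop)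

theorem QBound.abs_pot_le (h : QBound β ψ D γ) (hl : 0 < lam) (hκ : -1 < γ - κ)
    (g : HY d β) (t : ℝ) (x : Sp d) :
    |Pot κ ψ lam g t x| ≤ D * (∫ s in Ioi 0, wt lam (γ - κ) s) * ‖g‖ := by
  rw [mul_right_comm, ← integral_const_mul, ← Real.norm_eq_abs]
  exact norm_integral_le_of_norm_le ((integrableOn_wt hl hκ).const_mul _)
    ((ae_restrict_mem measurableSet_Ioi).mono fun _ hs => h.pot_le g _ _ _ _ hs)

theorem pot_nonpos (κ : ℝ) (ψ : Sp d → ℝ) (lam : ℝ) (g : HY d β) {t : ℝ} (ht : t ≤ 0)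
    (x : Sp d) : Pot κ ψ lam g t x = 0 := by
  refine setIntegral_eq_zero_of_forall_eq_zero fun s hs => ?_
  have : ∀ y, ev g (t - s) y = 0 := ev_nonpos g (by linarith [mem_Ioi.1 hs])
  simp [Qk, this]

theorem QBound.pot_add (h : QBound β ψ D γ) (hl : 0 < lam) (hκ : -1 < γ - κ)
    (f g : HY d β) (t : ℝ) (x : Sp d) :
    Pot κ ψ lam (f + g) t x = Pot κ ψ lam f t x + Pot κ ψ lam g t x := by
  unfold Pot
  rw [← integral_add (h.integrableOn hl hκ f t x) (h.integrableOn hl hκ g t x)]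
  congr 1; ext s
  rw [← mul_add]
  congr 1
  unfold Qk
  rw [← integral_add (integrable_Qk h.ker (continuous_ev_right f _) (abs_ev_le f _) s x)
    (integrable_Qk h.ker (continuous_ev_right g _) (abs_ev_le g _) s x)]
  simp [add_mul]

theorem pot_smul (κ : ℝ) (ψ : Sp d → ℝ) (lam c : ℝ) (g : HY d β) (t : ℝ)
    (x : Sp d) : Pot κ ψ lam (c • g) t x = c * Pot κ ψ lam g t x := by
  unfold Pot
  rw [← integral_const_mul]
  congr 1; ext s
  simp only [Qk, ev_smul, mul_assoc, integral_const_mul]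
  ring

/-- Potentials with an integrable weight are bounded operators. -/
theorem IsKer.exists_pot (h : IsKer ψ) (hβ : 0 < β) (hl : 0 < lam) (hκ : κ < 1) :
    ∃ T : HY d β →L[ℝ] HY d β, (∀ g t x, ev (T g) t x = Pot κ ψ lam g t x) ∧
      ‖T‖ ≤ (∫ z, |ψ z|) * ∫ s in Ioi 0, wt lam (-κ) s := by
  have hQ : QBound β ψ (∫ z, |ψ z|) 0 := h.qBound
  have hκ' : -1 < 0 - κ := by linarith
  have hInt : 0 ≤ ∫ s in Ioi 0, wt lam (-κ) s :=
    setIntegral_nonneg measurableSet_Ioi fun s hs => wt_nonneg _ _ hs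
  refine exists_op (mul_nonneg hQ.nonneg hInt) (fun g => hQ.continuous_pot hl hκ' g)
    (fun g t x => by simpa using hQ.abs_pot_le hl hκ' g t x) (fun g t x y => ?_)
    (fun g t ht x => pot_nonpos _ _ _ g ht x) (hQ.pot_add hl hκ') (pot_smul _ _ _)
  unfold Pot
  rw [← integral_sub (hQ.integrableOn hl hκ' g t x) (hQ.integrableOn hl hκ' g t y)]
  have e : (∫ z, |ψ z|) * (∫ s in Ioi 0, wt lam (-κ) s) * ‖g‖ * ‖x - y‖ ^ β =
      ∫ s in Ioi 0, ((∫ z, |ψ z|) * ‖g‖ * ‖x - y‖ ^ β) * wt lam (-κ) s := by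
    rw [integral_const_mul]; ring
  rw [e, ← Real.norm_eq_abs]
  refine norm_integral_le_of_norm_le
    ((integrableOn_wt hl (by linarith : -1 < -κ)).const_mul _)
    ((ae_restrict_mem measurableSet_Ioi).mono fun s hs => ?_)
  rw [← mul_sub, norm_mul, Real.norm_of_nonneg (wt_nonneg _ _ hs), mul_comm]
  exact mul_le_mul_of_nonneg_right (abs_Qk_sub_le hβ h g s _ x y) (wt_nonneg _ _ hs)

theorem wt_le {δ s : ℝ} (hl : 0 ≤ lam) (hs : 0 < s) : wt lam δ s ≤ s ^ δ := by
  unfold wt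
  refine mul_le_of_le_one_right (by positivity) (Real.exp_le_one_iff.2 ?_)
  have := mul_nonneg hl hs.le
  linarith

/-- The singular integrals with cancellation are bounded operators. -/
theorem HasKerDeriv.exists_pot {ψ' : Fin d → Sp d → ℝ} (h : HasKerDeriv ψ ψ')
    (h0 : 0 < β) (h1 : β < 1) (hψ : ∫ z, ψ z = 0) :
    ∃ C, 0 ≤ C ∧ ∀ lam, 1 ≤ lam → ∃ T : HY d β →L[ℝ] HY d β,
      (∀ g t x, ev (T g) t x = Pot 1 ψ lam g t x) ∧ ‖T‖ ≤ C := by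
  have hQ := h.ker.qBound' h0 h1 hψ
  have hQ' (i) := (h.ker' i).qBound' h0 h1 (h.integral_eq_zero i)
  set D := ∫ z, ‖z‖ ^ β * |ψ z| with hD
  set D' := ∑ i, ∫ z, ‖z‖ ^ β * |ψ' i z| with hD'
  have hD0 : 0 ≤ D := hQ.nonneg
  have hD'0 : 0 ≤ D' := Finset.sum_nonneg fun i _ => (hQ' i).nonneg
  have hκ : -1 < β / 2 - 1 := by linarith
  refine ⟨D * (Real.Gamma (β / 2)) + 2 * D * (2 / β) + D' * (2 / (1 - β)), ?_, fun lam hl => ?_⟩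
  · have := Real.Gamma_pos_of_pos (half_pos h0)
    have : 0 < 1 - β := by linarith
    positivity
  have hl0 : 0 < lam := by linarith
  have hG := Real.Gamma_pos_of_pos (half_pos h0)
  have hc1 : 0 ≤ D * Real.Gamma (β / 2) := by positivity
  have hc2 : 0 ≤ 2 * D * (2 / β) := by positivity
  have hc3 : 0 ≤ D' * (2 / (1 - β)) := by
    have : 0 < 1 - β := by linarith
    positivity
  refine exists_op (by positivity) (fun g => hQ.continuous_pot hl0 hκ g)
    (fun g t x => ?_) (fun g t x y => ?_)
    (fun g t ht x => pot_nonpos _ _ _ g ht x) (hQ.pot_add hl0 hκ) (pot_smul _ _ _)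
  · refine (hQ.abs_pot_le hl0 hκ g t x).trans (mul_le_mul_of_nonneg_right ?_ (norm_nonneg _))
    rw [integral_wt hl0 hκ, sub_add_cancel]
    have : (1 / lam) ^ (β / 2) ≤ 1 :=
      Real.rpow_le_one (by positivity) ((div_le_one hl0).2 hl) (by positivity)
    have := mul_le_mul_of_nonneg_right this hG.le
    have := mul_le_mul_of_nonneg_left this hD0
    linarith
  · rcases eq_or_ne x y with rfl | hxy
    · simp only [sub_self, abs_zero]; positivity
    set r := ‖x - y‖ with hr
    have hr0 : 0 < r := norm_pos_iff.2 (sub_ne_zero.2 hxy)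
    have hr2 : 0 < r ^ 2 := by positivity
    set F : ℝ → ℝ := fun s => wt lam (-1) s * Qk ψ (ev g (t - s)) s x -
      wt lam (-1) s * Qk ψ (ev g (t - s)) s y with hF
    have hFi : IntegrableOn F (Ioi 0) :=
      (hQ.integrableOn hl0 hκ g t x).sub (hQ.integrableOn hl0 hκ g t y)
    have e1 : Pot 1 ψ lam g t x - Pot 1 ψ lam g t y = ∫ s in Ioi 0, F s :=
      (integral_sub (hQ.integrableOn hl0 hκ g t x) (hQ.integrableOn hl0 hκ g t y)).symm
    have e2 : ∫ s in Ioi 0, F s = (∫ s in Ioc 0 (r ^ 2), F s) + ∫ s in Ioi (r ^ 2), F s := by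
      rw [← setIntegral_union (Ioc_disjoint_Ioi le_rfl) measurableSet_Ioi
        (hFi.mono_set Ioc_subset_Ioi_self) (hFi.mono_set (Ioi_subset_Ioi hr2.le)),
        Ioc_union_Ioi_eq_Ioi hr2.le]
    have b1 : ‖∫ s in Ioc 0 (r ^ 2), F s‖ ≤ 2 * D * (2 / β) * ‖g‖ * r ^ β := by
      have hi : IntegrableOn (fun s : ℝ => s ^ (β / 2 - 1)) (Ioc 0 (r ^ 2)) :=
        (intervalIntegrable_iff_integrableOn_Ioc_of_le hr2.le).1
          (intervalIntegral.intervalIntegrable_rpow' hκ)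
      have hv : ∫ s in Ioc 0 (r ^ 2), s ^ (β / 2 - 1) = (2 / β) * r ^ β := by
        rw [← intervalIntegral.integral_of_le hr2.le, integral_rpow (Or.inl hκ), sub_add_cancel,
          Real.zero_rpow (by positivity), sub_zero, ← Real.rpow_natCast, ← Real.rpow_mul hr0.le]
        norm_num
        rw [show (2 : ℝ) * (β / 2) = β by ring]
        field_simp
      calc _ ≤ ∫ s in Ioc 0 (r ^ 2), 2 * D * ‖g‖ * s ^ (β / 2 - 1) := by
            refine norm_integral_le_of_norm_le (hi.const_mul _)
              ((ae_restrict_mem measurableSet_Ioc).mono fun s hs => ?_)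
            have h1 := hQ.pot_le g 1 lam t x (mem_Ioi.2 hs.1)
            have h2 := hQ.pot_le g 1 lam t y (mem_Ioi.2 hs.1)
            have h3 := mul_le_mul_of_nonneg_left (wt_le (δ := β / 2 - 1) hl0.le hs.1)
              (mul_nonneg hD0 (norm_nonneg g))
            refine (norm_sub_le _ _).trans ?_
            linarith
        _ = _ := by rw [integral_const_mul, hv]; ring
    have b2 : ‖∫ s in Ioi (r ^ 2), F s‖ ≤ D' * (2 / (1 - β)) * ‖g‖ * r ^ β := by
      have hlt : β / 2 - 3 / 2 < -1 := by linarith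
      have hi := integrableOn_Ioi_rpow_of_lt hlt hr2
      have hv : ∫ s in Ioi (r ^ 2), s ^ (β / 2 - 3 / 2) = (2 / (1 - β)) * r ^ (β - 1) := by
        rw [integral_Ioi_rpow_of_lt hlt hr2, ← Real.rpow_natCast, ← Real.rpow_mul hr0.le]
        have : (β / 2 - 3 / 2 + 1) = -(1 - β) / 2 := by ring
        rw [this, show ((2 : ℕ) : ℝ) * (-(1 - β) / 2) = β - 1 by push_cast; ring]
        have : 1 - β ≠ 0 := by linarith
        field_simp
      have hv2 : r ^ (β - 1) * r = r ^ β := by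
        rw [Real.rpow_sub_one hr0.ne', div_mul_cancel₀ _ hr0.ne']
      calc _ ≤ ∫ s in Ioi (r ^ 2), D' * ‖g‖ * r * s ^ (β / 2 - 3 / 2) := by
            refine norm_integral_le_of_norm_le (hi.const_mul _)
              ((ae_restrict_mem measurableSet_Ioi).mono fun s hs => ?_)
            have hs0 : 0 < s := hr2.trans hs
            have hmv : ‖Qk ψ (ev g (t - s)) s x - Qk ψ (ev g (t - s)) s y‖ ≤
                (D' * ‖g‖ * s ^ (β / 2 - 1 / 2)) * ‖x - y‖ := by
              refine Convex.norm_image_sub_le_of_norm_hasFDerivWithin_le (s := univ)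
                (fun z _ => (h.hasFDerivAt_Qk (continuous_ev_right g (t - s)) (abs_ev_le g (t - s))
                  hs0 z).hasFDerivWithinAt) (fun z _ => (norm_lin_le _).trans ?_) convex_univ
                (mem_univ _) (mem_univ _)
              rw [hD', mul_assoc, Finset.sum_mul]
              refine Finset.sum_le_sum fun i _ => ?_
              rw [abs_neg, abs_mul, abs_of_nonneg (by positivity), Real.rpow_sub hs0,
                ← Real.sqrt_eq_rpow]
              calc _ ≤ (√s)⁻¹ * ((∫ z, ‖z‖ ^ β * |ψ' i z|) * s ^ (β / 2) * ‖g‖) :=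
                    mul_le_mul_of_nonneg_left ((hQ' i).bound g hs0 _ _) (by positivity)
                _ = _ := by rw [div_eq_mul_inv]; ring
            rw [← hr] at hmv
            simp only [hF]
            rw [← mul_sub, norm_mul, Real.norm_of_nonneg (wt_nonneg _ _ hs0)]
            have h4 := wt_le (δ := -1) hl0.le hs0
            have h5 : s ^ (-1 : ℝ) * s ^ (β / 2 - 1 / 2) = s ^ (β / 2 - 3 / 2) := by
              rw [← Real.rpow_add hs0]; ring_nf
            calc _ ≤ s ^ (-1 : ℝ) * ((D' * ‖g‖ * s ^ (β / 2 - 1 / 2)) * r) :=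
                  mul_le_mul h4 hmv (norm_nonneg _) (by positivity)
              _ = _ := by rw [← h5]; ring
        _ = _ := by rw [integral_const_mul, hv, ← hv2]; ring
    rw [e1, e2, ← Real.norm_eq_abs]
    refine (norm_add_le _ _).trans ((add_le_add b1 b2).trans ?_)
    have : 0 ≤ D * Real.Gamma (β / 2) * ‖g‖ * r ^ β := by positivity
    linarith

/-- Spatial derivative of a potential. -/
theorem HasKerDeriv.hasFDerivAt_pot {ψ' : Fin d → Sp d → ℝ} (h : HasKerDeriv ψ ψ')
    (hQ : QBound β ψ D γ) (hl : 0 < lam) (hκ : -1 < γ - κ)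
    {D' : Fin d → ℝ} {γ' : ℝ} (hQ' : ∀ i, QBound β (ψ' i) (D' i) γ')
    (hκ' : -1 < γ' - (κ + 1 / 2)) (g : HY d β) (t : ℝ) (x : Sp d) :
    HasFDerivAt (Pot κ ψ lam g t) (lin fun i => -Pot (κ + 1 / 2) (ψ' i) lam g t x) x := by
  have hw (s : ℝ) (hs : s ∈ Ioi (0 : ℝ)) : wt lam (-κ) s * (√s)⁻¹ = wt lam (-(κ + 1 / 2)) s := by
    rw [Real.sqrt_eq_rpow, ← Real.rpow_neg (le_of_lt hs), wt_mul _ _ _ hs]; ring_nf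
  have key := hasFDerivAt_integral_of_dominated_of_fderiv_le (𝕜 := ℝ)
    (μ := volume.restrict (Ioi 0))
    (F := fun x s => wt lam (-κ) s * Qk ψ (ev g (t - s)) s x)
    (F' := fun x s => lin fun i => -(wt lam (-(κ + 1 / 2)) s * Qk (ψ' i) (ev g (t - s)) s x))
    (x₀ := x) (s := univ)
    (bound := fun s => ∑ i, D' i * ‖g‖ * wt lam (γ' - (κ + 1 / 2)) s) univ_mem
    (Eventually.of_forall fun y => aestronglyMeasurable_pot h.ker g _ _ _ _)
    (hQ.integrableOn hl hκ g t x)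
    (by
      unfold lin
      refine Finset.aestronglyMeasurable_fun_sum _ fun i _ => ?_
      exact ((aestronglyMeasurable_pot (h.ker' i) g _ _ _ _).neg).smul_const _)
    ((ae_restrict_mem measurableSet_Ioi).mono fun s hs y _ => by
      refine (norm_lin_le _).trans (Finset.sum_le_sum fun i _ => ?_)
      rw [abs_neg]
      exact (hQ' i).pot_le g _ _ _ _ hs)
    (integrable_finsetSum _ fun i _ => (integrableOn_wt hl hκ').const_mul _)
    ((ae_restrict_mem measurableSet_Ioi).mono fun s hs y _ => by
      have := (h.hasFDerivAt_Qk (continuous_ev_right g (t - s)) (abs_ev_le g (t - s))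
        hs y).const_mul (wt lam (-κ) s)
      refine this.congr_fderiv ?_
      rw [← lin_smul]
      congr 1
      ext i
      rw [← hw s hs]; ring)
  refine key.congr_fderiv ?_
  have hi (i) : Integrable (fun s => (-(wt lam (-(κ + 1 / 2)) s * Qk (ψ' i) (ev g (t - s)) s x)) •
      (ContinuousLinearMap.proj i : Sp d →L[ℝ] ℝ)) (volume.restrict (Ioi 0)) :=
    ((hQ' i).integrableOn hl hκ' g t x).neg.smul_const _
  unfold lin
  rw [integral_finsetSum _ fun i _ => hi i]
  refine Finset.sum_congr rfl fun i _ => ?_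
  rw [integral_smul_const, integral_neg]
  rfl

end

/-- Abstract form of Duhamel's formula. -/
theorem duhamel {F F' : ℝ → ℝ → ℝ} {k : ℝ → ℝ} (hF : Continuous fun p : ℝ × ℝ => F p.1 p.2)
    (hF' : ContinuousOn (fun p : ℝ × ℝ => F' p.1 p.2) {p | 0 < p.1})
    (hd : ∀ s, 0 < s → ∀ r, HasDerivAt (fun s => F s r) (F' s r) s)
    (h0 : ∀ s, ∀ r ≤ 0, F s r = 0) (h0' : ∀ s, ∀ r ≤ 0, F' s r = 0)
    (hk : IntegrableOn k (Ioi 0)) (hb : ∀ s, 0 < s → ∀ r, |F' s r| ≤ k s) {t : ℝ} (ht : 0 ≤ t) :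
    ∫ s in Ioi 0, F s (t - s) =
      (∫ τ in (0 : ℝ)..t, F 0 τ) + ∫ τ in (0 : ℝ)..t, ∫ s in Ioi 0, F' s (τ - s) := by
  have reflect (f : ℝ → ℝ → ℝ) (τ : ℝ) : ∫ s in Ioi 0, f s (τ - s) =
      ∫ r, (Iio τ).indicator (fun r => f (τ - r) r) r := by
    rw [← integral_indicator measurableSet_Ioi,
      ← integral_sub_left_eq_self ((Set.Ioi (0 : ℝ)).indicator fun s => f s (τ - s)) volume τ]
    congr 1; ext r
    by_cases hr : r < τ
    · rw [indicator_of_mem (by simpa using hr), indicator_of_mem (by simpa using hr)]; simp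
    · rw [indicator_of_notMem (by simpa using hr), indicator_of_notMem (by simpa using hr)]
  let H : ℝ × ℝ → ℝ := {p : ℝ × ℝ | p.2 < p.1}.indicator fun p => F' (p.1 - p.2) p.2
  have hH (τ r : ℝ) : H (τ, r) = (Iio τ).indicator (fun r => F' (τ - r) r) r := by
    by_cases hr : r < τ
    · simp only [H]
      rw [indicator_of_mem (by simpa using hr), indicator_of_mem (by simpa using hr)]
    · simp only [H]
      rw [indicator_of_notMem (by simpa using hr), indicator_of_notMem (by simpa using hr)]
  have hopen : IsOpen {p : ℝ × ℝ | p.2 < p.1} := isOpen_lt continuous_snd continuous_fst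
  have hHm : AEStronglyMeasurable H (volume.prod volume) := by
    refine (aestronglyMeasurable_indicator_iff hopen.measurableSet).2 ?_
    refine ContinuousOn.aestronglyMeasurable ?_ hopen.measurableSet
    exact hF'.comp (f := fun p : ℝ × ℝ => (p.1 - p.2, p.2)) (by fun_prop)
      fun p hp => sub_pos.2 (show p.2 < p.1 from hp)
  have hHi : IntegrableOn H (Ioc 0 t ×ˢ Ioc 0 t) (volume.prod volume) := by
    have h1 : Integrable ((Ioc 0 t).indicator fun _ : ℝ => (1 : ℝ)) :=
      (integrable_indicator_iff measurableSet_Ioc).2 (by simp)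
    have h2 : Integrable ((Set.Ioi (0 : ℝ)).indicator k) := (integrable_indicator_iff
        measurableSet_Ioi).2 hk
    have h3 := h1.convolution_integrand (ContinuousLinearMap.mul ℝ ℝ) h2
    refine Integrable.mono' h3.integrableOn hHm.restrict
      ((ae_restrict_mem (measurableSet_Ioc.prod measurableSet_Ioc)).mono fun p hp => ?_)
    obtain ⟨τ, r⟩ := p
    simp only [ContinuousLinearMap.mul_apply']
    rw [indicator_of_mem hp.2, one_mul, hH]
    by_cases hr : r < τ
    · rw [indicator_of_mem (by simpa using hr), indicator_of_mem (by simpa using hr)]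
      exact hb _ (sub_pos.2 hr) _
    · rw [indicator_of_notMem (by simpa using hr), indicator_of_notMem (by simpa using hr)]
      simp
  have hHi' : Integrable (Function.uncurry fun τ r => H (τ, r))
      ((volume.restrict (Ioc 0 t)).prod (volume.restrict (Ioc 0 t))) := by
    rw [Measure.prod_restrict]; exact hHi
  have restr (f : ℝ → ℝ → ℝ) (hf : ∀ s, ∀ r ≤ 0, f s r = 0) (τ : ℝ) (hτ : τ ≤ t) :
      ∫ r, (Iio τ).indicator (fun r => f (τ - r) r) r =
        ∫ r in Ioc 0 t, (Iio τ).indicator (fun r => f (τ - r) r) r := by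
    rw [setIntegral_eq_integral_of_forall_compl_eq_zero]
    intro r hr
    by_cases hr0 : r ≤ 0
    · simp [indicator_apply, hf _ r hr0]
    · refine indicator_of_notMem (fun h => hr ⟨not_le.1 hr0, ?_⟩) _
      exact (le_of_lt h).trans hτ
  have inner (r : ℝ) (hr : r ∈ Ioc 0 t) :
      ∫ τ in Ioc 0 t, H (τ, r) = F (t - r) r - F 0 r := by
    have e : ∫ τ in Ioc 0 t, H (τ, r) = ∫ τ in r..t, F' (τ - r) r := by
      rw [intervalIntegral.integral_of_le hr.2]
      have hfun : (fun τ => H (τ, r)) = (Ioi r).indicator fun τ => F' (τ - r) r := by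
        ext τ
        rw [hH]
        by_cases h : r < τ
        · rw [indicator_of_mem (by simpa using h), indicator_of_mem (by simpa using h)]
        · rw [indicator_of_notMem (by simpa using h), indicator_of_notMem (by simpa using h)]
      rw [hfun, setIntegral_indicator measurableSet_Ioi]
      congr 2
      ext τ
      simp only [mem_inter_iff, Set.mem_Ioc, Set.mem_Ioi]
      have := hr.1
      grind
    rw [e, intervalIntegral.integral_comp_sub_right (fun s => F' s r) r, sub_self]
    have h1 : 0 ≤ t - r := sub_nonneg.2 hr.2
    refine intervalIntegral.integral_eq_sub_of_hasDerivAt_of_le h1 ?_ (fun s hs => hd s hs.1 r) ?_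
    · exact (hF.comp (f := fun s : ℝ => (s, r)) (by fun_prop)).continuousOn
    · rw [intervalIntegrable_iff_integrableOn_Ioc_of_le h1]
      refine Integrable.mono' (hk.mono_set Ioc_subset_Ioi_self) ?_
        ((ae_restrict_mem measurableSet_Ioc).mono fun s hs => hb s hs.1 r)
      refine ContinuousOn.aestronglyMeasurable ?_ measurableSet_Ioc
      exact hF'.comp (f := fun s : ℝ => (s, r)) (by fun_prop) fun s hs => hs.1
  have cont1 : IntegrableOn (fun r => F (t - r) r) (Ioc 0 t) := by
    refine (Continuous.integrableOn_Icc ?_).mono_set Ioc_subset_Icc_self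
    exact hF.comp (f := fun r : ℝ => (t - r, r)) (by fun_prop)
  have cont2 : IntegrableOn (fun r => F 0 r) (Ioc 0 t) := by
    refine (Continuous.integrableOn_Icc ?_).mono_set Ioc_subset_Icc_self
    exact hF.comp (f := fun r : ℝ => (0, r)) (by fun_prop)
  have lhs : ∫ s in Ioi 0, F s (t - s) = ∫ r in Ioc 0 t, F (t - r) r := by
    rw [reflect F t, restr F h0 t le_rfl, setIntegral_indicator measurableSet_Iio,
      show Ioc 0 t ∩ Iio t = Ioo 0 t by ext r; simp only [mem_inter_iff, Set.mem_Ioc, Set.mem_Iio, Set.mem_Ioo]; grind,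
      ← integral_Ioc_eq_integral_Ioo]
  have rhs : ∫ τ in (0 : ℝ)..t, ∫ s in Ioi 0, F' s (τ - s) =
      ∫ r in Ioc 0 t, (F (t - r) r - F 0 r) := by
    rw [intervalIntegral.integral_of_le ht]
    calc _ = ∫ τ in Ioc 0 t, ∫ r in Ioc 0 t, H (τ, r) := by
          refine setIntegral_congr_fun measurableSet_Ioc fun τ hτ => ?_
          rw [reflect F' τ, restr F' h0' τ hτ.2]
          simp_rw [hH]
      _ = ∫ r in Ioc 0 t, ∫ τ in Ioc 0 t, H (τ, r) := integral_integral_swap hHi'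
      _ = _ := setIntegral_congr_fun measurableSet_Ioc fun r hr => inner r hr
  rw [lhs, rhs, integral_sub cont1 cont2, intervalIntegral.integral_of_le ht]
  ring

/-- Gaussian kernels associated with a positive definite matrix. -/
structure IsGauss (A : Fin d → Fin d → ℝ) (φ : Sp d → ℝ) (φ1 : Fin d → Sp d → ℝ)
    (φ2 : Fin d → Fin d → Sp d → ℝ) (φ3 : Fin d → Fin d → Fin d → Sp d → ℝ) : Prop where
  d1 : HasKerDeriv φ φ1
  d2 : ∀ i, HasKerDeriv (φ1 i) (φ2 i)
  d3 : ∀ i j, HasKerDeriv (φ2 i j) (φ3 i j)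
  int : ∫ z, φ z = 1
  euler : ∀ z, d * φ z + ∑ i, z i * φ1 i z = -∑ i, ∑ j, A i j * φ2 i j z

theorem isKer_exp {q : Sp d → ℝ} (hq : Continuous q) {c : ℝ} (hc : 0 < c)
    (h : ∀ z, c * ‖z‖ ^ 2 ≤ q z) : IsKer fun z => Real.exp (-q z) := by
  refine ⟨by fun_prop, fun N => ⟨N.factorial * Real.exp (1 + 1 / (4 * c)), fun z => ?_⟩⟩
  have h1 : -q z ≤ (1 + 1 / (4 * c)) - (1 + ‖z‖) := by
    have : ‖z‖ ≤ c * ‖z‖ ^ 2 + 1 / (4 * c) := by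
      have h3 : 0 ≤ c * (‖z‖ - 1 / (2 * c)) ^ 2 := by positivity
      have h4 : c * (‖z‖ - 1 / (2 * c)) ^ 2 = c * ‖z‖ ^ 2 - ‖z‖ + 1 / (4 * c) := by
        field_simp; ring
      linarith
    linarith [h z]
  have h2 := Real.pow_div_factorial_le_exp (1 + ‖z‖) (by positivity) N
  rw [div_le_iff₀ (by positivity)] at h2
  rw [abs_of_pos (Real.exp_pos _)]
  calc _ ≤ (Real.exp (1 + ‖z‖) * N.factorial) * Real.exp ((1 + 1 / (4 * c)) - (1 + ‖z‖)) := by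
        gcongr
    _ = _ := by rw [Real.exp_sub]; field_simp

theorem exists_inv {A : Fin d → Fin d → ℝ} (hs : ∀ i j, A i j = A j i)
    (hp : ∀ y : Sp d, y ≠ 0 → 0 < ∑ i, ∑ j, A i j * y i * y j) :
    ∃ B : Fin d → Fin d → ℝ, (∀ i j, B i j = B j i) ∧
      (∀ i j, ∑ k, A i k * B k j = if i = j then 1 else 0) ∧
      ∃ c, 0 < c ∧ ∀ z : Sp d, c * ‖z‖ ^ 2 ≤ ∑ i, ∑ j, B i j * z i * z j := by
  let M : Matrix (Fin d) (Fin d) ℝ := Matrix.of A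
  have hM : M.PosDef := by
    refine Matrix.PosDef.of_dotProduct_mulVec_pos ?_ fun y hy => ?_
    · ext i j; simp [M, hs j i]
    · have := hp y hy
      simp only [dotProduct, Matrix.mulVec, M, Matrix.of_apply, Finset.mul_sum, Pi.star_apply,
        star_trivial]
      refine this.trans_eq (Finset.sum_congr rfl fun i _ => Finset.sum_congr rfl fun j _ => by ring)
  have hI := hM.inv
  have hsymm (i j) : M⁻¹ i j = M⁻¹ j i := by
    have := congrFun (congrFun hI.1 j) i
    simpa using this
  refine ⟨fun i j => M⁻¹ i j, hsymm, fun i j => ?_, ?_⟩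
  · have := congrFun (congrFun (Matrix.mul_nonsing_inv M
      ((Matrix.isUnit_iff_isUnit_det M).1 hM.isUnit)) i) j
    rw [Matrix.mul_apply, Matrix.one_apply] at this
    exact this
  · have hpos (y : Sp d) (hy : y ≠ 0) : 0 < ∑ i, ∑ j, M⁻¹ i j * y i * y j := by
      have := hI.dotProduct_mulVec_pos hy
      simp only [dotProduct, Matrix.mulVec, Finset.mul_sum, Pi.star_apply, star_trivial] at this
      refine this.trans_eq (Finset.sum_congr rfl fun i _ => Finset.sum_congr rfl fun j _ => by ring)
    set Qd : Sp d → ℝ := fun z => ∑ i, ∑ j, M⁻¹ i j * z i * z j with hQd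
    have hcont : Continuous Qd := by fun_prop
    have hscale (r : ℝ) (z : Sp d) : Qd (r • z) = r ^ 2 * Qd z := by
      simp only [hQd, Finset.mul_sum, Pi.smul_apply, smul_eq_mul]
      exact Finset.sum_congr rfl fun i _ => Finset.sum_congr rfl fun j _ => by ring
    by_cases hne : (Metric.sphere (0 : Sp d) 1).Nonempty
    · obtain ⟨z0, hz0, hmin⟩ := (isCompact_sphere (0 : Sp d) 1).exists_isMinOn hne
        hcont.continuousOn
      have hz0' : z0 ≠ 0 := by rintro rfl; simp at hz0
      refine ⟨Qd z0, hpos z0 hz0', fun z => ?_⟩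
      rcases eq_or_ne z 0 with rfl | hz
      · simp
      have h1 := hmin (show ‖z‖⁻¹ • z ∈ Metric.sphere (0 : Sp d) 1 by
        simp [norm_smul, hz])
      simp only [mem_ofPred_eq] at h1
      rw [hscale] at h1
      have hz' : 0 < ‖z‖ := norm_pos_iff.2 hz
      rw [inv_pow, inv_mul_eq_div, le_div_iff₀ (by positivity)] at h1
      exact h1
    · refine ⟨1, one_pos, fun z => ?_⟩
      have hz : z = 0 := by
        by_contra hz
        exact hne ⟨‖z‖⁻¹ • z, by simp [norm_smul, hz]⟩
      simp [hz]

theorem exists_gauss {A : Fin d → Fin d → ℝ} (hs : ∀ i j, A i j = A j i)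
    (hp : ∀ y : Sp d, y ≠ 0 → 0 < ∑ i, ∑ j, A i j * y i * y j) :
    ∃ φ φ1 φ2 φ3, IsGauss A φ φ1 φ2 φ3 := by
  obtain ⟨B, hB, hAB, c, hc, hBc⟩ := exists_inv hs hp
  let l : Fin d → Sp d → ℝ := fun i z => ∑ j, B i j * z j
  let q : Sp d → ℝ := fun z => 1 / 2 * ∑ i, z i * l i z
  have hl (i) (z) : HasFDerivAt (l i) (lin fun k => B i k) z := by
    have : l i = lin fun k => B i k := by ext z; rw [lin_apply]
    rw [this]; exact (lin fun k => B i k).hasFDerivAt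
  have hz (i : Fin d) (z : Sp d) : HasFDerivAt (fun z : Sp d => z i)
      (ContinuousLinearMap.proj i : Sp d →L[ℝ] ℝ) z := hasFDerivAt_apply i z
  have hq (z) : HasFDerivAt q (lin fun k => l k z) z := by
    have h1 := (HasFDerivAt.fun_sum fun i (_ : i ∈ Finset.univ) =>
      (hz i z).mul (hl i z)).const_mul (1 / 2 : ℝ)
    refine h1.congr_fderiv ?_
    ext y
    have e1 : ∑ i, z i * ∑ k, B i k * y k = ∑ k, l k z * y k := by
      simp only [Finset.mul_sum, l, Finset.sum_mul]
      rw [Finset.sum_comm]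
      exact Finset.sum_congr rfl fun i _ => Finset.sum_congr rfl fun j _ => by rw [hB j i]; ring
    simp only [_root_.sum_apply, _root_.add_apply, _root_.smul_apply, lin_apply, smul_eq_mul,
      Finset.sum_add_distrib, e1, ContinuousLinearMap.proj_apply]
    ring
  have hqc : Continuous q := continuous_iff_continuousAt.2 fun z => (hq z).continuousAt
  have hlc (i) : Continuous (l i) := by fun_prop
  have hE : IsKer fun z => Real.exp (-q z) := by
    refine isKer_exp hqc (half_pos hc) fun z => ?_
    have e : q z = 1 / 2 * ∑ i, ∑ j, B i j * z i * z j := by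
      simp only [q, l, Finset.mul_sum]
      exact Finset.sum_congr rfl fun i _ => Finset.sum_congr rfl fun j _ => by ring
    rw [e]; linarith [hBc z]
  have hEpos : 0 < ∫ z, Real.exp (-q z) := by
    rw [integral_pos_iff_support_of_nonneg (fun z => (Real.exp_pos _).le) hE.integrable]
    have : Function.support (fun z => Real.exp (-q z)) = univ := by
      ext z; simp [(Real.exp_pos _).ne']
    rw [this]
    exact isOpen_univ.measure_pos _ univ_nonempty
  set K := ∫ z, Real.exp (-q z) with hK
  let φ : Sp d → ℝ := fun z => K⁻¹ * Real.exp (-q z)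
  have hφ : IsKer φ := hE.smul _
  have hφd (z) : HasFDerivAt φ (lin fun k => -(l k z * φ z)) z := by
    have h1 := ((hq z).neg.exp).const_mul K⁻¹
    refine h1.congr_fderiv ?_
    ext y
    simp only [_root_.smul_apply, _root_.neg_apply, Pi.neg_apply, lin_apply, smul_eq_mul, φ,
      Finset.mul_sum, ← Finset.sum_neg_distrib]
    exact Finset.sum_congr rfl fun i _ => by ring
  have lker {ψ : Sp d → ℝ} (h : IsKer ψ) (i) : IsKer fun z => l i z * ψ z := by
    have : (fun z => l i z * ψ z) = fun z => ∑ j, B i j * (z j * ψ z) := by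
      ext z; simp only [l, Finset.sum_mul, mul_assoc]
    rw [this]
    exact IsKer.sum _ fun j => (h.coord_mul j).smul _
  have nker {ψ : Sp d → ℝ} (h : IsKer ψ) : IsKer fun z => -ψ z := by
    simpa using h.smul (-1)
  let φ1 : Fin d → Sp d → ℝ := fun i z => -(l i z * φ z)
  let φ2 : Fin d → Fin d → Sp d → ℝ := fun i j z => l i z * (l j z * φ z) + -(B i j * φ z)
  let φ3 : Fin d → Fin d → Fin d → Sp d → ℝ := fun i j k z =>
    (B i k * (l j z * φ z) + B j k * (l i z * φ z)) +
      -(l k z * φ2 i j z)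
  have k1 (i) : IsKer (φ1 i) := nker (lker hφ i)
  have k2 (i j) : IsKer (φ2 i j) := (lker (lker hφ j) i).add (nker (hφ.smul _))
  have k3 (i j k) : IsKer (φ3 i j k) :=
    (((lker hφ j).smul _).add ((lker hφ i).smul _)).add (nker (lker (k2 i j) k))
  have d2 (i z) : HasFDerivAt (φ1 i) (lin fun j => φ2 i j z) z := by
    refine (((hl i z).mul (hφd z)).neg).congr_fderiv ?_
    ext y
    simp only [_root_.smul_apply, _root_.neg_apply, _root_.add_apply, lin_apply, smul_eq_mul,
      Finset.mul_sum, ← Finset.sum_add_distrib, ← Finset.sum_neg_distrib, φ2]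
    exact Finset.sum_congr rfl fun i _ => by ring
  have d3 (i j z) : HasFDerivAt (φ2 i j) (lin fun k => φ3 i j k z) z := by
    refine (((hl i z).mul ((hl j z).mul (hφd z))).add ((hφd z).const_mul (B i j)).neg).congr_fderiv ?_
    ext y
    simp only [_root_.smul_apply, _root_.neg_apply, Pi.mul_apply, _root_.add_apply, lin_apply,
      smul_eq_mul, Finset.mul_sum, ← Finset.sum_add_distrib, ← Finset.sum_neg_distrib, φ2, φ3,
          mul_add]
    exact Finset.sum_congr rfl fun i _ => by ring
  refine ⟨φ, φ1, φ2, φ3, ⟨hφ, k1, hφd⟩, fun i => ⟨k1 i, k2 i, d2 i⟩,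
    fun i j => ⟨k2 i j, k3 i j, d3 i j⟩, ?_, fun z => ?_⟩
  · simp only [φ]
    rw [integral_const_mul, inv_mul_cancel₀ hEpos.ne']
  · have tr : ∑ i, ∑ j, A i j * B i j = d := by
      have hrow (i) : ∑ j, A i j * B i j = 1 := by
        have := hAB i i
        simp only [if_true] at this
        rw [← this]
        exact Finset.sum_congr rfl fun j _ => by rw [hB i j]
      simp [hrow]
    have Al (i) : ∑ j, A i j * l j z = z i := by
      simp only [l, Finset.mul_sum]
      rw [Finset.sum_comm]
      have hcol (k) : ∑ j, A i j * (B j k * z k) = (if i = k then 1 else 0) * z k := by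
        rw [← hAB i k, Finset.sum_mul]
        exact Finset.sum_congr rfl fun j _ => by ring
      simp [hcol]
    have e : ∑ i, ∑ j, A i j * φ2 i j z =
        (∑ i, z i * l i z) * φ z - d * φ z := by
      rw [← tr, Finset.sum_mul, Finset.sum_mul, ← Finset.sum_sub_distrib]
      refine Finset.sum_congr rfl fun i _ => ?_
      rw [← Al i, Finset.sum_mul, Finset.sum_mul, Finset.sum_mul, ← Finset.sum_sub_distrib]
      refine Finset.sum_congr rfl fun j _ => ?_
      simp only [φ2]; ring
    rw [e, Finset.sum_mul]
    simp only [φ1, mul_neg, Finset.sum_neg_distrib, mul_assoc]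
    ring

theorem IsKer.exists_bound_dilate {ψ : Sp d → ℝ} (h : IsKer ψ) :
    ∃ b : Sp d → ℝ, Integrable b ∧ ∀ z, ∀ ρ : ℝ, 1 / 2 ≤ ρ → (1 + ‖z‖) * |ψ (ρ • z)| ≤ b z := by
  obtain ⟨C, hC⟩ := h.2 (d + 2)
  refine ⟨fun z => 2 ^ (d + 2) * C * ((1 + ‖z‖) ^ (d + 1))⁻¹, integrable_decay.const_mul _,
    fun z ρ hρ => ?_⟩
  have h1 : 1 + ‖z‖ ≤ 2 * (1 + ‖ρ • z‖) := by
    rw [norm_smul, Real.norm_of_nonneg (by linarith)]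
    nlinarith [norm_nonneg z]
  rw [le_mul_inv_iff₀ (by positivity)]
  calc (1 + ‖z‖) * |ψ (ρ • z)| * (1 + ‖z‖) ^ (d + 1)
      = (1 + ‖z‖) ^ (d + 2) * |ψ (ρ • z)| := by ring
    _ ≤ (2 * (1 + ‖ρ • z‖)) ^ (d + 2) * |ψ (ρ • z)| := by gcongr
    _ = 2 ^ (d + 2) * ((1 + ‖ρ • z‖) ^ (d + 2) * |ψ (ρ • z)|) := by rw [mul_pow]; ring
    _ ≤ _ := by gcongr; exact hC _

theorem HasKerDeriv.dilate {ψ : Sp d → ℝ} {ψ' : Fin d → Sp d → ℝ} (h : HasKerDeriv ψ ψ')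
    {G : Sp d → ℝ} (hG : Continuous G) {M : ℝ} (hM : ∀ z, |G z| ≤ M) :
    HasDerivAt (fun ρ : ℝ => ∫ z, G z * (ρ ^ d * ψ (ρ • z)))
      (∫ z, G z * (d * ψ z + ∑ i, z i * ψ' i z)) 1 := by
  have hM0 : 0 ≤ M := (abs_nonneg _).trans (hM 0)
  obtain ⟨b, hb, hb'⟩ := h.ker.exists_bound_dilate
  choose c hc hc' using fun i => (h.ker' i).exists_bound_dilate
  have hψ := h.ker.1
  have hψ' (i) := (h.ker' i).1
  have key := hasDerivAt_integral_of_dominated_loc_of_deriv_le (𝕜 := ℝ) (μ := volume)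
    (F := fun ρ z => G z * (ρ ^ d * ψ (ρ • z)))
    (F' := fun ρ z => G z * (d * ρ ^ (d - 1) * ψ (ρ • z) + ρ ^ d * ∑ i, z i * ψ' i (ρ • z)))
    (x₀ := (1 : ℝ)) (s := Metric.ball 1 (1 / 2))
    (bound := fun z => M * (d * 2 ^ (d - 1) * b z + 2 ^ d * ∑ i, c i z))
    (Metric.ball_mem_nhds _ (by norm_num))
    (Eventually.of_forall fun ρ => Continuous.aestronglyMeasurable (by fun_prop))
    (by
      have : Integrable fun z => G z * ψ z :=
        h.ker.integrable.bdd_mul hG.aestronglyMeasurable (Eventually.of_forall hM)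
      simpa using this)
    (Continuous.aestronglyMeasurable (by fun_prop))
    (Eventually.of_forall fun z ρ hρ => by
      rw [Metric.mem_ball, Real.dist_eq, abs_lt] at hρ
      have hρ1 : 1 / 2 ≤ ρ := by linarith
      have hρ2 : ρ ≤ 2 := by linarith
      have hρ0 : 0 ≤ ρ := by linarith
      rw [norm_mul, Real.norm_eq_abs, Real.norm_eq_abs]
      refine mul_le_mul (hM z) ((abs_add_le _ _).trans (add_le_add ?_ ?_)) (abs_nonneg _) hM0
      · rw [abs_mul, abs_of_nonneg (by positivity)]
        have := hb' z ρ hρ1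
        have h2 : |ψ (ρ • z)| ≤ b z := by nlinarith [norm_nonneg z, abs_nonneg (ψ (ρ • z))]
        gcongr
      · rw [abs_mul, abs_of_nonneg (by positivity)]
        gcongr
        refine (Finset.abs_sum_le_sum_abs _ _).trans (Finset.sum_le_sum fun i _ => ?_)
        refine le_trans ?_ (hc' i z ρ hρ1)
        rw [abs_mul]
        gcongr
        have := norm_le_pi_norm z i
        rw [Real.norm_eq_abs] at this
        linarith)
    (((hb.const_mul _).add ((integrable_finsetSum _ fun i _ => hc i).const_mul _)).const_mul M)
    (Eventually.of_forall fun z ρ _ => by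
      have h1 : HasDerivAt (fun ρ : ℝ => ρ • z) z ρ := by
        simpa using (hasDerivAt_id ρ).smul_const z
      have h2 := (h.deriv (ρ • z)).comp_hasDerivAt ρ h1
      have h3 := ((hasDerivAt_pow d ρ).mul h2).const_mul (G z)
      convert! h3 using 1
      simp only [lin_apply, Function.comp]
      congr 3
      exact Finset.sum_congr rfl fun i _ => mul_comm _ _)
  simpa using key.2

section

variable {A : Fin d → Fin d → ℝ} {φ : Sp d → ℝ} {φ1 : Fin d → Sp d → ℝ}
  {φ2 : Fin d → Fin d → Sp d → ℝ} {φ3 : Fin d → Fin d → Fin d → Sp d → ℝ}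

theorem IsGauss.hasDerivAt_Qk (h : IsGauss A φ φ1 φ2 φ3) {G : Sp d → ℝ} (hG : Continuous G)
    {M : ℝ} (hM : ∀ z, |G z| ≤ M) {s : ℝ} (hs : 0 < s) (x : Sp d) :
    HasDerivAt (fun s => Qk φ G s x) (1 / (2 * s) * ∑ i, ∑ j, A i j * Qk (φ2 i j) G s x) s := by
  have hs' : 0 < √s := Real.sqrt_pos.2 hs
  have h1 := h.d1.dilate (G := fun z => G (x + √s • z)) (by fun_prop) (M := M) fun z => hM _
  have h2 : HasDerivAt (fun r => √s / √r) (-(1 / (2 * s))) s := by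
    have := ((Real.hasDerivAt_sqrt hs.ne').inv hs'.ne').const_mul (√s)
    refine this.congr_deriv ?_
    rw [Real.sq_sqrt hs.le]
    field_simp
  have h1' : HasDerivAt (fun ρ : ℝ => ∫ z, G (x + √s • z) * (ρ ^ d * φ (ρ • z)))
      (∫ z, G (x + √s • z) * (d * φ z + ∑ i, z i * φ1 i z)) (√s / √s) := by
    rwa [div_self hs'.ne']
  have h3 := h1'.comp s h2
  have e : (∫ z, G (x + √s • z) * (d * φ z + ∑ i, z i * φ1 i z)) * -(1 / (2 * s)) =
      1 / (2 * s) * ∑ i, ∑ j, A i j * Qk (φ2 i j) G s x := by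
    have hInt (i j) := integrable_Qk (h.d3 i j).ker hG hM s x
    have : ∑ i, ∑ j, A i j * Qk (φ2 i j) G s x =
        ∫ z, ∑ i, ∑ j, A i j * (G (x + √s • z) * φ2 i j z) := by
      rw [integral_finsetSum _ fun i _ => integrable_finsetSum _ fun j _ => (hInt i j).const_mul _]
      refine Finset.sum_congr rfl fun i _ => ?_
      rw [integral_finsetSum _ fun j _ => (hInt i j).const_mul _]
      exact Finset.sum_congr rfl fun j _ => (integral_const_mul _ _).symm
    simp only [h.euler]
    rw [this, mul_neg, mul_comm, ← mul_neg, ← integral_neg]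
    congr 2; ext z
    rw [mul_neg, neg_neg, Finset.mul_sum]
    refine Finset.sum_congr rfl fun i _ => ?_
    rw [Finset.mul_sum]
    exact Finset.sum_congr rfl fun j _ => by ring
  rw [e] at h3
  refine h3.congr_of_eventuallyEq ?_
  filter_upwards [lt_mem_nhds hs] with r hr
  have hr' : 0 < √r := Real.sqrt_pos.2 hr
  have hρ : 0 < √s / √r := by positivity
  have h4 := Measure.integral_comp_smul volume (fun z => G (x + √r • z) * φ z) (√s / √r)
  rw [Module.finrank_fintype_fun_eq_card, Fintype.card_fin, abs_of_pos (by positivity),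
    smul_eq_mul, eq_inv_mul_iff_mul_eq₀ (by positivity), ← integral_const_mul] at h4
  unfold Qk
  rw [← h4]
  simp only [Function.comp]
  congr 1; ext z
  rw [smul_smul, mul_div_cancel₀ _ hr'.ne']
  ring

/-- `u` has time derivative `ut`, gradient `u1` and Hessian `u2`. -/
structure HYRep (u ut : HY d β) (u1 : Fin d → HY d β) (u2 : Fin d → Fin d → HY d β) : Prop where
  dt : ∀ t x, HasDerivAt (fun τ => ev u τ x) (ev ut t x) t
  dx : ∀ t x, HasFDerivAt (ev u t) (lin fun i => ev (u1 i) t x) x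
  dxx : ∀ j t x, HasFDerivAt (ev (u1 j) t) (lin fun i => ev (u2 i j) t x) x

/-- Solution operators for `∂ₜ + λ - ½ Σ cᵢⱼ ∂ᵢⱼ`. -/
def Solv (β : ℝ) (c : ℝ → Sp d → Fin d → Fin d → ℝ) (C lam : ℝ) : Prop :=
  ∃ (V0 Vt : HY d β →L[ℝ] HY d β) (V1 : Fin d → HY d β →L[ℝ] HY d β)
    (V2 : Fin d → Fin d → HY d β →L[ℝ] HY d β),
    (∀ g, HYRep (V0 g) (Vt g) (fun i => V1 i g) fun i j => V2 i j g) ∧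
    (∀ g t x, ev (Vt g) t x + lam * ev (V0 g) t x -
      1 / 2 * ∑ i, ∑ j, c t x i j * ev (V2 i j g) t x = ev g t x) ∧
    ‖V0‖ ≤ C * (√lam)⁻¹ ∧ (∀ i, ‖V1 i‖ ≤ C * (√lam)⁻¹) ∧ ∀ i j, ‖V2 i j‖ ≤ C

theorem Qk_zero {φ : Sp d → ℝ} (h : ∫ z, φ z = 1) (G : Sp d → ℝ) (x : Sp d) :
    Qk φ G 0 x = G x := by
  simp [Qk, integral_const_mul, h]

theorem IsGauss.hasDerivAt_pot (h : IsGauss A φ φ1 φ2 φ3) (h0 : 0 < β) (h1 : β < 1) {lam : ℝ}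
    (hl : 0 < lam) (g : HY d β) (t : ℝ) (x : Sp d) :
    HasDerivAt (fun t => Pot 0 φ lam g t x) (ev g t x - lam * Pot 0 φ lam g t x +
      1 / 2 * ∑ i, ∑ j, A i j * Pot 1 (φ2 i j) lam g t x) t := by
  have Q0 : QBound β φ (∫ z, |φ z|) 0 := h.d1.ker.qBound
  have Q2 (i j) := (h.d3 i j).ker.qBound' h0 h1 ((h.d2 i).integral_eq_zero j)
  have k0 : -1 < (0 : ℝ) - 0 := by norm_num
  have k2 : -1 < β / 2 - 1 := by linarith
  set E : ℝ → ℝ := fun t => -(lam * Pot 0 φ lam g t x) +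
    1 / 2 * ∑ i, ∑ j, A i j * Pot 1 (φ2 i j) lam g t x with hE
  have hpc {κ : ℝ} {ψ : Sp d → ℝ} {D γ : ℝ} (h : QBound β ψ D γ) (hκ : -1 < γ - κ) :
      Continuous fun t => Pot κ ψ lam g t x :=
    (h.continuous_pot hl hκ g).comp (f := fun t : ℝ => (t, x)) (by fun_prop)
  have hEc : Continuous E := by
    refine ((hpc Q0 k0).const_mul lam).neg.add (continuous_const.mul ?_)
    exact continuous_finsetSum _ fun i _ => continuous_finsetSum _ fun j _ =>
      continuous_const.mul (hpc (Q2 i j) k2)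
  have hgc : Continuous fun t => ev g t x :=
    (continuous_ev g).comp (f := fun t : ℝ => (t, x)) (by fun_prop)
  have Ezero {τ : ℝ} (hτ : τ ≤ 0) : E τ = 0 := by simp [hE, pot_nonpos _ _ _ g hτ]
  let F : ℝ → ℝ → ℝ := fun s r => Real.exp (-(lam * s)) * Qk φ (ev g r) s x
  let F' : ℝ → ℝ → ℝ := fun s r => -lam * (wt lam (-0) s * Qk φ (ev g r) s x) +
    1 / 2 * ∑ i, ∑ j, A i j * (wt lam (-1) s * Qk (φ2 i j) (ev g r) s x)
  have hQc {ψ : Sp d → ℝ} (h : IsKer ψ) : Continuous fun p : ℝ × ℝ => Qk ψ (ev g p.2) p.1 x :=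
    (continuous_Qk h g).comp (f := fun p : ℝ × ℝ => (p.1, p.2, x)) (by fun_prop)
  have hwc (κ : ℝ) : ContinuousOn (fun p : ℝ × ℝ => wt lam (-κ) p.1) {p | 0 < p.1} :=
    (continuousOn_wt lam (-κ)).comp continuousOn_fst fun p hp => hp
  have hD {τ : ℝ} := duhamel (t := τ) (F := F) (F' := F')
    (k := fun s => lam * ((∫ z, |φ z|) * ‖g‖ * wt lam (0 - 0) s) +
      1 / 2 * ∑ i, ∑ j, |A i j| * ((∫ z, ‖z‖ ^ β * |φ2 i j z|) * ‖g‖ * wt lam (β / 2 - 1) s))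
    (Continuous.mul (by fun_prop) (hQc h.d1.ker))
    (ContinuousOn.add (continuousOn_const.mul ((hwc _).mul (hQc h.d1.ker).continuousOn))
      (continuousOn_const.mul (continuousOn_finsetSum _ fun i _ => continuousOn_finsetSum _ fun j _ =>
        continuousOn_const.mul ((hwc _).mul (hQc (h.d3 i j).ker).continuousOn))))
    (fun s hs r => by
      have e1 : HasDerivAt (fun s => Real.exp (-(lam * s))) (Real.exp (-(lam * s)) * -(lam * 1)) s :=
        (((hasDerivAt_id s).const_mul lam).neg).exp
      refine (e1.mul (h.hasDerivAt_Qk (continuous_ev_right g r) (abs_ev_le g r) hs x)).congr_deriv ?_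
      simp only [F', wt, neg_zero, Real.rpow_zero, Real.rpow_neg_one, one_mul, Finset.mul_sum]
      congr 1
      · ring
      · refine Finset.sum_congr rfl fun i _ => Finset.sum_congr rfl fun j _ => ?_
        field_simp)
    (fun s r hr => by
      have : ev g r = fun _ => 0 := funext fun y => ev_nonpos g hr y
      simp [F, Qk, this])
    (fun s r hr => by
      have : ev g r = fun _ => 0 := funext fun y => ev_nonpos g hr y
      simp [F', Qk, this])
    (by
      refine Integrable.add (((integrableOn_wt hl k0).const_mul _).const_mul _)
        (Integrable.const_mul ?_ _)
      exact integrable_finsetSum _ fun i _ => integrable_finsetSum _ fun j _ =>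
        ((integrableOn_wt hl k2).const_mul _).const_mul _)
    (fun s hs r => by
      have b0 := Q0.pot_le g 0 lam (r + s) x (mem_Ioi.2 hs)
      have b2 (i j) := (Q2 i j).pot_le g 1 lam (r + s) x (mem_Ioi.2 hs)
      simp only [add_sub_cancel_right] at b0 b2
      refine (abs_add_le _ _).trans (add_le_add ?_ ?_)
      · rw [abs_mul, abs_neg, abs_of_pos hl]
        exact mul_le_mul_of_nonneg_left b0 hl.le
      · rw [abs_mul, abs_of_pos (by norm_num : (0 : ℝ) < 1 / 2)]
        refine mul_le_mul_of_nonneg_left ?_ (by norm_num)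
        refine (Finset.abs_sum_le_sum_abs _ _).trans (Finset.sum_le_sum fun i _ => ?_)
        refine (Finset.abs_sum_le_sum_abs _ _).trans (Finset.sum_le_sum fun j _ => ?_)
        rw [abs_mul]
        exact mul_le_mul_of_nonneg_left (b2 i j) (abs_nonneg _))
  have hF0 (τ) : F 0 τ = ev g τ x := by simp [F, Qk_zero h.int]
  have hF' (τ) : ∫ s in Ioi 0, F' s (τ - s) = E τ := by
    have i0 := Q0.integrableOn hl k0 g τ x
    have i2 (i j) := (Q2 i j).integrableOn hl k2 g τ x
    simp only [F']
    rw [integral_add (i0.const_mul _) (Integrable.const_mul (integrable_finsetSum _ fun i _ =>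
      integrable_finsetSum _ fun j _ => (i2 i j).const_mul _) _), integral_const_mul,
      integral_const_mul, integral_finsetSum _ fun i _ => integrable_finsetSum _ fun j _ =>
        (i2 i j).const_mul _]
    simp only [hE, Pot]
    rw [neg_mul]
    congr 2
    refine Finset.sum_congr rfl fun i _ => ?_
    rw [integral_finsetSum _ fun j _ => (i2 i j).const_mul _]
    exact Finset.sum_congr rfl fun j _ => integral_const_mul _ _
  have main (τ : ℝ) : Pot 0 φ lam g τ x = ∫ r in (0 : ℝ)..τ, (ev g r x + E r) := by
    rcases le_total 0 τ with hτ | hτ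
    · have := hD hτ
      simp only [hF0, hF'] at this
      rw [intervalIntegral.integral_add (hgc.intervalIntegrable _ _) (hEc.intervalIntegrable _ _),
        ← this]
      simp [Pot, F, wt]
    · rw [pot_nonpos _ _ _ g hτ, intervalIntegral.integral_symm, intervalIntegral.integral_of_le hτ,
        setIntegral_eq_zero_of_forall_eq_zero, neg_zero]
      intro r hr
      rw [ev_nonpos g hr.2, Ezero hr.2, add_zero]
  have hfin : HasDerivAt (fun τ => ∫ r in (0 : ℝ)..τ, (ev g r x + E r)) (ev g t x + E t) t :=
    ((hgc.add hEc).integral_hasStrictDerivAt 0 t).hasDerivAt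
  simp_rw [← main] at hfin
  refine hfin.congr_deriv ?_
  simp only [hE]; ring

/-- Constant coefficient equations are solvable. -/
theorem solv_const (h0 : 0 < β) (h1 : β < 1) (hs : ∀ i j, A i j = A j i)
    (hp : ∀ y : Sp d, y ≠ 0 → 0 < ∑ i, ∑ j, A i j * y i * y j) :
    ∃ C, 0 < C ∧ ∀ lam, 1 ≤ lam → Solv β (fun _ _ => A) C lam := by
  obtain ⟨φ, φ1, φ2, φ3, h⟩ := exists_gauss hs hp
  choose C2 hC2 hV2 using fun i j =>
    (h.d3 i j).exists_pot h0 h1 ((h.d2 i).integral_eq_zero j)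
  set C0 := ∫ z, |φ z| with hC0
  set C1 := fun i => ∫ z, |φ1 i z| with hC1
  have hC0' : 0 ≤ C0 := integral_nonneg fun _ => abs_nonneg _
  have hC1' (i) : 0 ≤ C1 i := integral_nonneg fun _ => abs_nonneg _
  have hG := Real.Gamma_pos_of_pos (half_pos one_pos)
  refine ⟨1 + C0 + (∑ i, C1 i) * Real.Gamma (1 / 2) + ∑ i, ∑ j, C2 i j, ?_, fun lam hl => ?_⟩
  · have := Finset.sum_nonneg fun i (_ : i ∈ Finset.univ) => hC1' i
    have := Finset.sum_nonneg fun i (_ : i ∈ Finset.univ) =>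
      Finset.sum_nonneg fun j (_ : j ∈ Finset.univ) => hC2 i j
    positivity
  have hl0 : 0 < lam := by linarith
  obtain ⟨V0, hV0, nV0⟩ := h.d1.ker.exists_pot (κ := 0) h0 hl0 one_pos
  choose V1 hV1 nV1 using fun i =>
    (h.d1.ker' i).exists_pot (κ := 1 / 2) h0 hl0 (by norm_num)
  choose V2 hV2 nV2 using fun i j => hV2 i j lam hl
  have Q0 : QBound β φ (∫ z, |φ z|) 0 := h.d1.ker.qBound
  have Q1 (i) : QBound β (φ1 i) (∫ z, |φ1 i z|) 0 := (h.d1.ker' i).qBound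
  have Q2 (i j) := (h.d3 i j).ker.qBound' h0 h1 ((h.d2 i).integral_eq_zero j)
  obtain ⟨B, hB⟩ : ∃ B, B = ContinuousLinearMap.id ℝ (HY d β) - lam • V0 +
    (1 / 2 : ℝ) • ∑ i, ∑ j, A i j • V2 i j := ⟨_, rfl⟩
  have hBe (g t x) : ev (B g) t x = ev g t x - lam * ev (V0 g) t x +
      1 / 2 * ∑ i, ∑ j, A i j * ev (V2 i j g) t x := by
    simp [hB, _root_.sum_apply]
  have sq : (√lam)⁻¹ = (1 / lam) ^ (1 / 2 : ℝ) := by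
    rw [← Real.sqrt_eq_rpow, Real.sqrt_div zero_le_one, Real.sqrt_one, one_div]
  have sq0 : 0 < (√lam)⁻¹ := by positivity
  have sC1 (i) : C1 i ≤ ∑ i, C1 i := Finset.single_le_sum (fun i _ => hC1' i) (Finset.mem_univ i)
  have sC2 (i j) : C2 i j ≤ ∑ i, ∑ j, C2 i j :=
    (Finset.single_le_sum (fun j _ => hC2 i j) (Finset.mem_univ j)).trans
      (Finset.single_le_sum (f := fun i => ∑ j, C2 i j)
        (fun i _ => Finset.sum_nonneg fun j _ => hC2 i j) (Finset.mem_univ i))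
  have pC1 := Finset.sum_nonneg fun i (_ : i ∈ Finset.univ) => hC1' i
  have pC2 := Finset.sum_nonneg fun i (_ : i ∈ Finset.univ) =>
      Finset.sum_nonneg fun j (_ : j ∈ Finset.univ) => hC2 i j
  refine ⟨V0, B, fun i => -V1 i, fun i j => V2 j i, fun g => ⟨fun t x => ?_, fun t x => ?_,
    fun j t x => ?_⟩, fun g t x => ?_, ?_, fun i => ?_, fun i j => ?_⟩
  · rw [hBe]
    simp only [hV0, hV2]
    exact h.hasDerivAt_pot h0 h1 hl0 g t x
  · have := h.d1.hasFDerivAt_pot Q0 hl0 (κ := 0) (by norm_num) Q1 (by norm_num) g t x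
    have e : ev (V0 g) t = Pot 0 φ lam g t := funext fun y => hV0 g t y
    rw [e]
    simpa [hV1] using this
  · have := (h.d2 j).hasFDerivAt_pot (Q1 j) hl0 (κ := 1 / 2) (by norm_num) (Q2 j)
      (by linarith) g t x
    have e : ev ((-V1 j) g) t = fun y => -Pot (1 / 2) (φ1 j) lam g t y :=
      funext fun y => by rw [← hV1]; rfl
    rw [e]
    refine this.neg.congr_fderiv ?_
    rw [← lin_neg]
    congr 1; ext i
    rw [hV2, neg_neg]; norm_num
  · rw [hBe]
    have e : ∑ i, ∑ j, A i j * ev (V2 j i g) t x = ∑ i, ∑ j, A i j * ev (V2 i j g) t x := by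
      rw [Finset.sum_comm]
      exact Finset.sum_congr rfl fun i _ => Finset.sum_congr rfl fun j _ => by rw [hs i j]
    rw [e]; ring
  · refine nV0.trans ?_
    rw [integral_wt hl0 (by norm_num), neg_zero, zero_add, Real.rpow_one, Real.Gamma_one, mul_one]
    have : 1 / lam ≤ (√lam)⁻¹ := by
      rw [one_div]
      refine inv_anti₀ (by positivity) ?_
      rw [Real.sqrt_le_left (by linarith)]
      nlinarith
    calc _ ≤ C0 * (√lam)⁻¹ := by gcongr
      _ ≤ _ := by
        gcongr
        have : 0 ≤ (∑ i, C1 i) * Real.Gamma (1 / 2) := by positivity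
        linarith
  · rw [norm_neg]
    refine (nV1 i).trans ?_
    rw [integral_wt hl0 (by norm_num), show -(1 / 2 : ℝ) + 1 = 1 / 2 by norm_num, ← sq]
    calc _ = (C1 i * Real.Gamma (1 / 2)) * (√lam)⁻¹ := by ring
      _ ≤ _ := by
        gcongr
        have := mul_le_mul_of_nonneg_right (sC1 i) hG.le
        linarith
  · refine (nV2 j i).trans ((sC2 j i).trans ?_)
    have : 0 ≤ (∑ i, C1 i) * Real.Gamma (1 / 2) := by positivity
    linarith

end

/-- Bounded continuous functions, uniformly `β`-Hölder in space, with bound `M`. -/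
structure MultWith (β M : ℝ) (m : ℝ → Sp d → ℝ) : Prop where
  cont : Continuous fun p : ℝ × Sp d => m p.1 p.2
  bound : ∀ t x, |m t x| ≤ M
  holder : ∀ t x y, |m t x - m t y| ≤ M * ‖x - y‖ ^ β

theorem MultWith.nonneg {M : ℝ} {m : ℝ → Sp d → ℝ} (h : MultWith β M m) : 0 ≤ M :=
  (abs_nonneg _).trans (h.bound 0 0)

theorem MultWith.mono {M M' : ℝ} {m : ℝ → Sp d → ℝ} (h : MultWith β M m) (hM : M ≤ M') :
    MultWith β M' m :=
  ⟨h.cont, fun t x => (h.bound t x).trans hM, fun t x y => (h.holder t x y).trans (by gcongr)⟩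

theorem MultWith.add {M M' : ℝ} {m m' : ℝ → Sp d → ℝ} (h : MultWith β M m)
    (h' : MultWith β M' m') : MultWith β (M + M') fun t x => m t x + m' t x where
  cont := h.cont.add h'.cont
  bound t x := (abs_add_le _ _).trans (add_le_add (h.bound t x) (h'.bound t x))
  holder t x y := by
    rw [add_sub_add_comm, add_mul]
    exact (abs_add_le _ _).trans (add_le_add (h.holder t x y) (h'.holder t x y))

theorem MultWith.mul {M M' : ℝ} {m m' : ℝ → Sp d → ℝ} (h : MultWith β M m)
    (h' : MultWith β M' m') : MultWith β (2 * (M * M')) fun t x => m t x * m' t x where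
  cont := h.cont.mul h'.cont
  bound t x := by
    have := mul_nonneg h.nonneg h'.nonneg
    rw [abs_mul]
    have := mul_le_mul (h.bound t x) (h'.bound t x) (abs_nonneg _) h.nonneg
    linarith
  holder t x y := by
    have e : m t x * m' t x - m t y * m' t y =
      m t x * (m' t x - m' t y) + (m t x - m t y) * m' t y := by ring
    have h1 := mul_le_mul (h.bound t x) (h'.holder t x y) (abs_nonneg _) h.nonneg
    have h2 := mul_le_mul (h.holder t x y) (h'.bound t y) (abs_nonneg _)
      ((abs_nonneg _).trans (h.holder t x y))
    rw [e]
    refine (abs_add_le _ _).trans ?_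
    rw [abs_mul, abs_mul]
    linarith

theorem multWith_const (b : ℝ) : MultWith β |b| fun (_ : ℝ) (_ : Sp d) => b where
  cont := continuous_const
  bound _ _ := le_rfl
  holder t x y := by rw [sub_self, abs_zero]; positivity

theorem MultWith.exists_op (hβ : 0 < β) {M : ℝ} {m : ℝ → Sp d → ℝ} (h : MultWith β M m) :
    ∃ T : HY d β →L[ℝ] HY d β, (∀ g t x, ev (T g) t x = m t x * ev g t x) ∧ ‖T‖ ≤ 2 * M :=
  exists_mul hβ h.cont h.nonneg h.bound h.holder

/-- Bounded continuous functions, uniformly `β`-Hölder in space. -/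
def Mult (β : ℝ) (m : ℝ → Sp d → ℝ) : Prop := ∃ M, MultWith β M m

theorem Mult.add {m m' : ℝ → Sp d → ℝ} (h : Mult β m) (h' : Mult β m') :
    Mult β fun t x => m t x + m' t x := ⟨_, h.choose_spec.add h'.choose_spec⟩

theorem Mult.mul {m m' : ℝ → Sp d → ℝ} (h : Mult β m) (h' : Mult β m') :
    Mult β fun t x => m t x * m' t x := ⟨_, h.choose_spec.mul h'.choose_spec⟩

theorem mult_const (b : ℝ) : Mult β fun (_ : ℝ) (_ : Sp d) => b := ⟨_, multWith_const b⟩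

theorem Mult.neg {m : ℝ → Sp d → ℝ} (h : Mult β m) : Mult β fun t x => -m t x := by
  simpa using (mult_const (-1)).mul h

theorem Mult.sub {m m' : ℝ → Sp d → ℝ} (h : Mult β m) (h' : Mult β m') :
    Mult β fun t x => m t x - m' t x := by
  simpa only [sub_eq_add_neg] using h.add h'.neg

theorem Mult.exists_op (hβ : 0 < β) {m : ℝ → Sp d → ℝ} (h : Mult β m) :
    ∃ T : HY d β →L[ℝ] HY d β, ∀ g t x, ev (T g) t x = m t x * ev g t x :=
  (h.choose_spec.exists_op hβ).imp fun _ h => h.1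

theorem multWith_of_lipschitz (h0 : 0 < β) (h1 : β ≤ 1) {m : ℝ → Sp d → ℝ}
    (hc : Continuous fun p : ℝ × Sp d => m p.1 p.2) {M K : ℝ} (hM : ∀ t x, |m t x| ≤ M)
    (hK : ∀ t x y, |m t x - m t y| ≤ K * ‖x - y‖) (hK0 : 0 ≤ K) : MultWith β (2 * M + K) m := by
  have hM0 : 0 ≤ M := (abs_nonneg _).trans (hM 0 0)
  refine ⟨hc, fun t x => (hM t x).trans (by linarith), fun t x y => ?_⟩
  rcases le_total ‖x - y‖ 1 with h | h
  · refine (hK t x y).trans ?_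
    have : ‖x - y‖ ≤ ‖x - y‖ ^ β := Real.self_le_rpow_of_le_one (norm_nonneg _) h h1
    have := mul_le_mul_of_nonneg_left this hK0
    have := mul_nonneg hM0 (Real.rpow_nonneg (norm_nonneg (x - y)) β)
    linarith
  · have : 1 ≤ ‖x - y‖ ^ β := Real.one_le_rpow h h0.le
    have h2 : |m t x - m t y| ≤ 2 * M :=
      (abs_sub _ _).trans (by linarith [hM t x, hM t y])
    nlinarith

theorem mult_of_contDiff (h0 : 0 < β) (h1 : β ≤ 1) {m : ℝ × Sp d → ℝ} (hm : ContDiff ℝ 1 m)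
    (hs : HasCompactSupport m) : Mult β fun t x => m (t, x) := by
  obtain ⟨M, hM⟩ := hm.continuous.bounded_above_of_compact_support hs
  obtain ⟨K, hK⟩ := hm.lipschitzWith_of_hasCompactSupport hs one_ne_zero
  refine ⟨_, multWith_of_lipschitz h0 h1 (K := K) (by simpa using hm.continuous)
    (fun t x => hM (t, x)) (fun t x y => ?_) K.2⟩
  have := hK.dist_le_mul (t, x) (t, y)
  rw [Real.dist_eq, dist_eq_norm] at this
  simpa using this

/-- A spacetime function with its first time derivative, gradient and Hessian, all of them
admissible multipliers. -/
structure Cut (β : ℝ) (χ χt : ℝ → Sp d → ℝ) (χ1 : Fin d → ℝ → Sp d → ℝ)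
    (χ2 : Fin d → Fin d → ℝ → Sp d → ℝ) : Prop where
  dt : ∀ t x, HasDerivAt (fun τ => χ τ x) (χt t x) t
  dx : ∀ t x, HasFDerivAt (χ t) (lin fun i => χ1 i t x) x
  dxx : ∀ j t x, HasFDerivAt (χ1 j t) (lin fun i => χ2 i j t x) x
  m : Mult β χ
  mt : Mult β χt
  m1 : ∀ i, Mult β (χ1 i)
  m2 : ∀ i j, Mult β (χ2 i j)

theorem hasFDerivAt_slice {m : ℝ × Sp d → ℝ} (hm : Differentiable ℝ m) (t : ℝ) (x : Sp d) :
    HasFDerivAt (fun y => m (t, y)) (lin fun i => fderiv ℝ m (t, x) (0, Pi.single i 1)) x := by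
  have h := (hm (t, x)).hasFDerivAt.comp x (hasFDerivAt_prodMk_right (𝕜 := ℝ) t x)
  refine h.congr_fderiv ?_
  exact lin_eq_of_apply_single _

theorem hasDerivAt_slice {m : ℝ × Sp d → ℝ} (hm : Differentiable ℝ m) (t : ℝ) (x : Sp d) :
    HasDerivAt (fun τ => m (τ, x)) (fderiv ℝ m (t, x) (1, 0)) t := by
  have h := (hm (t, x)).hasFDerivAt.comp_hasDerivAt t
    ((hasDerivAt_id t).prodMk (hasDerivAt_const t x))
  exact h

theorem exists_cut (h0 : 0 < β) (h1 : β ≤ 1) {χ : ℝ × Sp d → ℝ} (hχ : ContDiff ℝ 3 χ)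
    (hs : HasCompactSupport χ) : ∃ χt χ1 χ2, Cut β (fun t x => χ (t, x)) χt χ1 χ2 ∧
      ∀ X k, χ =ᶠ[𝓝 X] (fun _ => k) → χt X.1 X.2 = 0 ∧ (∀ i, χ1 i X.1 X.2 = 0) ∧ ∀ i j, χ2 i j X.1
        X.2 = 0 := by
  have hd : ContDiff ℝ 2 (fderiv ℝ χ) := hχ.fderiv_right (by norm_num)
  have hsd : HasCompactSupport (fderiv ℝ χ) := hs.fderiv ℝ
  have c1 (v) : ContDiff ℝ 2 fun X => fderiv ℝ χ X v := hd.clm_apply contDiff_const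
  have s1 (v) : HasCompactSupport fun X => fderiv ℝ χ X v :=
    hs.fderiv_apply ℝ v
  have c2 (v w) : ContDiff ℝ 1 fun X => fderiv ℝ (fun X => fderiv ℝ χ X v) X w :=
    ((c1 v).fderiv_right (m := 1) (by norm_num)).clm_apply contDiff_const
  have s2 (v w) : HasCompactSupport fun X => fderiv ℝ (fun X => fderiv ℝ χ X v) X w :=
    (s1 v).fderiv_apply ℝ w
  refine ⟨fun t x => fderiv ℝ χ (t, x) (1, 0),
    fun i t x => fderiv ℝ χ (t, x) (0, Pi.single i 1),
    fun i j t x => fderiv ℝ (fun X => fderiv ℝ χ X (0, Pi.single j 1)) (t, x) (0, Pi.single i 1),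
    ⟨fun t x => hasDerivAt_slice (hχ.differentiable (by norm_num)) t x,
    fun t x => hasFDerivAt_slice (hχ.differentiable (by norm_num)) t x,
    fun j t x => hasFDerivAt_slice ((c1 _).differentiable (by norm_num)) t x,
    mult_of_contDiff h0 h1 (hχ.of_le (by norm_num)) hs,
    mult_of_contDiff h0 h1 ((c1 _).of_le (by norm_num)) (s1 _),
    fun i => mult_of_contDiff h0 h1 ((c1 _).of_le (by norm_num)) (s1 _),
    fun i j => mult_of_contDiff h0 h1 (c2 _ _) (s2 _ _)⟩, fun X k hX => ?_⟩
  have t1 (v) : (fun X => fderiv ℝ χ X v) =ᶠ[𝓝 X] fun _ => 0 := by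
    filter_upwards [hX.fderiv (𝕜 := ℝ)] with Y hY
    rw [hY]; simp
  have t2 (v w) : fderiv ℝ (fun X => fderiv ℝ χ X v) X w = 0 := by
    rw [(t1 v).fderiv_eq]; simp
  exact ⟨(t1 _).eq_of_nhds, fun i => (t1 _).eq_of_nhds, fun i j => t2 _ _⟩

theorem Cut.one_sub {χ χt : ℝ → Sp d → ℝ} {χ1 : Fin d → ℝ → Sp d → ℝ}
    {χ2 : Fin d → Fin d → ℝ → Sp d → ℝ} (h : Cut β χ χt χ1 χ2) :
    Cut β (fun t x => 1 - χ t x) (fun t x => -χt t x) (fun i t x => -χ1 i t x)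
      fun i j t x => -χ2 i j t x where
  dt t x := (h.dt t x).const_sub 1
  dx t x := ((h.dx t x).const_sub 1).congr_fderiv (lin_neg _).symm
  dxx j t x := (h.dxx j t x).neg.congr_fderiv (lin_neg _).symm
  m := (mult_const 1).sub h.m
  mt := h.mt.neg
  m1 i := (h.m1 i).neg
  m2 i j := (h.m2 i j).neg

/-- Solvability is stable under small perturbations of the coefficients. -/
theorem Solv.perturb (hβ : 0 < β) {c c' : ℝ → Sp d → Fin d → Fin d → ℝ} {C lam M : ℝ}
    (h : Solv β c C lam) (hm : ∀ i j, MultWith β M fun t x => c' t x i j - c t x i j)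
    (hM : (d : ℝ) ^ 2 * (M * C) ≤ 1 / 2) : Solv β c' (2 * C) lam := by
  obtain ⟨V0, Vt, V1, V2, hr, he, n0, n1, n2⟩ := h
  choose m hm hmn using fun i j => (hm i j).exists_op hβ
  obtain ⟨B, hB⟩ : ∃ B, B = (1 / 2 : ℝ) • ∑ i, ∑ j, (m i j).comp (V2 i j) := ⟨_, rfl⟩
  have hBe (g t x) : ev (B g) t x =
      1 / 2 * ∑ i, ∑ j, (c' t x i j - c t x i j) * ev (V2 i j g) t x := by
    simp [hB, _root_.sum_apply, hm]
  have hBn : ‖B‖ ≤ 1 / 2 := by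
    rw [hB, norm_smul, Real.norm_of_nonneg (by norm_num)]
    have : ‖∑ i, ∑ j, (m i j).comp (V2 i j)‖ ≤ ∑ i : Fin d, ∑ j : Fin d, 2 * M * C := by
      refine norm_sum_le_of_le _ fun i _ => norm_sum_le_of_le _ fun j _ => ?_
      refine (ContinuousLinearMap.opNorm_comp_le _ _).trans ?_
      exact mul_le_mul (hmn i j) (n2 i j) (norm_nonneg _) ((norm_nonneg _).trans (hmn i j))
    simp only [Finset.sum_const, Finset.card_univ, Fintype.card_fin, nsmul_eq_mul] at this
    nlinarith
  obtain ⟨J, hJ, hJn⟩ := exists_inverse B hBn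
  have cn {V : HY d β →L[ℝ] HY d β} {D : ℝ} (hV : ‖V‖ ≤ D) : ‖V.comp J‖ ≤ 2 * D := by
    refine (ContinuousLinearMap.opNorm_comp_le _ _).trans ?_
    have := mul_le_mul hV hJn (norm_nonneg _) ((norm_nonneg _).trans hV)
    linarith
  refine ⟨V0.comp J, Vt.comp J, fun i => (V1 i).comp J, fun i j => (V2 i j).comp J,
    fun g => hr (J g), fun g t x => ?_, ?_, fun i => ?_, fun i j => cn (n2 i j)⟩
  · have e := congrArg (fun f => ev f t x) (hJ g)
    simp only [ev_sub, hBe, sub_mul, Finset.sum_sub_distrib] at e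
    have := he (J g) t x
    simp only [ContinuousLinearMap.comp_apply]
    linarith
  · rw [mul_assoc]; exact cn n0
  · rw [mul_assoc]; exact cn (n1 i)

/-- Local Hölder continuity of the coefficients at a point. -/
def HolAt (c : ℝ → Sp d → Fin d → Fin d → ℝ) (α : ℝ) (X : ℝ × Sp d) : Prop :=
  ∃ U ∈ 𝓝 X, ∃ C, 0 ≤ C ∧ ∀ i j, ∀ q ∈ U, ∀ q' ∈ U,
    |c q.1 q.2 i j - c q'.1 q'.2 i j| ≤ C * dist q q' ^ α

/-- Projection onto the closed cube of radius `δ` around `X`. -/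
def clampTo (X : ℝ × Sp d) (δ : ℝ) (Y : ℝ × Sp d) : ℝ × Sp d :=
  (max (X.1 - δ) (min Y.1 (X.1 + δ)), fun i => max (X.2 i - δ) (min (Y.2 i) (X.2 i + δ)))

theorem dist_clampTo_le (X : ℝ × Sp d) (δ : ℝ) (Y Z : ℝ × Sp d) :
    dist (clampTo X δ Y) (clampTo X δ Z) ≤ dist Y Z := by
  have key (p q a b : ℝ) : dist (max p (min a q)) (max p (min b q)) ≤ dist a b := by
    have h1 := (LipschitzWith.id.const_max p (f := fun a : ℝ => a)).dist_le_mul (min a q) (min b q)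
    have h2 := (LipschitzWith.id.min_const q (f := fun a : ℝ => a)).dist_le_mul a b
    simp only [NNReal.coe_one, one_mul] at h1 h2
    exact h1.trans h2
  rw [Prod.dist_eq, Prod.dist_eq]
  refine max_le_max (key _ _ _ _) ?_
  refine (dist_pi_le_iff dist_nonneg).2 fun i => (key _ _ _ _).trans (dist_le_pi_dist Y.2 Z.2 i)

theorem continuous_clampTo (X : ℝ × Sp d) (δ : ℝ) : Continuous (clampTo X δ) :=
  (LipschitzWith.of_dist_le_mul (K := 1) fun Y Z => by
    simpa using dist_clampTo_le X δ Y Z).continuous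

theorem dist_clampTo_center {X : ℝ × Sp d} {δ : ℝ} (hδ : 0 ≤ δ) (Y : ℝ × Sp d) :
    dist (clampTo X δ Y) X ≤ δ := by
  have key (p a : ℝ) : dist (max (p - δ) (min a (p + δ))) p ≤ δ := by
    rw [Real.dist_eq, abs_le]
    exact ⟨by linarith [le_max_left (p - δ) (min a (p + δ))],
      by linarith [max_le (by linarith : p - δ ≤ p + δ) (min_le_right a (p + δ))]⟩
  rw [Prod.dist_eq]
  exact max_le (key _ _) ((dist_pi_le_iff hδ).2 fun i => key _ _)

theorem clampTo_of_dist_le {X Y : ℝ × Sp d} {δ : ℝ} (h : dist Y X ≤ δ) : clampTo X δ Y = Y := by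
  have key (p a : ℝ) (h : dist a p ≤ δ) : max (p - δ) (min a (p + δ)) = a := by
    rw [Real.dist_eq, abs_le] at h
    rw [min_eq_left (by linarith), max_eq_right (by linarith)]
  rw [Prod.dist_eq] at h
  have h2 := (le_max_right _ _).trans h
  refine Prod.ext (key _ _ ((le_max_left _ _).trans h)) (funext fun i => key _ _ ?_)
  exact (dist_le_pi_dist Y.2 X.2 i).trans h2

/-- Near each point the equation is solvable after freezing the coefficients far away. -/
theorem exists_local_solv {α : ℝ} (h0 : 0 < β) (hβα : β < α) (hα : α ≤ 1)
    {c : ℝ → Sp d → Fin d → Fin d → ℝ} {X : ℝ × Sp d}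
    (hs : ∀ i j, c X.1 X.2 i j = c X.1 X.2 j i)
    (hp : ∀ y : Sp d, y ≠ 0 → 0 < ∑ i, ∑ j, c X.1 X.2 i j * y i * y j) (hc : HolAt c α X) :
    ∃ δ C, 0 < δ ∧ 0 < C ∧ ∃ c' : ℝ → Sp d → Fin d → Fin d → ℝ,
      (∀ Y, dist Y X ≤ δ → c' Y.1 Y.2 = c Y.1 Y.2) ∧
      (∀ Y : ℝ × Sp d, ∃ Z : ℝ × Sp d, c' Y.1 Y.2 = c Z.1 Z.2) ∧
      (∀ i j, Mult β fun t x => c' t x i j) ∧ ∀ lam, 1 ≤ lam → Solv β c' C lam := by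
  obtain ⟨U, hU, K, hK, hUK⟩ := hc
  obtain ⟨C, hC, hV⟩ := solv_const (A := c X.1 X.2) h0 (by linarith) hs hp
  obtain ⟨r, hr, hrU⟩ := Metric.mem_nhds_iff.1 hU
  have hab : 0 < α - β := by linarith
  have lim : Tendsto (fun δ : ℝ => (d : ℝ) ^ 2 * ((K * (2 * δ) ^ (α - β)) * C)) (𝓝[>] 0) (𝓝 0) := by
    have : ContinuousAt (fun δ : ℝ => (d : ℝ) ^ 2 * ((K * (2 * δ) ^ (α - β)) * C)) 0 := by
      have : ContinuousAt (fun δ : ℝ => (2 * δ) ^ (α - β)) 0 :=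
        ContinuousAt.rpow_const (by fun_prop) (Or.inr hab.le)
      fun_prop
    have h2 := this.tendsto.mono_left (nhdsWithin_le_nhds (s := Set.Ioi 0))
    simpa [Real.zero_rpow hab.ne'] using h2
  obtain ⟨δ, hδ, hδ0, hδ1⟩ : ∃ δ : ℝ, (d : ℝ) ^ 2 * ((K * (2 * δ) ^ (α - β)) * C) ≤ 1 / 2 ∧
      0 < δ ∧ δ < min r (1 / 2) := by
    have e1 := lim.eventually (ge_mem_nhds (show (0 : ℝ) < 1 / 2 by norm_num))
    have e2 : ∀ᶠ δ in 𝓝[>] (0 : ℝ), 0 < δ := eventually_mem_nhdsWithin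
    have e3 : ∀ᶠ δ in 𝓝[>] (0 : ℝ), δ < min r (1 / 2) :=
      (gt_mem_nhds (show 0 < min r (1 / 2) by positivity)).filter_mono nhdsWithin_le_nhds
    exact (e1.and (e2.and e3)).exists
  have hδr : δ < r := hδ1.trans_le (min_le_left _ _)
  have hδ2 : δ < 1 / 2 := hδ1.trans_le (min_le_right _ _)
  set π := clampTo X δ with hπ
  have hπU (Y) : π Y ∈ U := hrU ((dist_clampTo_center hδ0.le Y).trans_lt hδr)
  have hXU : X ∈ U := mem_of_mem_nhds hU
  have d0 : (0 : ℝ) ≤ 2 * δ := by linarith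
  have hcont (i j) : Continuous fun p : ℝ × Sp d => c (π p).1 (π p).2 i j := by
    refine ContinuousOn.comp_continuous (s := U) (f := π)
      (g := fun q : ℝ × Sp d => c q.1 q.2 i j) ?_ (continuous_clampTo X δ) hπU
    intro q hq
    have hα0 : 0 < α := by linarith
    rw [ContinuousWithinAt, tendsto_iff_dist_tendsto_zero]
    refine squeeze_zero' (Eventually.of_forall fun _ => dist_nonneg)
      (eventually_mem_nhdsWithin.mono fun q' hq' => hUK i j q' hq' q hq) ?_
    have : ContinuousAt (fun q' => K * dist q' q ^ α) q :=
      continuousAt_const.mul (ContinuousAt.rpow_const (by fun_prop) (Or.inr hα0.le))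
    have h2 := this.tendsto.mono_left (nhdsWithin_le_nhds (s := U))
    simpa [Real.zero_rpow hα0.ne'] using h2
  have hm (i j) : MultWith β (K * (2 * δ) ^ (α - β)) fun t x =>
      c (π (t, x)).1 (π (t, x)).2 i j - c X.1 X.2 i j := by
    have hole {D e : ℝ} (hD : 0 ≤ D) (hD1 : D ≤ 2 * δ) (hDe : D ≤ e) :
        K * D ^ α ≤ K * (2 * δ) ^ (α - β) * e ^ β := by
      rw [mul_assoc]
      refine mul_le_mul_of_nonneg_left ?_ hK
      calc D ^ α = D ^ (α - β) * D ^ β := by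
            rw [← Real.rpow_add_of_nonneg hD hab.le h0.le]; ring_nf
        _ ≤ (2 * δ) ^ (α - β) * e ^ β := by gcongr
    refine ⟨?_, fun t x => ?_, fun t x y => ?_⟩
    · exact (hcont i j).sub continuous_const
    · refine (hUK i j _ (hπU _) _ hXU).trans ?_
      have h1 := dist_clampTo_center (X := X) hδ0.le (t, x)
      simpa using hole (e := 1) dist_nonneg (h1.trans (by linarith)) (h1.trans (by linarith))
    · rw [sub_sub_sub_cancel_right]
      refine (hUK i j _ (hπU _) _ (hπU _)).trans ?_
      refine hole dist_nonneg ?_ ?_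
      · have := dist_triangle_right (π (t, x)) (π (t, y)) X
        have h1 := dist_clampTo_center (X := X) hδ0.le (t, x)
        have h2 := dist_clampTo_center (X := X) hδ0.le (t, y)
        linarith
      · refine (dist_clampTo_le X δ _ _).trans ?_
        rw [dist_eq_norm]; simp
  refine ⟨δ, 2 * C, hδ0, by positivity, fun t x => c (π (t, x)).1 (π (t, x)).2, fun Y hY => ?_,
    fun Y => ⟨π Y, rfl⟩, fun i j => ?_, fun lam hl => (hV lam hl).perturb h0 hm hδ⟩
  · simp only [Prod.mk.eta, hπ, clampTo_of_dist_le hY]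
  · simpa using (Mult.add ⟨_, hm i j⟩ (mult_const (c X.1 X.2 i j)))

/-- For all large `λ`, an operator inverting `∂ₜ + λ - ½ Σ cᵢⱼ ∂ᵢⱼ` up to the factor `ζ` and a
small error. -/
def Approx (β : ℝ) (c : ℝ → Sp d → Fin d → Fin d → ℝ) (ζ : ℝ → Sp d → ℝ) : Prop :=
  ∀ ε > 0, ∃ l0, ∀ lam, l0 ≤ lam → ∃ (V0 Vt : HY d β →L[ℝ] HY d β)
    (V1 : Fin d → HY d β →L[ℝ] HY d β) (V2 : Fin d → Fin d → HY d β →L[ℝ] HY d β)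
    (K : HY d β →L[ℝ] HY d β),
    (∀ g, HYRep (V0 g) (Vt g) (fun i => V1 i g) fun i j => V2 i j g) ∧
    (∀ g t x, ev (Vt g) t x + lam * ev (V0 g) t x -
      1 / 2 * ∑ i, ∑ j, c t x i j * ev (V2 i j g) t x = ζ t x * ev g t x + ev (K g) t x) ∧
    ‖K‖ ≤ ε

theorem HYRep.add {u ut v vt : HY d β} {u1 v1 : Fin d → HY d β} {u2 v2 : Fin d → Fin d → HY d β}
    (hu : HYRep u ut u1 u2) (hv : HYRep v vt v1 v2) :
    HYRep (u + v) (ut + vt) (fun i => u1 i + v1 i) fun i j => u2 i j + v2 i j where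
  dt t x := (hu.dt t x).add (hv.dt t x)
  dx t x := by
    simp only [ev_add]
    rw [lin_add]
    exact (hu.dx t x).add (hv.dx t x)
  dxx j t x := by
    simp only [ev_add]
    rw [lin_add]
    exact (hu.dxx j t x).add (hv.dxx j t x)

theorem hasFDerivAt_mul_lin {f g : Sp d → ℝ} {f1 g1 : Fin d → ℝ} {x : Sp d}
    (hf : HasFDerivAt f (lin f1) x) (hg : HasFDerivAt g (lin g1) x) :
    HasFDerivAt (fun y => f y * g y) (lin fun i => f1 i * g x + f x * g1 i) x := by
  refine (hf.mul hg).congr_fderiv ?_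
  rw [← lin_smul, ← lin_smul, ← lin_add]
  congr 1; ext i; ring

theorem approx_of_solv (hβ : 0 < β) {c c' : ℝ → Sp d → Fin d → Fin d → ℝ} {C : ℝ}
    (hc' : ∀ i j, Mult β fun t x => c' t x i j) (h : ∀ lam, 1 ≤ lam → Solv β c' C lam)
    {χ χt : ℝ → Sp d → ℝ} {χ1 : Fin d → ℝ → Sp d → ℝ} {χ2 : Fin d → Fin d → ℝ → Sp d → ℝ}
    (hχ : Cut β χ χt χ1 χ2)
    (hcc : ∀ t x, c t x = c' t x ∨
      (χ t x = 0 ∧ χt t x = 0 ∧ (∀ i, χ1 i t x = 0) ∧ ∀ i j, χ2 i j t x = 0)) :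
    Approx β c χ := by
  obtain ⟨m, hm⟩ := hχ.m.exists_op hβ
  obtain ⟨mt, hmt⟩ := hχ.mt.exists_op hβ
  choose m1 hm1 using fun i => (hχ.m1 i).exists_op hβ
  choose m2 hm2 using fun i j => (hχ.m2 i j).exists_op hβ
  choose k hk using fun i j => (hc' i j).exists_op hβ
  obtain ⟨N, hN⟩ : ∃ N, N = ‖mt‖ + ∑ i, ∑ j, ‖k i j‖ * (‖m2 i j‖ + ‖m1 j‖ + ‖m1 i‖) := ⟨_, rfl⟩
  have hN0 : 0 ≤ N := by
    rw [hN]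
    exact add_nonneg (norm_nonneg _) (Finset.sum_nonneg fun i _ => Finset.sum_nonneg fun j _ =>
      mul_nonneg (norm_nonneg _) (add_nonneg (add_nonneg (norm_nonneg _) (norm_nonneg _))
          (norm_nonneg _)))
  intro ε hε
  have hC0 : 0 ≤ C := by
    obtain ⟨V0, _, _, _, _, _, n0, _⟩ := h 1 le_rfl
    simpa using (norm_nonneg _).trans n0
  refine ⟨max 1 ((N * C / ε) ^ 2), fun lam hl => ?_⟩
  have hl1 : 1 ≤ lam := (le_max_left _ _).trans hl
  have hsmall : N * (C * (√lam)⁻¹) ≤ ε := by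
    have : N * C / ε ≤ √lam := Real.le_sqrt_of_sq_le ((le_max_right _ _).trans hl)
    rw [div_le_iff₀ hε] at this
    have hs : 0 < √lam := Real.sqrt_pos.2 (by linarith)
    rw [← mul_assoc, mul_inv_le_iff₀ hs]
    linarith
  obtain ⟨V0, Vt, V1, V2, hr, he, n0, n1, n2⟩ := h lam hl1
  set e := C * (√lam)⁻¹ with hedef
  have he0 : 0 ≤ e := (norm_nonneg _).trans n0
  obtain ⟨K, hK⟩ : ∃ K, K = mt.comp V0 + (-(1 / 2) : ℝ) • ∑ i, ∑ j, (k i j).comp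
    ((m2 i j).comp V0 + (m1 j).comp (V1 i) + (m1 i).comp (V1 j)) := ⟨_, rfl⟩
  have hKe (g t x) : ev (K g) t x = χt t x * ev (V0 g) t x - 1 / 2 * ∑ i, ∑ j, c' t x i j *
      (χ2 i j t x * ev (V0 g) t x + χ1 j t x * ev (V1 i g) t x + χ1 i t x * ev (V1 j g) t x) := by
    simp [hK, _root_.sum_apply, hk, hm1, hm2, hmt, sub_eq_add_neg, mul_add]
  refine ⟨m.comp V0, mt.comp V0 + m.comp Vt, fun i => (m1 i).comp V0 + m.comp (V1 i),
    fun i j => ((m2 i j).comp V0 + (m1 j).comp (V1 i)) + ((m1 i).comp (V1 j) + m.comp (V2 i j)),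
    K, fun g => ⟨fun t x => ?_, fun t x => ?_, fun j t x => ?_⟩, fun g t x => ?_, ?_⟩
  · have e1 : (fun τ => ev ((m.comp V0) g) τ x) = fun τ => χ τ x * ev (V0 g) τ x :=
      funext fun τ => hm _ _ _
    rw [e1]
    refine ((hχ.dt t x).mul ((hr g).dt t x)).congr_deriv ?_
    simp [hm, hmt]
  · have e1 : ev ((m.comp V0) g) t = fun y => χ t y * ev (V0 g) t y := funext fun y => hm _ _ _
    rw [e1]
    refine (hasFDerivAt_mul_lin (hχ.dx t x) ((hr g).dx t x)).congr_fderiv ?_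
    simp [hm, hm1]
  · have e1 : ev (((m1 j).comp V0 + m.comp (V1 j)) g) t =
        fun y => χ1 j t y * ev (V0 g) t y + χ t y * ev (V1 j g) t y := funext fun y => by
      simp [hm, hm1]
    rw [e1]
    refine ((hasFDerivAt_mul_lin (hχ.dxx j t x) ((hr g).dx t x)).add
      (hasFDerivAt_mul_lin (hχ.dx t x) ((hr g).dxx j t x))).congr_fderiv ?_
    rw [← lin_add]
    simp [hm, hm1, hm2]
  · rw [hKe]
    simp only [ContinuousLinearMap.comp_apply, _root_.add_apply, ev_add, hm, hm1, hm2, hmt]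
    have e1 : ∑ i, ∑ j, c t x i j * (χ2 i j t x * ev (V0 g) t x + χ1 j t x * ev (V1 i g) t x +
        (χ1 i t x * ev (V1 j g) t x + χ t x * ev (V2 i j g) t x)) =
        ∑ i, ∑ j, c' t x i j * (χ2 i j t x * ev (V0 g) t x + χ1 j t x * ev (V1 i g) t x +
        χ1 i t x * ev (V1 j g) t x) + χ t x * ∑ i, ∑ j, c' t x i j * ev (V2 i j g) t x := by
      simp only [Finset.mul_sum, ← Finset.sum_add_distrib]
      refine Finset.sum_congr rfl fun i _ => Finset.sum_congr rfl fun j _ => ?_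
      rcases hcc t x with h | ⟨h1, h2, h3, h4⟩
      · rw [h]; ring
      · simp [h1, h3, h4]
    rw [e1]
    have := he g t x
    linear_combination (χ t x) * this
  · refine le_trans ?_ hsmall
    rw [hK, hN, add_mul]
    have cn {T V : HY d β →L[ℝ] HY d β} {D : ℝ} (hV : ‖V‖ ≤ D) : ‖T.comp V‖ ≤ ‖T‖ * D :=
      (ContinuousLinearMap.opNorm_comp_le _ _).trans (by gcongr)
    refine norm_add_le_of_le (cn n0) ?_
    rw [norm_smul, Finset.sum_mul]
    have : ‖∑ i, ∑ j, (k i j).comp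
        ((m2 i j).comp V0 + (m1 j).comp (V1 i) + (m1 i).comp (V1 j))‖ ≤
        ∑ i, (∑ j, ‖k i j‖ * (‖m2 i j‖ + ‖m1 j‖ + ‖m1 i‖)) * e := by
      refine norm_sum_le_of_le _ fun i _ => ?_
      rw [Finset.sum_mul]
      refine norm_sum_le_of_le _ fun j _ => ?_
      rw [mul_assoc]
      refine cn ?_
      rw [add_mul, add_mul]
      exact norm_add_le_of_le (norm_add_le_of_le (cn n0) (cn (n1 i))) (cn (n1 j))
    refine (mul_le_of_le_one_left (norm_nonneg _) ?_).trans this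
    rw [Real.norm_eq_abs, abs_neg, abs_of_pos] <;> norm_num

theorem Approx.patch (hβ : 0 < β) {c : ℝ → Sp d → Fin d → Fin d → ℝ} {ζ ζ' : ℝ → Sp d → ℝ}
    (h : Approx β c ζ) (h' : Approx β c ζ') (hζ : Mult β ζ) :
    Approx β c fun t x => ζ t x + ζ' t x * (1 - ζ t x) := by
  obtain ⟨m, hm⟩ := ((mult_const 1).sub hζ).exists_op hβ
  intro ε hε
  have hm1 : 0 < ‖m‖ + 1 := by positivity
  obtain ⟨l, hl⟩ := h (ε / 2) (by positivity)
  obtain ⟨l', hl'⟩ := h' (ε / 2 / (‖m‖ + 1)) (by positivity)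
  refine ⟨max l l', fun lam hlam => ?_⟩
  obtain ⟨V0, Vt, V1, V2, K, hr, he, hK⟩ := hl lam ((le_max_left _ _).trans hlam)
  obtain ⟨V0', Vt', V1', V2', K', hr', he', hK'⟩ := hl' lam ((le_max_right _ _).trans hlam)
  refine ⟨V0 + V0'.comp m, Vt + Vt'.comp m, fun i => V1 i + (V1' i).comp m,
    fun i j => V2 i j + (V2' i j).comp m, K + K'.comp m,
    fun g => (hr g).add (hr' (m g)), fun g t x => ?_, ?_⟩
  · have h1 := he g t x
    have h2 := he' (m g) t x
    rw [hm] at h2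
    simp only [_root_.add_apply, ContinuousLinearMap.comp_apply, ev_add, mul_add,
      Finset.sum_add_distrib]
    linarith
  · have := ContinuousLinearMap.opNorm_comp_le K' m
    have h2 : ‖K'‖ * ‖m‖ ≤ ε / 2 := by
      rw [le_div_iff₀ hm1] at hK'
      nlinarith [norm_nonneg K']
    exact (norm_add_le _ _).trans (by linarith)

/-- Local smallness patches to exact solvability on the whole space. -/
theorem Approx.solve {c : ℝ → Sp d → Fin d → Fin d → ℝ} {ζ : ℝ → Sp d → ℝ}
    (h : Approx β c ζ) (hζ : ∀ t x, ζ t x = 1) :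
    ∃ lam : ℝ, ∀ g : HY d β, ∃ (u ut : HY d β) (u1 : Fin d → HY d β) (u2 : Fin d → Fin d → HY d β),
      HYRep u ut u1 u2 ∧ ∀ t x,
      ev ut t x + lam * ev u t x - 1 / 2 * ∑ i, ∑ j, c t x i j * ev (u2 i j) t x = ev g t x := by
  obtain ⟨l, hl⟩ := h (1 / 2) (by norm_num)
  obtain ⟨V0, Vt, V1, V2, K, hr, he, hK⟩ := hl l le_rfl
  obtain ⟨J, hJ, -⟩ := exists_inverse (-K) (by rwa [norm_neg])
  refine ⟨l, fun g => ⟨_, _, _, _, hr (J g), fun t x => ?_⟩⟩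
  rw [he, hζ, one_mul, ← ev_add]
  have := hJ g
  rw [_root_.neg_apply, sub_neg_eq_add] at this
  rw [this]

theorem exists_bump {E : Type*} [NormedAddCommGroup E] [NormedSpace ℝ E] [FiniteDimensional ℝ E]
    {K U : Set E} (hK : IsCompact K) (hU : IsOpen U) (h : K ⊆ U) :
    ∃ χ : E → ℝ, ContDiff ℝ 3 χ ∧ HasCompactSupport χ ∧ tsupport χ ⊆ U ∧
      (∀ x, 0 ≤ χ x ∧ χ x ≤ 1) ∧ ∃ V, IsOpen V ∧ K ⊆ V ∧ ∀ x ∈ V, χ x = 1 := by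
  obtain ⟨L, hL, hKL, hLU⟩ := exists_compact_between hK hU h
  obtain ⟨L', hL', hLL', hLU'⟩ := exists_compact_between hL hU hLU
  obtain ⟨f, hf, hr, hs, h1⟩ := exists_contMDiff_support_eq_eq_one_iff (n := 3)
    (modelWithCornersSelf ℝ E) isOpen_interior hL.isClosed hLL'
  rw [contMDiff_iff_contDiff] at hf
  have ht : tsupport f ⊆ L' := by
    rw [tsupport, hs]
    exact closure_minimal interior_subset hL'.isClosed
  refine ⟨f, hf, hL'.of_isClosed_subset (isClosed_tsupport _) ht, ht.trans hLU',
    fun x => ?_, interior L, isOpen_interior, hKL, fun x hx => (h1 x).1 (interior_subset hx)⟩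
  exact hr (mem_range_self x)

/-- Solvability of the Cauchy problem with zero initial values for coefficients that are constant
outside a compact set. -/
theorem exists_global_solv {α : ℝ} (h0 : 0 < β) (hβα : β < α) (hα : α ≤ 1)
    {c : ℝ → Sp d → Fin d → Fin d → ℝ} (hs : ∀ t x i j, c t x i j = c t x j i)
    (hp : ∀ t x, ∀ y : Sp d, y ≠ 0 → 0 < ∑ i, ∑ j, c t x i j * y i * y j)
    (hc : ∀ X, HolAt c α X) {A : Fin d → Fin d → ℝ} {K : Set (ℝ × Sp d)} (hK : IsCompact K)
    (hA : ∀ X ∉ K, c X.1 X.2 = A) :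
    (∀ i j, Mult β fun t x => c t x i j) ∧
    ∃ lam : ℝ, ∀ g : HY d β, ∃ (u ut : HY d β) (u1 : Fin d → HY d β) (u2 : Fin d → Fin d → HY d β),
      HYRep u ut u1 u2 ∧ ∀ t x,
      ev ut t x + lam * ev u t x - 1 / 2 * ∑ i, ∑ j, c t x i j * ev (u2 i j) t x = ev g t x := by
  have h1 : β ≤ 1 := by linarith
  have patch {ζ ζ' : ℝ → Sp d → ℝ} (h : Mult β ζ ∧ Approx β c ζ ∧
      ∀ i j, Mult β fun t x => ζ t x * c t x i j) (h' : Mult β ζ' ∧ Approx β c ζ' ∧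
      ∀ i j, Mult β fun t x => ζ' t x * c t x i j) :
      Mult β (fun t x => ζ t x + ζ' t x * (1 - ζ t x)) ∧
      Approx β c (fun t x => ζ t x + ζ' t x * (1 - ζ t x)) ∧
      ∀ i j, Mult β fun t x => (ζ t x + ζ' t x * (1 - ζ t x)) * c t x i j := by
    have m1 := (mult_const 1).sub h.1
    refine ⟨h.1.add (h'.1.mul m1), h.2.1.patch h0 h'.2.1 h.1, fun i j => ?_⟩
    convert! (h.2.2 i j).add ((h'.2.2 i j).mul m1) using 3
    ring
  have compact (S : Set (ℝ × Sp d)) (hS : IsCompact S) : ∃ ζ : ℝ → Sp d → ℝ,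
      (Mult β ζ ∧ Approx β c ζ ∧ ∀ i j, Mult β fun t x => ζ t x * c t x i j) ∧
      ∀ X ∈ S, ζ X.1 X.2 = 1 := by
    refine IsCompact.induction_on hS (p := fun S => ∃ ζ : ℝ → Sp d → ℝ,
      (Mult β ζ ∧ Approx β c ζ ∧ ∀ i j, Mult β fun t x => ζ t x * c t x i j) ∧
      ∀ X ∈ S, ζ X.1 X.2 = 1) ?_ (fun s t hst ih => ih.imp fun ζ h => ⟨h.1, fun X hX =>
        h.2 X (hst hX)⟩) (fun _ _ hs ht => ?_) fun X _ => ?_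
    · refine ⟨fun _ _ => 0, ⟨mult_const 0, fun ε hε => ⟨0, fun lam _ => ⟨0, 0, 0, 0, 0,
        fun g => ⟨fun t x => ?_, fun t x => ?_, fun j t x => ?_⟩, by simp, by simp [hε.le]⟩⟩,
        fun i j => by simpa using mult_const 0⟩, by simp⟩
      · simpa using hasDerivAt_const t (0 : ℝ)
      · refine (hasFDerivAt_const (0 : ℝ) x).congr_fderiv ?_
        ext; simp [lin_apply]
      · refine (hasFDerivAt_const (0 : ℝ) x).congr_fderiv ?_
        ext; simp [lin_apply]
    · obtain ⟨ζ, hζ, hζ1⟩ := hs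
      obtain ⟨ζ', hζ', hζ1'⟩ := ht
      refine ⟨_, patch hζ hζ', fun X hX => ?_⟩
      rcases hX with hX | hX
      · simp [hζ1 X hX]
      · simp [hζ1' X hX]
    · obtain ⟨δ, C, hδ, hC, c', hcc', -, hm, hV⟩ :=
        exists_local_solv h0 hβα hα (hs X.1 X.2) (hp X.1 X.2) (hc X)
      obtain ⟨χ, hχ, hχc, hχs, -, V, hVo, hXV, hV1⟩ := exists_bump (K := {X})
        isCompact_singleton (Metric.isOpen_ball (x := X) (ε := δ)) (by simpa using hδ)
      obtain ⟨χt, χ1, χ2, hcut, hout⟩ := exists_cut h0 h1 hχ hχc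
      have key (t x) : c t x = c' t x ∨
          (χ (t, x) = 0 ∧ χt t x = 0 ∧ (∀ i, χ1 i t x = 0) ∧ ∀ i j, χ2 i j t x = 0) := by
        by_cases h : (t, x) ∈ tsupport χ
        · exact Or.inl (hcc' (t, x) (Metric.mem_ball.1 (hχs h)).le).symm
        · exact Or.inr ⟨image_eq_zero_of_notMem_tsupport h, hout (t, x) 0
            (notMem_tsupport_iff_eventuallyEq.1 h)⟩
      refine ⟨V, mem_nhdsWithin_of_mem_nhds (hVo.mem_nhds (by simpa using hXV)),
        fun t x => χ (t, x), ⟨hcut.m, approx_of_solv h0 hm hV hcut key, fun i j => ?_⟩,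
        fun Y hY => hV1 Y hY⟩
      convert! hcut.m.mul (hm i j) using 3 with t x
      rcases key t x with h | h
      · rw [h]
      · simp [h.1]
  obtain ⟨η, hη, hηc, -, -, V, hVo, hKV, hV1⟩ := exists_bump hK isOpen_univ (subset_univ _)
  obtain ⟨ηt, η1, η2, hcut, hout⟩ := exists_cut h0 h1 hη hηc
  obtain ⟨ζ, hζ, hζ1⟩ := compact _ hηc
  have far : Mult β (fun t x => 1 - η (t, x)) ∧ Approx β c (fun t x => 1 - η (t, x)) ∧
      ∀ i j, Mult β fun t x => (1 - η (t, x)) * c t x i j := by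
    have key (t x) : c t x = A ∨ (1 - η (t, x) = 0 ∧ -ηt t x = 0 ∧
        (∀ i, -η1 i t x = 0) ∧ ∀ i j, -η2 i j t x = 0) := by
      by_cases h : (t, x) ∈ K
      · refine Or.inr ?_
        have hev : (fun Y => η Y) =ᶠ[𝓝 (t, x)] fun _ => 1 :=
          Filter.eventuallyEq_of_mem (hVo.mem_nhds (hKV h)) hV1
        obtain ⟨e1, e2, e3⟩ := hout (t, x) 1 hev
        exact ⟨by rw [hV1 _ (hKV h), sub_self], by simp [e1], fun i => by simp [e2],
          fun i j => by simp [e3]⟩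
      · exact Or.inl (hA (t, x) h)
    obtain ⟨D, hD, hV⟩ : ∃ D, 0 < D ∧ ∀ lam, 1 ≤ lam → Solv β (fun _ _ => A) D lam := by
      by_cases hne : ∃ X, X ∉ K
      · obtain ⟨X, hX⟩ := hne
        rw [← hA X hX]
        exact solv_const h0 (by linarith) (hs _ _) (hp _ _)
      · exact absurd (Set.eq_univ_of_forall (by simpa using hne)) hK.ne_univ
    have hmA (i j) : Mult β fun (_ : ℝ) (_ : Sp d) => A i j := mult_const _
    refine ⟨hcut.one_sub.m, approx_of_solv h0 hmA hV hcut.one_sub key, fun i j => ?_⟩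
    convert! hcut.one_sub.m.mul (hmA i j) using 3 with t x
    rcases key t x with h | h
    · rw [h]
    · simp [h.1]
  have tot := patch far hζ
  have one (t x) : (1 - η (t, x)) + ζ t x * (1 - (1 - η (t, x))) = 1 := by
    by_cases h : (t, x) ∈ tsupport η
    · rw [hζ1 _ h]; ring
    · rw [image_eq_zero_of_notMem_tsupport h]; ring
  refine ⟨fun i j => ?_, tot.2.1.solve one⟩
  simpa only [one, one_mul] using tot.2.2 i j

/-- `ut`, `u1`, `u2` are the time derivative, gradient and Hessian of `u` at the points of `O`. -/
structure Jet (O : Set (ℝ × Sp d)) (u ut : ℝ → Sp d → ℝ) (u1 : Fin d → ℝ → Sp d → ℝ)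
    (u2 : Fin d → Fin d → ℝ → Sp d → ℝ) : Prop where
  dt : ∀ t x, (t, x) ∈ O → HasDerivAt (fun τ => u τ x) (ut t x) t
  dx : ∀ t x, (t, x) ∈ O → HasFDerivAt (u t) (lin fun i => u1 i t x) x
  dxx : ∀ j t x, (t, x) ∈ O → HasFDerivAt (u1 j t) (lin fun i => u2 i j t x) x

/-- The elliptic operator `½ Σ cᵢⱼ ∂ᵢⱼ` applied to a function with Hessian `u2`. -/
def Lop (c : ℝ → Sp d → Fin d → Fin d → ℝ) (u2 : Fin d → Fin d → ℝ → Sp d → ℝ) (t : ℝ)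
    (x : Sp d) : ℝ :=
  1 / 2 * ∑ i, ∑ j, c t x i j * u2 i j t x

namespace Jet

variable {O O' : Set (ℝ × Sp d)} {u ut v vt : ℝ → Sp d → ℝ} {u1 v1 : Fin d → ℝ → Sp d → ℝ}
  {u2 v2 : Fin d → Fin d → ℝ → Sp d → ℝ}

theorem mono (h : Jet O u ut u1 u2) (hO : O' ⊆ O) : Jet O' u ut u1 u2 :=
  ⟨fun t x hx => h.dt t x (hO hx), fun t x hx => h.dx t x (hO hx),
    fun j t x hx => h.dxx j t x (hO hx)⟩

theorem add (hu : Jet O u ut u1 u2) (hv : Jet O v vt v1 v2) :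
    Jet O (fun t x => u t x + v t x) (fun t x => ut t x + vt t x)
      (fun i t x => u1 i t x + v1 i t x) fun i j t x => u2 i j t x + v2 i j t x where
  dt t x hx := (hu.dt t x hx).add (hv.dt t x hx)
  dx t x hx := by
    rw [lin_add]
    exact (hu.dx t x hx).add (hv.dx t x hx)
  dxx j t x hx := by
    rw [lin_add]
    exact (hu.dxx j t x hx).add (hv.dxx j t x hx)

theorem smul (hu : Jet O u ut u1 u2) (k : ℝ) :
    Jet O (fun t x => k * u t x) (fun t x => k * ut t x)
      (fun i t x => k * u1 i t x) fun i j t x => k * u2 i j t x where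
  dt t x hx := (hu.dt t x hx).const_mul k
  dx t x hx := by
    rw [lin_smul]
    exact (hu.dx t x hx).const_mul k
  dxx j t x hx := by
    rw [lin_smul]
    exact (hu.dxx j t x hx).const_mul k

theorem neg (hu : Jet O u ut u1 u2) :
    Jet O (fun t x => -u t x) (fun t x => -ut t x)
      (fun i t x => -u1 i t x) fun i j t x => -u2 i j t x := by
  simpa using hu.smul (-1)

theorem sub (hu : Jet O u ut u1 u2) (hv : Jet O v vt v1 v2) :
    Jet O (fun t x => u t x - v t x) (fun t x => ut t x - vt t x)
      (fun i t x => u1 i t x - v1 i t x) fun i j t x => u2 i j t x - v2 i j t x := by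
  simpa only [sub_eq_add_neg] using hu.add hv.neg

theorem mul (hu : Jet O u ut u1 u2) (hv : Jet O v vt v1 v2) :
    Jet O (fun t x => u t x * v t x) (fun t x => ut t x * v t x + u t x * vt t x)
      (fun i t x => u1 i t x * v t x + u t x * v1 i t x) fun i j t x =>
        (u2 i j t x * v t x + u1 j t x * v1 i t x) + (u1 i t x * v1 j t x + u t x * v2 i j t x) where
  dt t x hx := (hu.dt t x hx).mul (hv.dt t x hx)
  dx t x hx := hasFDerivAt_mul_lin (hu.dx t x hx) (hv.dx t x hx)
  dxx j t x hx := by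
    refine ((hasFDerivAt_mul_lin (hu.dxx j t x hx) (hv.dx t x hx)).add
      (hasFDerivAt_mul_lin (hu.dx t x hx) (hv.dxx j t x hx))).congr_fderiv ?_
    rw [← lin_add]

theorem congr (hu : Jet O u ut u1 u2) (hO : IsOpen O) (h : ∀ t x, (t, x) ∈ O → v t x = u t x) :
    Jet O v ut u1 u2 where
  dt t x hx := (hu.dt t x hx).congr_of_eventuallyEq <| by
    have : ContinuousAt (fun τ : ℝ => (τ, x)) t := by fun_prop
    exact (this.eventually (hO.mem_nhds hx)).mono fun τ hτ => h τ x hτ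
  dx t x hx := (hu.dx t x hx).congr_of_eventuallyEq <| by
    have : ContinuousAt (fun y : Sp d => (t, y)) x := by fun_prop
    exact (this.eventually (hO.mem_nhds hx)).mono fun τ hτ => h t τ hτ
  dxx j t x hx := hu.dxx j t x hx

end Jet

theorem HYRep.rep {u ut : HY d β} {u1 : Fin d → HY d β} {u2 : Fin d → Fin d → HY d β}
    (h : HYRep u ut u1 u2) (O : Set (ℝ × Sp d)) :
    Jet O (ev u) (ev ut) (fun i => ev (u1 i)) fun i j => ev (u2 i j) :=
  ⟨fun t x _ => h.dt t x, fun t x _ => h.dx t x, fun j t x _ => h.dxx j t x⟩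

theorem Lop_add (c : ℝ → Sp d → Fin d → Fin d → ℝ) (u2 v2 : Fin d → Fin d → ℝ → Sp d → ℝ)
    (t : ℝ) (x : Sp d) :
    Lop c (fun i j t x => u2 i j t x + v2 i j t x) t x = Lop c u2 t x + Lop c v2 t x := by
  simp only [Lop, mul_add, Finset.sum_add_distrib]

theorem Lop_smul (c : ℝ → Sp d → Fin d → Fin d → ℝ) (u2 : Fin d → Fin d → ℝ → Sp d → ℝ)
    (k t : ℝ) (x : Sp d) : Lop c (fun i j t x => k * u2 i j t x) t x = k * Lop c u2 t x := by
  simp only [Lop, Finset.mul_sum]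
  exact Finset.sum_congr rfl fun i _ => Finset.sum_congr rfl fun j _ => by ring

theorem Lop_neg (c : ℝ → Sp d → Fin d → Fin d → ℝ) (u2 : Fin d → Fin d → ℝ → Sp d → ℝ)
    (t : ℝ) (x : Sp d) : Lop c (fun i j t x => -u2 i j t x) t x = -Lop c u2 t x := by
  simpa using Lop_smul c u2 (-1) t x

theorem Lop_sub (c : ℝ → Sp d → Fin d → Fin d → ℝ) (u2 v2 : Fin d → Fin d → ℝ → Sp d → ℝ)
    (t : ℝ) (x : Sp d) :
    Lop c (fun i j t x => u2 i j t x - v2 i j t x) t x = Lop c u2 t x - Lop c v2 t x := by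
  simp only [Lop, mul_sub, Finset.sum_sub_distrib]

/-- The pairing of a positive semidefinite and a negative semidefinite form is nonpositive. -/
theorem sum_mul_nonpos {A H : Fin d → Fin d → ℝ} (hs : ∀ i j, A i j = A j i)
    (hp : ∀ y : Sp d, 0 ≤ ∑ i, ∑ j, A i j * y i * y j)
    (hH : ∀ y : Sp d, ∑ i, ∑ j, H i j * y i * y j ≤ 0) : ∑ i, ∑ j, A i j * H i j ≤ 0 := by
  have hA : (Matrix.of A).PosSemidef := by
    refine Matrix.PosSemidef.of_dotProduct_mulVec_nonneg ?_ fun y => ?_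
    · ext i j; simp [Matrix.conjTranspose_apply, hs j i]
    · refine (hp y).trans_eq ?_
      simp only [dotProduct, Matrix.mulVec, Matrix.of_apply, Finset.mul_sum, Pi.star_apply,
        star_trivial]
      exact Finset.sum_congr rfl fun i _ => Finset.sum_congr rfl fun j _ => by ring
  obtain ⟨m, B, hB⟩ := Matrix.posSemidef_iff_eq_sum_vecMulVec.1 hA
  have hAB (i j) : A i j = ∑ k, B k i * B k j := by
    have := congrFun (congrFun hB i) j
    simpa [Matrix.sum_apply, Matrix.vecMulVec_apply] using this
  have : ∑ i, ∑ j, A i j * H i j = ∑ k, ∑ i, ∑ j, H i j * B k i * B k j := by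
    simp only [hAB, Finset.sum_mul]
    symm
    rw [Finset.sum_comm]
    refine Finset.sum_congr rfl fun i _ => ?_
    rw [Finset.sum_comm]
    exact Finset.sum_congr rfl fun j _ => Finset.sum_congr rfl fun k _ => by ring
  rw [this]
  exact Finset.sum_nonpos fun k _ => hH (B k)

theorem hess_nonpos {f : Sp d → ℝ} {g : Fin d → Sp d → ℝ} {H : Fin d → Fin d → ℝ} {x : Sp d}
    (hf : ∀ᶠ y in 𝓝 x, HasFDerivAt f (lin fun i => g i y) y)
    (hg : ∀ j, HasFDerivAt (g j) (lin fun i => H i j) x) (hm : IsLocalMax f x) (v : Sp d) :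
    ∑ i, ∑ j, H i j * v i * v j ≤ 0 := by
  by_contra! hpos
  have hl (s : ℝ) : HasDerivAt (fun s : ℝ => x + s • v) v s := by
    simpa using ((hasDerivAt_id s).smul_const v).const_add x
  have hc : ContinuousAt (fun s : ℝ => x + s • v) 0 := (hl 0).continuousAt
  have hx : (fun s : ℝ => x + s • v) 0 = x := by simp
  rw [← hx] at hf
  have h1 : ∀ᶠ s : ℝ in 𝓝 0, HasDerivAt (fun s : ℝ => f (x + s • v))
      (∑ i, g i (x + s • v) * v i) s := (hc.eventually hf).mono fun s hs => by
    have := hs.comp_hasDerivAt s (hl s)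
    rw [lin_apply] at this
    exact this
  have h2 : HasDerivAt (fun s : ℝ => ∑ i, g i (x + s • v) * v i)
      (∑ i, ∑ j, H i j * v i * v j) 0 := by
    have : HasDerivAt (fun s : ℝ => ∑ j, g j (x + s • v) * v j)
        (∑ j, (∑ i, H i j * v i) * v j) 0 := HasDerivAt.fun_sum fun j _ => by
      have e : HasFDerivAt (g j) (lin fun i => H i j) ((fun s : ℝ => x + s • v) 0) := by
        rw [hx]; exact hg j
      simpa [lin_apply] using (e.comp_hasDerivAt (0 : ℝ) (hl 0)).mul_const (v j)
    convert this using 1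
    rw [Finset.sum_comm]
    simp only [Finset.sum_mul]
  have hd : deriv (fun s : ℝ => f (x + s • v)) =ᶠ[𝓝 0] fun s : ℝ => ∑ i, g i (x + s • v) * v i :=
    h1.mono fun s hs => hs.deriv
  have hmax : IsLocalMax (fun s : ℝ => f (x + s • v)) 0 := by
    rw [← hx] at hm
    have := hc.eventually hm
    simpa [IsLocalMax, IsMaxFilter] using this
  have hdd : deriv (deriv fun s : ℝ => f (x + s • v)) 0 = ∑ i, ∑ j, H i j * v i * v j := by
    rw [hd.deriv_eq, h2.deriv]
  have hmin := isLocalMin_of_deriv_deriv_pos (by rw [hdd]; exact hpos) hmax.deriv_eq_zero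
    h1.self_of_nhds.continuousAt
  have hconst : (fun s : ℝ => f (x + s • v)) =ᶠ[𝓝 0] fun _ => f (x + (0 : ℝ) • v) := by
    filter_upwards [hmax, hmin] with s h h'
    exact le_antisymm h h'
  have : deriv (deriv fun s : ℝ => f (x + s • v)) 0 = 0 := by
    rw [hconst.deriv.deriv_eq]
    simp
  linarith

/-- Weak maximum principle on a bounded cylinder. -/
theorem nonpos_of_cylinder {c : ℝ → Sp d → Fin d → Fin d → ℝ} {s T : ℝ} {D : Set (Sp d)}
    (hD : IsOpen D) (hDc : IsCompact (closure D))
    (hs : ∀ t ∈ Set.Ioo s T, ∀ x ∈ D, ∀ i j, c t x i j = c t x j i)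
    (hp : ∀ t ∈ Set.Ioo s T, ∀ x ∈ D, ∀ y : Sp d, 0 ≤ ∑ i, ∑ j, c t x i j * y i * y j)
    {w wt : ℝ → Sp d → ℝ} {w1 : Fin d → ℝ → Sp d → ℝ} {w2 : Fin d → Fin d → ℝ → Sp d → ℝ}
    (hw : Jet (Set.Ioo s T ×ˢ D) w wt w1 w2)
    (hc : ContinuousOn (fun X : ℝ × Sp d => w X.1 X.2) (Set.Icc s T ×ˢ closure D))
    (hsub : ∀ t ∈ Set.Ioo s T, ∀ x ∈ D, 0 < w t x → wt t x < Lop c w2 t x)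
    (h0 : ∀ x ∈ closure D, w s x ≤ 0)
    (hb : ∀ t ∈ Set.Icc s T, ∀ x ∈ frontier D, w t x ≤ 0) :
    ∀ t ∈ Set.Icc s T, ∀ x ∈ closure D, w t x ≤ 0 := by
  have main : ∀ t ∈ Set.Ico s T, ∀ x ∈ closure D, w t x ≤ 0 := by
    intro t ht x hx
    by_contra! hpos
    have hsubset : Set.Icc s t ×ˢ closure D ⊆ Set.Icc s T ×ˢ closure D :=
      prod_mono (Set.Icc_subset_Icc le_rfl ht.2.le) le_rfl
    obtain ⟨⟨t0, x0⟩, ⟨ht0, hx0⟩, hmax⟩ := (isCompact_Icc.prod hDc).exists_isMaxOn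
      ⟨(t, x), ⟨Set.right_mem_Icc.2 ht.1, hx⟩⟩ (hc.mono hsubset)
    have hle (τ) (hτ : τ ∈ Set.Icc s t) (y) (hy : y ∈ closure D) : w τ y ≤ w t0 x0 :=
      hmax (a := (τ, y)) ⟨hτ, hy⟩
    have hpos0 : 0 < w t0 x0 := hpos.trans_le (hle t (Set.right_mem_Icc.2 ht.1) x hx)
    simp only at ht0 hx0
    have hst : s < t0 := lt_of_le_of_ne ht0.1 fun h => by
      have := h0 x0 hx0
      rw [h] at this
      linarith
    have hxD : x0 ∈ D := by
      by_contra hn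
      have := hb t0 ⟨ht0.1, ht0.2.trans ht.2.le⟩ x0 ⟨hx0, by rwa [hD.interior_eq]⟩
      linarith
    have htT : t0 ∈ Set.Ioo s T := ⟨hst, ht0.2.trans_lt ht.2⟩
    have h1 := hsub t0 htT x0 hxD hpos0
    have h2 : 0 ≤ wt t0 x0 := by
      have hd := (hw.dt t0 x0 ⟨htT, hxD⟩).hasDerivWithinAt (s := Set.Iio t0)
      rw [hasDerivWithinAt_iff_tendsto_slope' (by simp)] at hd
      refine ge_of_tendsto hd ?_
      filter_upwards [Ioo_mem_nhdsLT hst] with τ hτ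
      rw [slope_def_field]
      exact div_nonneg_of_nonpos (by
        have := hle τ ⟨hτ.1.le, hτ.2.le.trans ht0.2⟩ x0 hx0
        linarith) (by linarith [hτ.2])
    have h3 : Lop c w2 t0 x0 ≤ 0 := by
      refine mul_nonpos_of_nonneg_of_nonpos (by norm_num)
        (sum_mul_nonpos (hs t0 htT x0 hxD) (hp t0 htT x0 hxD) fun v => ?_)
      refine hess_nonpos (f := w t0) (g := fun i => w1 i t0) (x := x0) ?_
        (fun j => hw.dxx j t0 x0 ⟨htT, hxD⟩) ?_ v
      · filter_upwards [hD.mem_nhds hxD] with y hy using hw.dx t0 y ⟨htT, hy⟩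
      · filter_upwards [hD.mem_nhds hxD] with y hy using hle t0 ht0 y (subset_closure hy)
    linarith
  intro t ht x hx
  rcases ht.2.lt_or_eq with h | rfl
  · exact main t ⟨ht.1, h⟩ x hx
  rcases ht.1.eq_or_lt with rfl | h
  · exact h0 x hx
  · have hct : ContinuousWithinAt (fun τ => w τ x) (Set.Ico s t) t := by
      have := hc (t, x) ⟨ht, hx⟩
      exact (this.comp (f := fun τ : ℝ => (τ, x)) (by fun_prop : Continuous fun τ : ℝ => (τ, x)).continuousWithinAt
        fun τ hτ => ⟨Set.Ico_subset_Icc_self hτ, hx⟩)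
    have hne : (𝓝[Set.Ico s t] t).NeBot := by
      rw [← mem_closure_iff_nhdsWithin_neBot, closure_Ico h.ne]
      exact ht
    exact le_of_tendsto hct (eventually_mem_nhdsWithin.mono fun τ hτ => main τ hτ x hx)

/-- Comparison with a barrier on a bounded cylinder. -/
theorem abs_le_of_cylinder {c : ℝ → Sp d → Fin d → Fin d → ℝ} {s T lam : ℝ} (hlam : 0 ≤ lam)
    {D : Set (Sp d)} (hD : IsOpen D) (hDc : IsCompact (closure D))
    (hs : ∀ t ∈ Set.Ioo s T, ∀ x ∈ D, ∀ i j, c t x i j = c t x j i)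
    (hp : ∀ t ∈ Set.Ioo s T, ∀ x ∈ D, ∀ y : Sp d, 0 ≤ ∑ i, ∑ j, c t x i j * y i * y j)
    {u ut b bt : ℝ → Sp d → ℝ} {u1 b1 : Fin d → ℝ → Sp d → ℝ}
    {u2 b2 : Fin d → Fin d → ℝ → Sp d → ℝ}
    (hu : Jet (Set.Ioo s T ×ˢ D) u ut u1 u2) (hbr : Jet (Set.Ioo s T ×ˢ D) b bt b1 b2)
    (hc : ContinuousOn (fun X : ℝ × Sp d => u X.1 X.2) (Set.Icc s T ×ˢ closure D))
    (hcb : ContinuousOn (fun X : ℝ × Sp d => b X.1 X.2) (Set.Icc s T ×ˢ closure D))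
    (hsub : ∀ t ∈ Set.Ioo s T, ∀ x ∈ D, |ut t x + lam * u t x - Lop c u2 t x| <
      bt t x + lam * b t x - Lop c b2 t x)
    (h0 : ∀ x ∈ closure D, |u s x| ≤ b s x)
    (hb : ∀ t ∈ Set.Icc s T, ∀ x ∈ frontier D, |u t x| ≤ b t x) :
    ∀ t ∈ Set.Icc s T, ∀ x ∈ closure D, |u t x| ≤ b t x := by
  intro t ht x hx
  refine abs_le'.2 ⟨?_, ?_⟩
  · refine sub_nonpos.1 (nonpos_of_cylinder hD hDc hs hp (hu.sub hbr) (hc.sub hcb)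
      (fun τ hτ y hy hpos => ?_) (fun y hy => sub_nonpos.2 (le_of_abs_le (h0 y hy)))
      (fun τ hτ y hy => sub_nonpos.2 (le_of_abs_le (hb τ hτ y hy))) t ht x hx)
    rw [Lop_sub]
    have := le_of_abs_le (hsub τ hτ y hy).le
    have h1 := (abs_lt.1 (hsub τ hτ y hy)).2
    nlinarith [mul_nonneg hlam hpos.le]
  · refine sub_nonpos.1 (nonpos_of_cylinder hD hDc hs hp (hu.neg.sub hbr) (hc.neg.sub hcb)
      (fun τ hτ y hy hpos => ?_) (fun y hy => sub_nonpos.2 (abs_le'.1 (h0 y hy)).2)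
      (fun τ hτ y hy => sub_nonpos.2 (abs_le'.1 (hb τ hτ y hy)).2) t ht x hx)
    rw [Lop_sub, Lop_neg]
    have h1 := (abs_lt.1 (hsub τ hτ y hy)).1
    nlinarith [mul_nonneg hlam hpos.le]

/-- The weight `1 + |x|²`. -/
def qw (x : Sp d) : ℝ := 1 + ∑ i, x i ^ 2

/-- Barrier functions of polynomial growth in space and exponential growth in time. -/
def bar (l : ℝ) (m : ℕ) (t : ℝ) (x : Sp d) : ℝ := Real.exp (l * t) * qw x ^ (m + 2)

theorem one_le_qw (x : Sp d) : 1 ≤ qw x := by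
  have : 0 ≤ ∑ i, x i ^ 2 := Finset.sum_nonneg fun i _ => sq_nonneg _
  unfold qw; linarith

theorem qw_pos (x : Sp d) : 0 < qw x := one_pos.trans_le (one_le_qw x)

theorem continuous_qw : Continuous (qw : Sp d → ℝ) := by
  unfold qw
  fun_prop

theorem bar_pos (l : ℝ) (m : ℕ) (t : ℝ) (x : Sp d) : 0 < bar l m t x :=
  mul_pos (Real.exp_pos _) (pow_pos (qw_pos x) _)

theorem continuous_bar (l : ℝ) (m : ℕ) : Continuous fun X : ℝ × Sp d => bar l m X.1 X.2 := by
  have := continuous_qw (d := d)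
  unfold bar
  fun_prop

theorem sq_le_qw (x : Sp d) (i : Fin d) : x i ^ 2 ≤ qw x := by
  have := Finset.single_le_sum (f := fun i => x i ^ 2) (fun i _ => sq_nonneg _) (Finset.mem_univ i)
  unfold qw; linarith

theorem norm_sq_le_qw (x : Sp d) : 1 + ‖x‖ ^ 2 ≤ qw x := by
  have h0 : 0 ≤ ∑ i, x i ^ 2 := Finset.sum_nonneg fun i _ => sq_nonneg _
  have : ‖x‖ ≤ √(∑ i, x i ^ 2) := (pi_norm_le_iff_of_nonneg (Real.sqrt_nonneg _)).2 fun i =>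
    Real.abs_le_sqrt (Finset.single_le_sum (f := fun i => x i ^ 2) (fun i _ => sq_nonneg _)
      (Finset.mem_univ i))
  have h1 := Real.sq_sqrt h0
  unfold qw
  nlinarith [norm_nonneg x]

theorem qw_le (x : Sp d) : qw x ≤ (d + 1) * (1 + ‖x‖ ^ 2) := by
  have : ∑ i, x i ^ 2 ≤ ∑ _i : Fin d, ‖x‖ ^ 2 := Finset.sum_le_sum fun i _ => by
    rw [← sq_abs]
    exact pow_le_pow_left₀ (abs_nonneg _) (norm_le_pi_norm x i) 2
  simp at this
  unfold qw
  nlinarith [sq_nonneg ‖x‖, (Nat.cast_nonneg d : (0 : ℝ) ≤ d)]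

theorem exists_rep_bar (l : ℝ) (m : ℕ) : ∃ (b1 : Fin d → ℝ → Sp d → ℝ)
    (b2 : Fin d → Fin d → ℝ → Sp d → ℝ),
    (∀ O, Jet O (bar l m) (fun t x => l * bar l m t x) b1 b2) ∧
    ∀ i j t x, qw x * |b2 i j t x| ≤ 4 * (m + 2) ^ 2 * bar l m t x := by
  have hq (x : Sp d) : HasFDerivAt qw (lin fun i => 2 * x i) x := by
    have (i : Fin d) : HasFDerivAt (fun x : Sp d => x i ^ 2) (lin (Pi.single i (2 * x i))) x := by
      refine ((hasFDerivAt_apply (𝕜 := ℝ) i x).pow 2).congr_fderiv ?_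
      ext y
      simp [lin_apply, Pi.single_apply]
    refine ((HasFDerivAt.fun_sum fun i _ => this i).const_add 1).congr_fderiv ?_
    ext y
    simp [lin_apply, _root_.sum_apply, Pi.single_apply]
  have hqn (n : ℕ) (x : Sp d) :
      HasFDerivAt (fun x => qw x ^ (n + 1)) (lin fun i => (n + 1) * qw x ^ n * (2 * x i)) x := by
    refine ((hq x).pow (n + 1)).congr_fderiv ?_
    ext y
    simp [lin_apply, Finset.mul_sum, mul_assoc]
  refine ⟨fun i t x => Real.exp (l * t) * ((m + 1 + 1) * qw x ^ (m + 1) * (2 * x i)),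
    fun i j t x => Real.exp (l * t) * ((m + 1 + 1) * 2 * ((m + 1) * qw x ^ m * (2 * x i) * x j +
      qw x ^ (m + 1) * (Pi.single j 1 : Sp d) i)),
    fun O => ⟨fun t x _ => ?_, fun t x _ => ?_, fun j t x _ => ?_⟩, fun i j t x => ?_⟩
  · have := (((hasDerivAt_id t).const_mul l).exp).mul_const (qw x ^ (m + 2))
    refine this.congr_deriv ?_
    simp [bar]; ring
  · refine ((hqn (m + 1) x).const_mul (Real.exp (l * t))).congr_fderiv ?_
    ext y
    simp [lin_apply, Finset.mul_sum, mul_assoc]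
  · have h1 : HasFDerivAt (fun x : Sp d => x j) (lin (Pi.single j 1)) x := by
      refine (hasFDerivAt_apply (𝕜 := ℝ) j x).congr_fderiv ?_
      ext y
      simp [lin_apply, Pi.single_apply]
    have h2 := ((hasFDerivAt_mul_lin (hqn m x) h1).const_mul ((m + 1 + 1 : ℝ) * 2)).const_mul
      (Real.exp (l * t))
    refine (h2.congr_fderiv ?_).congr_of_eventuallyEq (Eventually.of_forall fun y => ?_)
    · rw [← lin_smul, ← lin_smul]
    · ring
  · have e : (0 : ℝ) ≤ Real.exp (l * t) := (Real.exp_pos _).le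
    have q0 := qw_pos x
    have h1 : |x i * x j| ≤ qw x := by
      rw [abs_mul]
      nlinarith [sq_le_qw x i, sq_le_qw x j, sq_abs (x i), sq_abs (x j),
        sq_nonneg (|x i| - |x j|)]
    have h2 : |(Pi.single j 1 : Sp d) i| ≤ 1 := by
      rw [Pi.single_apply]; split_ifs <;> simp
    have h3 : |(m + 1) * qw x ^ m * (2 * x i) * x j + qw x ^ (m + 1) * (Pi.single j 1 : Sp d) i| ≤
        2 * (m + 1) * qw x ^ (m + 1) + qw x ^ (m + 1) := by
      refine (abs_add_le _ _).trans (add_le_add ?_ ?_)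
      · rw [show (m + 1) * qw x ^ m * (2 * x i) * x j = 2 * (m + 1) * qw x ^ m * (x i * x j) by ring,
          abs_mul, abs_of_nonneg (by positivity), pow_succ, ← mul_assoc]
        gcongr
      · rw [abs_mul, abs_of_nonneg (by positivity)]
        exact mul_le_of_le_one_right (by positivity) h2
    rw [abs_mul, abs_of_nonneg e, abs_mul, abs_of_nonneg (by positivity)]
    calc qw x * (Real.exp (l * t) * ((m + 1 + 1) * 2 *
          |(m + 1) * qw x ^ m * (2 * x i) * x j + qw x ^ (m + 1) * (Pi.single j 1 : Sp d) i|))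
        ≤ qw x * (Real.exp (l * t) * ((m + 1 + 1) * 2 *
          (2 * (m + 1) * qw x ^ (m + 1) + qw x ^ (m + 1)))) := by gcongr
      _ = (2 * (m + 2) * (2 * m + 3)) * bar l m t x := by unfold bar; ring
      _ ≤ _ := by
        refine mul_le_mul_of_nonneg_right ?_ (bar_pos l m t x).le
        nlinarith [(Nat.cast_nonneg m : (0 : ℝ) ≤ m)]

/-- The growth rate that makes `bar` a strict barrier for coefficients bounded by `K (1 + |x|²)`. -/
theorem exists_barrier (K : ℝ) (m : ℕ) : ∃ l0 : ℝ, 0 ≤ l0 ∧ ∀ l, l0 ≤ l →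
    ∃ (b1 : Fin d → ℝ → Sp d → ℝ) (b2 : Fin d → Fin d → ℝ → Sp d → ℝ),
    (∀ O, Jet O (bar l m) (fun t x => l * bar l m t x) b1 b2) ∧
    ∀ (c : ℝ → Sp d → Fin d → Fin d → ℝ) t x, (∀ i j, |c t x i j| ≤ K * qw x) →
      Lop c b2 t x < l * bar l m t x := by
  refine ⟨d * d * (|K| * (4 * (m + 2) ^ 2)) + 1, by positivity, fun l hl => ?_⟩
  obtain ⟨b1, b2, hr, hb⟩ := exists_rep_bar (d := d) l m
  refine ⟨b1, b2, hr, fun c t x hc => ?_⟩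
  have hbp := bar_pos l m t x
  have : ∑ i, ∑ j, c t x i j * b2 i j t x ≤
      ∑ _i : Fin d, ∑ _j : Fin d, |K| * (4 * (m + 2) ^ 2) * bar l m t x := by
    refine Finset.sum_le_sum fun i _ => Finset.sum_le_sum fun j _ => ?_
    calc c t x i j * b2 i j t x ≤ |c t x i j| * |b2 i j t x| := by
          rw [← abs_mul]; exact le_abs_self _
      _ ≤ (|K| * qw x) * |b2 i j t x| := by
        gcongr
        exact (hc i j).trans (mul_le_mul_of_nonneg_right (le_abs_self K) (qw_pos x).le)
      _ ≤ _ := by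
        rw [mul_assoc, mul_assoc]
        exact mul_le_mul_of_nonneg_left (hb i j t x) (abs_nonneg K)
  simp only [Finset.sum_const, Finset.card_univ, Fintype.card_fin, nsmul_eq_mul] at this
  unfold Lop
  have h0 : (0 : ℝ) ≤ d * d * (|K| * (4 * (m + 2) ^ 2)) := by positivity
  nlinarith [mul_nonneg h0 hbp.le, mul_le_mul_of_nonneg_right hl hbp.le]

theorem isOpen_qw_lt (R : ℝ) : IsOpen {x : Sp d | qw x < R} :=
  isOpen_lt continuous_qw continuous_const

theorem closure_qw_lt_subset (R : ℝ) : closure {x : Sp d | qw x < R} ⊆ {x | qw x ≤ R} :=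
  closure_minimal (fun x (hx : qw x < R) => hx.le) (isClosed_le continuous_qw continuous_const)

theorem isCompact_qw_le (R : ℝ) : IsCompact {x : Sp d | qw x ≤ R} := by
  refine Metric.isCompact_of_isClosed_isBounded (isClosed_le continuous_qw continuous_const)
    ((Metric.isBounded_closedBall (x := (0 : Sp d)) (r := |R| + 1)).subset fun x hx => ?_)
  rw [mem_closedBall_zero_iff]
  have h1 := norm_sq_le_qw x
  have h2 : qw x ≤ R := hx
  nlinarith [sq_nonneg (‖x‖ - 1), le_abs_self R, norm_nonneg x]

theorem isCompact_closure_qw_lt (R : ℝ) : IsCompact (closure {x : Sp d | qw x < R}) :=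
  (isCompact_qw_le R).of_isClosed_subset isClosed_closure (closure_qw_lt_subset R)

theorem frontier_qw_lt {R : ℝ} {x : Sp d} (hx : x ∈ frontier {x : Sp d | qw x < R}) : qw x = R :=
  frontier_lt_subset_eq continuous_qw continuous_const hx

/-- Comparison with a barrier on the whole space, for functions of polynomial growth. -/
theorem abs_le_of_growth {c : ℝ → Sp d → Fin d → Fin d → ℝ} {s T lam K C : ℝ} {m : ℕ}
    (hlam : 0 ≤ lam)
    (hs : ∀ t ∈ Set.Ioo s T, ∀ x, ∀ i j, c t x i j = c t x j i)
    (hp : ∀ t ∈ Set.Ioo s T, ∀ x, ∀ y : Sp d, 0 ≤ ∑ i, ∑ j, c t x i j * y i * y j)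
    (hK : ∀ t ∈ Set.Ioo s T, ∀ x i j, |c t x i j| ≤ K * qw x)
    {u ut b bt : ℝ → Sp d → ℝ} {u1 b1 : Fin d → ℝ → Sp d → ℝ}
    {u2 b2 : Fin d → Fin d → ℝ → Sp d → ℝ}
    (hu : Jet (Set.Ioo s T ×ˢ univ) u ut u1 u2) (hbr : Jet (Set.Ioo s T ×ˢ univ) b bt b1 b2)
    (hc : ContinuousOn (fun X : ℝ × Sp d => u X.1 X.2) (Set.Icc s T ×ˢ univ))
    (hcb : ContinuousOn (fun X : ℝ × Sp d => b X.1 X.2) (Set.Icc s T ×ˢ univ))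
    (hb0 : ∀ t ∈ Set.Icc s T, ∀ x, 0 ≤ b t x)
    (hg : ∀ t ∈ Set.Icc s T, ∀ x, |u t x| ≤ C * qw x ^ m)
    (hsub : ∀ t ∈ Set.Ioo s T, ∀ x, |ut t x + lam * u t x - Lop c u2 t x| ≤
      bt t x + lam * b t x - Lop c b2 t x)
    (h0 : ∀ x, |u s x| ≤ b s x) :
    ∀ t ∈ Set.Icc s T, ∀ x, |u t x| ≤ b t x := by
  intro t ht x
  obtain ⟨l, hl0, hl⟩ := exists_barrier (d := d) K m
  obtain ⟨e1, e2, he, hle⟩ := hl l le_rfl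
  refine le_of_forall_pos_le_add fun ε hε => ?_
  have hbx := bar_pos l m t x
  obtain ⟨η, hη, hηε⟩ : ∃ η, 0 < η ∧ η * bar l m t x = ε :=
    ⟨ε / bar l m t x, by positivity, by field_simp⟩
  have hexp : 0 < Real.exp (l * s) := Real.exp_pos _
  obtain ⟨R, hxR, hR0, hR⟩ : ∃ R, qw x < R ∧ 0 < R ∧ |C| ≤ η * (Real.exp (l * s) * R) := by
    refine ⟨max (qw x + 1) (|C| / (η * Real.exp (l * s))),
      (lt_add_one _).trans_le (le_max_left _ _),
      (by linarith [qw_pos x] : 0 < qw x + 1).trans_le (le_max_left _ _), ?_⟩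
    have := le_max_right (qw x + 1) (|C| / (η * Real.exp (l * s)))
    rwa [div_le_iff₀' (by positivity), mul_assoc] at this
  rw [← hηε]
  refine abs_le_of_cylinder hlam (isOpen_qw_lt R) (isCompact_closure_qw_lt R)
    (fun t ht x _ => hs t ht x) (fun t ht x _ => hp t ht x)
    (hu.mono (prod_mono le_rfl (subset_univ _)))
    ((hbr.mono (prod_mono le_rfl (subset_univ _))).add ((he _).smul η))
    (hc.mono (prod_mono le_rfl (subset_univ _)))
    ((hcb.mono (prod_mono le_rfl (subset_univ _))).add
      (continuousOn_const.mul (continuous_bar l m).continuousOn))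
    (fun τ hτ y _ => ?_) (fun y _ => ?_) (fun τ hτ y hy => ?_) t ht x (subset_closure hxR)
  · rw [Lop_add, Lop_smul]
    have h1 := hsub τ hτ y
    have h2 := hle c τ y (hK τ hτ y)
    have h3 := bar_pos l m τ y
    nlinarith [mul_nonneg hlam (mul_pos hη h3).le, mul_lt_mul_of_pos_left h2 hη]
  · have := h0 y
    have h3 := bar_pos l m s y
    nlinarith [mul_pos hη h3]
  · have hq := frontier_qw_lt hy
    have h1 : bar l m τ y = Real.exp (l * τ) * R * R * qw y ^ m := by
      rw [bar, pow_add, hq]; ring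
    have h2 : Real.exp (l * s) ≤ Real.exp (l * τ) :=
      Real.exp_le_exp.2 (mul_le_mul_of_nonneg_left hτ.1 hl0)
    have hR1 : 1 ≤ R := hq ▸ one_le_qw y
    have hqm : 0 ≤ qw y ^ m := pow_nonneg (qw_pos y).le _
    have h4 : C ≤ η * (Real.exp (l * τ) * R * R) := by
      refine (le_abs_self C).trans (hR.trans ?_)
      refine mul_le_mul_of_nonneg_left ?_ hη.le
      calc Real.exp (l * s) * R ≤ Real.exp (l * τ) * R := by gcongr
        _ ≤ _ := le_mul_of_one_le_right (by positivity) hR1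
    have h5 := mul_le_mul_of_nonneg_right h4 hqm
    have := hg τ hτ y
    have := hb0 τ hτ y
    rw [h1]
    linarith

theorem deriv_eq_zero_of_const_on {f : ℝ → ℝ} (hf : ContDiff ℝ 1 f) {O : Set ℝ} (hO : IsOpen O)
    {k : ℝ} (h : ∀ s ∈ O, f s = k) : ∀ s ∈ closure O, deriv f s = 0 := by
  have hc : Continuous (deriv f) := hf.continuous_deriv le_rfl
  refine fun s hs => closure_minimal (s := O) (t := {s | deriv f s = 0}) (fun s hs => ?_)
    (isClosed_eq hc continuous_const) hs
  have : f =ᶠ[𝓝 s] fun _ => k := Filter.eventuallyEq_of_mem (hO.mem_nhds hs) h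
  simp [this.deriv_eq]

/-- A smooth monotone step with bounded derivatives. -/
theorem exists_step : ∃ (S S1 S2 : ℝ → ℝ) (M : ℝ), 1 ≤ M ∧ (∀ s, HasDerivAt S (S1 s) s) ∧
    (∀ s, HasDerivAt S1 (S2 s) s) ∧ (∀ s ≤ 0, S s = 0 ∧ S1 s = 0 ∧ S2 s = 0) ∧
    (∀ s, 1 ≤ s → S s = 1 ∧ S1 s = 0 ∧ S2 s = 0) ∧ (∀ s, 0 ≤ S s ∧ S s ≤ 1) ∧
    ∀ f ∈ ({S, S1, S2} : Set (ℝ → ℝ)), Continuous f ∧ (∀ s, |f s| ≤ M) ∧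
      ∀ s s', |f s - f s'| ≤ M * |s - s'| := by
  have c0 : ContDiff ℝ 3 Real.smoothTransition := Real.smoothTransition.contDiff
  have c1 : ContDiff ℝ 2 (deriv Real.smoothTransition) := by
    simpa using c0.iterate_deriv' 2 1
  have c2 : ContDiff ℝ 1 (deriv (deriv Real.smoothTransition)) := by
    simpa using c1.iterate_deriv' 1 1
  have c3 : Continuous (deriv (deriv (deriv Real.smoothTransition))) := c2.continuous_deriv le_rfl
  have cl : closure (Set.Iio (0 : ℝ)) = Set.Iic 0 := closure_Iio _
  have cr : closure (Set.Ioi (1 : ℝ)) = Set.Ici 1 := closure_Ioi _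
  have l1 : ∀ s ≤ 0, deriv Real.smoothTransition s = 0 := fun s hs =>
    deriv_eq_zero_of_const_on (c0.of_le (by norm_num)) isOpen_Iio
      (fun s (hs : s < 0) => Real.smoothTransition.zero_of_nonpos hs.le) s (by rwa [cl])
  have r1 : ∀ s, 1 ≤ s → deriv Real.smoothTransition s = 0 := fun s hs =>
    deriv_eq_zero_of_const_on (c0.of_le (by norm_num)) isOpen_Ioi
      (fun s (hs : 1 < s) => Real.smoothTransition.one_of_one_le hs.le) s (by rwa [cr])
  have l2 : ∀ s ≤ 0, deriv (deriv Real.smoothTransition) s = 0 := fun s hs =>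
    deriv_eq_zero_of_const_on (c1.of_le (by norm_num)) isOpen_Iio
      (fun s (hs : s < 0) => l1 s hs.le) s (by rwa [cl])
  have r2 : ∀ s, 1 ≤ s → deriv (deriv Real.smoothTransition) s = 0 := fun s hs =>
    deriv_eq_zero_of_const_on (c1.of_le (by norm_num)) isOpen_Ioi
      (fun s (hs : 1 < s) => r1 s hs.le) s (by rwa [cr])
  have l3 : ∀ s ≤ 0, deriv (deriv (deriv Real.smoothTransition)) s = 0 := fun s hs =>
    deriv_eq_zero_of_const_on c2 isOpen_Iio (fun s (hs : s < 0) => l2 s hs.le) s (by rwa [cl])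
  have r3 : ∀ s, 1 ≤ s → deriv (deriv (deriv Real.smoothTransition)) s = 0 := fun s hs =>
    deriv_eq_zero_of_const_on c2 isOpen_Ioi (fun s (hs : 1 < s) => r2 s hs.le) s (by rwa [cr])
  have bd {f : ℝ → ℝ} (hf : Continuous f) (hl : ∀ s ≤ 0, f s = 0) (hr : ∀ s, 1 ≤ s → f s = 0) :
      ∃ M, ∀ s, |f s| ≤ M := by
    refine hf.bounded_above_of_compact_support (HasCompactSupport.intro (isCompact_Icc (a := (0:ℝ))
      (b := 1)) fun s hs => ?_)
    rw [Set.mem_Icc, not_and_or, not_le, not_le] at hs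
    exact hs.elim (fun h => hl s h.le) fun h => hr s h.le
  obtain ⟨M1, h1⟩ := bd c1.continuous l1 r1
  obtain ⟨M2, h2⟩ := bd c2.continuous l2 r2
  obtain ⟨M3, h3⟩ := bd c3 l3 r3
  have lip {f : ℝ → ℝ} (hf : ContDiff ℝ 1 f) {M : ℝ} (hM : ∀ s, |deriv f s| ≤ M) (s s' : ℝ) :
      |f s - f s'| ≤ M * |s - s'| :=
    convex_univ.norm_image_sub_le_of_norm_deriv_le
      (fun s _ => (hf.differentiable (by norm_num)).differentiableAt) (fun s _ => hM s)
      (mem_univ s') (mem_univ s)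
  have p1 : 0 ≤ M1 := (abs_nonneg _).trans (h1 0)
  have p2 : 0 ≤ M2 := (abs_nonneg _).trans (h2 0)
  have p3 : 0 ≤ M3 := (abs_nonneg _).trans (h3 0)
  refine ⟨Real.smoothTransition, deriv Real.smoothTransition,
    deriv (deriv Real.smoothTransition), 1 + M1 + M2 + M3, by linarith,
    fun s => (c0.differentiable (by norm_num)).differentiableAt.hasDerivAt,
    fun s => (c1.differentiable (by norm_num)).differentiableAt.hasDerivAt,
    fun s hs => ⟨Real.smoothTransition.zero_of_nonpos hs, l1 s hs, l2 s hs⟩,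
    fun s hs => ⟨Real.smoothTransition.one_of_one_le hs, r1 s hs, r2 s hs⟩,
    fun s => ⟨Real.smoothTransition.nonneg s, Real.smoothTransition.le_one s⟩, ?_⟩
  rintro f (rfl | rfl | rfl)
  · refine ⟨c0.continuous, fun s => ?_, fun s s' => (lip (c0.of_le (by norm_num)) h1 s s').trans ?_⟩
    · rw [abs_of_nonneg (Real.smoothTransition.nonneg s)]
      linarith [Real.smoothTransition.le_one s]
    · gcongr; linarith
  · refine ⟨c1.continuous, fun s => (h1 s).trans (by linarith),
      fun s s' => (lip (c1.of_le (by norm_num)) h2 s s').trans ?_⟩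
    gcongr; linarith
  · refine ⟨c2.continuous, fun s => (h2 s).trans (by linarith),
      fun s s' => (lip c2 h3 s s').trans ?_⟩
    gcongr; linarith

/-- Cutoffs at the levels of a function `b`, with derivative bounds polynomial in the level. -/
theorem exists_cutoffs {b bt : ℝ → Sp d → ℝ} {b1 : Fin d → ℝ → Sp d → ℝ}
    {b2 : Fin d → Fin d → ℝ → Sp d → ℝ} (h : Cut β b bt b1 b2) :
    ∃ Q : ℝ, 1 ≤ Q ∧ ∀ A : ℝ, 1 ≤ A → ∃ (ζ ζt : ℝ → Sp d → ℝ) (ζ1 : Fin d → ℝ → Sp d → ℝ)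
      (ζ2 : Fin d → Fin d → ℝ → Sp d → ℝ), Jet univ ζ ζt ζ1 ζ2 ∧
      MultWith β (Q * A ^ 3) ζ ∧ MultWith β (Q * A ^ 3) ζt ∧
      (∀ i, MultWith β (Q * A ^ 3) (ζ1 i)) ∧ (∀ i j, MultWith β (Q * A ^ 3) (ζ2 i j)) ∧
      (∀ t x, 0 ≤ ζ t x ∧ ζ t x ≤ 1) ∧
      (∀ t x, A * b t x ≤ 1 → ζ t x = 0 ∧ ζt t x = 0 ∧ (∀ i, ζ1 i t x = 0) ∧
        ∀ i j, ζ2 i j t x = 0) ∧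
      ∀ t x, 2 ≤ A * b t x → ζ t x = 1 ∧ ζt t x = 0 ∧ (∀ i, ζ1 i t x = 0) ∧
        ∀ i j, ζ2 i j t x = 0 := by
  obtain ⟨S, S1, S2, M, hM, hS, hS1, hl, hr, h01, hf⟩ := exists_step
  obtain ⟨B0, m0⟩ := h.m
  obtain ⟨Bt, mt⟩ := h.mt
  choose B1 m1 using h.m1
  choose B2 m2 using h.m2
  have s1 : 0 ≤ ∑ i, B1 i := Finset.sum_nonneg fun i _ => (m1 i).nonneg
  have s2 : 0 ≤ ∑ i, ∑ j, B2 i j := Finset.sum_nonneg fun i _ => Finset.sum_nonneg fun j _ =>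
    (m2 i j).nonneg
  obtain ⟨B, hB, e0, et, e1, e2⟩ : ∃ B, 1 ≤ B ∧ MultWith β B b ∧ MultWith β B bt ∧
      (∀ i, MultWith β B (b1 i)) ∧ ∀ i j, MultWith β B (b2 i j) := by
    have := m0.nonneg
    have := mt.nonneg
    refine ⟨1 + B0 + Bt + ∑ i, B1 i + ∑ i, ∑ j, B2 i j, by linarith, m0.mono (by linarith),
      mt.mono (by linarith), fun i => (m1 i).mono ?_, fun i j => (m2 i j).mono ?_⟩
    · have := Finset.single_le_sum (f := B1) (fun i _ => (m1 i).nonneg) (Finset.mem_univ i)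
      linarith
    · have h1 := Finset.single_le_sum (f := B2 i) (fun j _ => (m2 i j).nonneg) (Finset.mem_univ j)
      have h2 := Finset.single_le_sum (f := fun i => ∑ j, B2 i j)
        (fun i _ => Finset.sum_nonneg fun j _ => (m2 i j).nonneg) (Finset.mem_univ i)
      linarith
  have comp {f} (hmem : f ∈ ({S, S1, S2} : Set (ℝ → ℝ))) (A : ℝ) (hA : 1 ≤ A) :
      MultWith β (M * A * B) fun t x => f (A * b t x - 1) := by
    obtain ⟨fc, fb, fl⟩ := hf f hmem
    have hA0 : 0 ≤ A := by linarith
    refine ⟨fc.comp ((continuous_const.mul e0.cont).sub continuous_const), fun t x => ?_,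
      fun t x y => ?_⟩
    · refine (fb _).trans ?_
      rw [mul_assoc]
      exact le_mul_of_one_le_right (by linarith) (by nlinarith)
    · refine (fl _ _).trans ?_
      rw [show A * b t x - 1 - (A * b t y - 1) = A * (b t x - b t y) by ring, abs_mul,
        abs_of_nonneg hA0, mul_assoc, mul_assoc]
      have := e0.holder t x y
      gcongr
  have hP : 1 ≤ M * B ^ 3 := one_le_mul_of_one_le_of_one_le hM (one_le_pow₀ hB)
  refine ⟨32 * (M * B ^ 3), by linarith, fun A hA => ?_⟩
  have hA0 : 0 ≤ A := by linarith
  have hA2 : A ≤ A ^ 2 := by nlinarith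
  have hA3 : A ^ 2 ≤ A ^ 3 := by nlinarith [mul_nonneg hA0 hA0]
  have hB2 : B ≤ B ^ 2 := by nlinarith
  have hB3 : B ^ 2 ≤ B ^ 3 := by nlinarith [sq_nonneg B]
  have hB0 : 0 ≤ B := by linarith
  have hM0 : 0 ≤ M := by linarith
  have cA : MultWith β A (fun (_ : ℝ) (_ : Sp d) => A) := by
    simpa [abs_of_nonneg hA0] using multWith_const (d := d) (β := β) A
  refine ⟨fun t x => S (A * b t x - 1), fun t x => S1 (A * b t x - 1) * (A * bt t x),
    fun i t x => S1 (A * b t x - 1) * (A * b1 i t x),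
    fun i j t x => S2 (A * b t x - 1) * (A * b1 i t x) * (A * b1 j t x) +
      S1 (A * b t x - 1) * (A * b2 i j t x),
    ⟨fun t x _ => ?_, fun t x _ => ?_, fun j t x _ => ?_⟩, ?_, ?_, fun i => ?_, fun i j => ?_,
    fun t x => h01 _, fun t x hx => ?_, fun t x hx => ?_⟩
  · exact (hS _).comp t (((h.dt t x).const_mul A).sub_const 1)
  · have := (hS (A * b t x - 1)).comp_hasFDerivAt x (((h.dx t x).const_mul A).sub_const 1)
    rw [← lin_smul, ← lin_smul] at this
    exact this
  · have h1 := (hS1 (A * b t x - 1)).comp_hasFDerivAt x (((h.dx t x).const_mul A).sub_const 1)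
    rw [← lin_smul, ← lin_smul] at h1
    have h2 := (h.dxx j t x).const_mul A
    rw [← lin_smul] at h2
    exact hasFDerivAt_mul_lin h1 h2
  · refine (comp (by simp) A hA).mono ?_
    calc M * A * B ≤ M * A ^ 3 * B ^ 3 := by gcongr <;> linarith
      _ ≤ _ := by nlinarith [mul_nonneg (mul_nonneg hM0 (pow_nonneg hA0 3)) (pow_nonneg hB0 3)]
  · refine ((comp (f := S1) (by simp) A hA).mul (cA.mul et)).mono ?_
    calc 2 * (M * A * B * (2 * (A * B))) = 4 * (M * A ^ 2 * B ^ 2) := by ring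
      _ ≤ 4 * (M * A ^ 3 * B ^ 3) := by gcongr
      _ ≤ _ := by nlinarith [mul_nonneg (mul_nonneg hM0 (pow_nonneg hA0 3)) (pow_nonneg hB0 3)]
  · refine ((comp (f := S1) (by simp) A hA).mul (cA.mul (e1 i))).mono ?_
    calc 2 * (M * A * B * (2 * (A * B))) = 4 * (M * A ^ 2 * B ^ 2) := by ring
      _ ≤ 4 * (M * A ^ 3 * B ^ 3) := by gcongr
      _ ≤ _ := by nlinarith [mul_nonneg (mul_nonneg hM0 (pow_nonneg hA0 3)) (pow_nonneg hB0 3)]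
  · refine ((((comp (f := S2) (by simp) A hA).mul (cA.mul (e1 i))).mul (cA.mul (e1 j))).add
      ((comp (f := S1) (by simp) A hA).mul (cA.mul (e2 i j)))).mono ?_
    calc 2 * (2 * (M * A * B * (2 * (A * B))) * (2 * (A * B))) + 2 * (M * A * B * (2 * (A * B)))
        = 16 * (M * A ^ 3 * B ^ 3) + 4 * (M * A ^ 2 * B ^ 2) := by ring
      _ ≤ 16 * (M * A ^ 3 * B ^ 3) + 4 * (M * A ^ 3 * B ^ 3) := by gcongr
      _ ≤ _ := by nlinarith [mul_nonneg (mul_nonneg hM0 (pow_nonneg hA0 3)) (pow_nonneg hB0 3)]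
  · obtain ⟨z0, z1, z2⟩ := hl (A * b t x - 1) (by linarith)
    simp [z0, z1, z2]
  · obtain ⟨z0, z1, z2⟩ := hr (A * b t x - 1) (by linarith)
    simp [z0, z1, z2]

/-- The commutator of `∂ₜ - ½ Σ cᵢⱼ ∂ᵢⱼ` with the multiplication by a cutoff with derivatives
`ζt, ζ1, ζ2`, applied to a function `g` with gradient `g1`. -/
def Comm (c : ℝ → Sp d → Fin d → Fin d → ℝ) (ζt : ℝ → Sp d → ℝ) (ζ1 : Fin d → ℝ → Sp d → ℝ)
    (ζ2 : Fin d → Fin d → ℝ → Sp d → ℝ) (g : ℝ → Sp d → ℝ) (g1 : Fin d → ℝ → Sp d → ℝ) (t : ℝ)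
    (x : Sp d) : ℝ :=
  ζt t x * g t x - 1 / 2 * ∑ i, ∑ j, c t x i j *
    (ζ2 i j t x * g t x + ζ1 j t x * g1 i t x + ζ1 i t x * g1 j t x)

theorem exists_commutator (hβ : 0 < β) {c : ℝ → Sp d → Fin d → Fin d → ℝ}
    (hm : ∀ i j, Mult β fun t x => c t x i j) :
    ∃ Θ : ℝ, 1 ≤ Θ ∧ ∀ q ζt ζ1 ζ2, MultWith β q ζt → (∀ i, MultWith β q (ζ1 i)) →
      (∀ i j, MultWith β q (ζ2 i j)) → ∀ (g : HY d β) (g1 : Fin d → HY d β), ∃ r : HY d β,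
        (∀ t x, ev r t x = Comm c ζt ζ1 ζ2 (ev g) (fun i => ev (g1 i)) t x) ∧
        ‖r‖ ≤ Θ * q * (‖g‖ + ∑ i, ‖g1 i‖) := by
  choose M hM using hm
  choose m hm hmn using fun i j => (hM i j).exists_op hβ
  have hM0 (i j) : 0 ≤ M i j := (hM i j).nonneg
  have hs : 0 ≤ ∑ i, ∑ j, M i j := Finset.sum_nonneg fun i _ => Finset.sum_nonneg fun j _ => hM0 i j
  refine ⟨2 + 6 * ∑ i, ∑ j, M i j, by linarith, fun q ζt ζ1 ζ2 ht h1 h2 g g1 => ?_⟩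
  have hq := ht.nonneg
  obtain ⟨T, hT, hTn⟩ := ht.exists_op hβ
  choose T1 hT1 hT1n using fun i => (h1 i).exists_op hβ
  choose T2 hT2 hT2n using fun i j => (h2 i j).exists_op hβ
  refine ⟨T g - (1 / 2 : ℝ) • ∑ i, ∑ j, m i j (T2 i j g + T1 j (g1 i) + T1 i (g1 j)),
    fun t x => by
      simp only [ev_sub, ev_smul, ev_sum, ev_add, Comm, hT, hm, hT1, hT2], ?_⟩
  obtain ⟨S, hS⟩ : ∃ S, S = ‖g‖ + ∑ i, ‖g1 i‖ := ⟨_, rfl⟩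
  have hg : ‖g‖ ≤ S := by
    rw [hS]; exact le_add_of_nonneg_right (Finset.sum_nonneg fun i _ => norm_nonneg _)
  have hg1 (i) : ‖g1 i‖ ≤ S := by
    rw [hS]
    exact (Finset.single_le_sum (f := fun i => ‖g1 i‖) (fun i _ => norm_nonneg _)
      (Finset.mem_univ i)).trans (le_add_of_nonneg_left (norm_nonneg _))
  rw [← hS]
  have hS0 : 0 ≤ S := (norm_nonneg g).trans hg
  have le {T : HY d β →L[ℝ] HY d β} {q : ℝ} {g : HY d β} (hTn : ‖T‖ ≤ 2 * q) (hg : ‖g‖ ≤ S) :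
      ‖T g‖ ≤ 2 * q * S :=
    (T.le_opNorm g).trans (mul_le_mul hTn hg (norm_nonneg _) ((norm_nonneg _).trans hTn))
  have key (i j) : ‖m i j (T2 i j g + T1 j (g1 i) + T1 i (g1 j))‖ ≤ M i j * (12 * q * S) := by
    refine ((m i j).le_opNorm _).trans ?_
    have : ‖T2 i j g + T1 j (g1 i) + T1 i (g1 j)‖ ≤ 6 * q * S := by
      refine (norm_add₃_le).trans ?_
      linarith [le (hT2n i j) hg, le (hT1n j) (hg1 i), le (hT1n i) (hg1 j)]
    refine (mul_le_mul (hmn i j) this (norm_nonneg _) (by linarith [hM0 i j])).trans_eq (by ring)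
  have hsum : ‖∑ i, ∑ j, m i j (T2 i j g + T1 j (g1 i) + T1 i (g1 j))‖ ≤
      (∑ i, ∑ j, M i j) * (12 * q * S) := by
    simp only [Finset.sum_mul]
    exact norm_sum_le_of_le _ fun i _ => norm_sum_le_of_le _ fun j _ => key i j
  refine (norm_sub_le _ _).trans ?_
  rw [norm_smul]
  have e : ‖(1 / 2 : ℝ)‖ = 1 / 2 := by norm_num
  rw [e]
  linarith [le hTn hg]

/-- Uniqueness for the whole-space problem with bounded coefficients. -/
theorem eq_of_solution {c : ℝ → Sp d → Fin d → Fin d → ℝ} (hm : ∀ i j, Mult β fun t x => c t x i j)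
    (hs : ∀ t x i j, c t x i j = c t x j i)
    (hp : ∀ t x, ∀ y : Sp d, 0 ≤ ∑ i, ∑ j, c t x i j * y i * y j) {lam : ℝ} (hlam : 0 ≤ lam)
    {w v : HY d β} {wt vt : ℝ → Sp d → ℝ} {w1 v1 : Fin d → ℝ → Sp d → ℝ}
    {w2 v2 : Fin d → Fin d → ℝ → Sp d → ℝ}
    (hw : Jet univ (ev w) wt w1 w2) (hv : Jet univ (ev v) vt v1 v2)
    (he : ∀ t x, wt t x + lam * ev w t x - Lop c w2 t x = vt t x + lam * ev v t x - Lop c v2 t x) :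
    w = v ∧ ∀ i t x, w1 i t x = v1 i t x := by
  choose M hM using hm
  have hM0 (i j) : 0 ≤ M i j := (hM i j).nonneg
  have hK (t x i j) : |c t x i j| ≤ (∑ i, ∑ j, M i j) * qw x := by
    have h1 := Finset.single_le_sum (f := M i) (fun j _ => hM0 i j) (Finset.mem_univ j)
    have h2 := Finset.single_le_sum (f := fun i => ∑ j, M i j)
        (fun i _ => Finset.sum_nonneg fun j _ => hM0 i j) (Finset.mem_univ i)
    have h3 : |c t x i j| ≤ ∑ i, ∑ j, M i j := ((hM i j).bound t x).trans (h1.trans h2)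
    exact h3.trans (le_mul_of_one_le_right ((abs_nonneg _).trans h3) (one_le_qw x))
  have hz : w = v := by
    ext t x
    rcases le_total t 0 with ht | ht
    · rw [ev_nonpos _ ht, ev_nonpos _ ht]
    have hzero : Jet (d := d) (Set.Ioo 0 t ×ˢ univ) (fun _ _ => 0) (fun _ _ => 0)
        (fun _ _ _ => 0) (fun _ _ _ _ => 0) := by
      simpa using ((hw.smul 0).mono (O' := Set.Ioo 0 t ×ˢ univ) (subset_univ _))
    have := abs_le_of_growth (c := c) (s := 0) (T := t) (m := 0) (C := ‖w - v‖) hlam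
      (fun t _ => hs t) (fun t _ => hp t)
      (fun t _ => hK t) ((hw.sub hv).mono (subset_univ _)) hzero
      ((continuous_ev w).sub (continuous_ev v)).continuousOn continuousOn_const
      (fun _ _ _ => le_rfl) (fun t _ x => by simpa using abs_ev_le (w - v) t x)
      (fun t _ x => by
        have h0 : Lop c (fun _ _ _ _ => 0) t x = 0 := by simp [Lop]
        rw [Lop_sub, h0]
        have : wt t x - vt t x + lam * (ev w t x - ev v t x) - (Lop c w2 t x - Lop c v2 t x) = 0 := by
          linear_combination he t x
        rw [this]; simp)
      (fun x => by simp [ev_nonpos]) t ⟨ht, le_rfl⟩ x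
    exact sub_eq_zero.1 (abs_nonpos_iff.1 this)
  refine ⟨hz, fun i t x => ?_⟩
  subst hz
  simpa using congrArg (fun L => L (Pi.single i 1))
    ((hw.dx t x (mem_univ _)).unique (hv.dx t x (mem_univ _)))

/-- Interpolation between the sup norm and the gradient. -/
theorem norm_le_interpolation (h0 : 0 < β) (h1 : β ≤ 1 / 2) {w : HY d β} {w1 : Fin d → HY d β}
    (hw : ∀ t x, HasFDerivAt (ev w t) (lin fun i => ev (w1 i) t x) x) {M ε : ℝ}
    (hM : ∀ t x, |ev w t x| ≤ M) (hε : 0 < ε) (hε1 : ε ≤ 1) :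
    ‖w‖ ≤ ε * ∑ i, ‖w1 i‖ + 3 * ε⁻¹ * M := by
  have hM0 : 0 ≤ M := (abs_nonneg _).trans (hM 0 0)
  obtain ⟨S, hS⟩ : ∃ S, S = ∑ i, ‖w1 i‖ := ⟨_, rfl⟩
  have hS0 : 0 ≤ S := by rw [hS]; exact Finset.sum_nonneg fun i _ => norm_nonneg _
  rw [← hS]
  have hi : 1 ≤ ε⁻¹ := (one_le_inv₀ hε).2 hε1
  have hεS : 0 ≤ ε * S := by positivity
  have hlip (t x y) : |ev w t x - ev w t y| ≤ S * ‖x - y‖ := by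
    refine convex_univ.norm_image_sub_le_of_norm_hasFDerivWithin_le
      (fun z _ => (hw t z).hasFDerivWithinAt) (fun z _ => ?_) (mem_univ y) (mem_univ x)
    refine (norm_lin_le _).trans ?_
    rw [hS]
    exact Finset.sum_le_sum fun i _ => abs_ev_le _ _ _
  obtain ⟨ρ, hρ, hρ1, e1, e2⟩ : ∃ ρ : ℝ, 0 < ρ ∧ ρ ≤ 1 ∧ ρ ^ (1 - β) = ε ∧ ρ ^ (-β) ≤ ε⁻¹ := by
    have hb : 0 < 1 - β := by linarith
    refine ⟨ε ^ (1 - β)⁻¹, Real.rpow_pos_of_pos hε _, Real.rpow_le_one hε.le hε1 (by positivity),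
      ?_, ?_⟩
    · rw [← Real.rpow_mul hε.le, inv_mul_cancel₀ hb.ne', Real.rpow_one]
    · rw [← Real.rpow_mul hε.le, ← Real.rpow_neg_one ε]
      refine Real.rpow_le_rpow_of_exponent_ge hε hε1 ?_
      rw [inv_mul_eq_div, le_div_iff₀ hb]
      linarith
  have hold (t x y) : |ev w t x - ev w t y| ≤ (ε * S + 3 * ε⁻¹ * M) * ‖x - y‖ ^ β := by
    rcases le_total ‖x - y‖ ρ with h | h
    · rcases (norm_nonneg (x - y)).eq_or_lt with hz | hz
      · have : x = y := sub_eq_zero.1 (norm_eq_zero.1 hz.symm)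
        rw [this, sub_self, abs_zero]; positivity
      · refine (hlip t x y).trans ?_
        have : ‖x - y‖ = ‖x - y‖ ^ (1 - β) * ‖x - y‖ ^ β := by
          rw [← Real.rpow_add hz]; simp
        have h2 : ‖x - y‖ ^ (1 - β) ≤ ε := by
          rw [← e1]
          exact Real.rpow_le_rpow hz.le h (by linarith)
        have hp : 0 ≤ ‖x - y‖ ^ β := by positivity
        calc S * ‖x - y‖ = S * ‖x - y‖ ^ (1 - β) * ‖x - y‖ ^ β := by rw [mul_assoc, ← this]
          _ ≤ S * ε * ‖x - y‖ ^ β := by gcongr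
          _ ≤ _ := by gcongr; nlinarith [mul_nonneg (inv_nonneg.2 hε.le) hM0]
    · have h3 : |ev w t x - ev w t y| ≤ 2 * M :=
        (abs_sub _ _).trans (by linarith [hM t x, hM t y])
      have h4 : 1 ≤ ε⁻¹ * ‖x - y‖ ^ β := by
        have h5 : ρ ^ β ≤ ‖x - y‖ ^ β := Real.rpow_le_rpow hρ.le h h0.le
        calc (1 : ℝ) = ρ ^ (-β) * ρ ^ β := by rw [← Real.rpow_add hρ]; simp
          _ ≤ ε⁻¹ * ‖x - y‖ ^ β := by gcongr
      have hp : 0 ≤ ‖x - y‖ ^ β := by positivity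
      calc |ev w t x - ev w t y| ≤ 2 * M * 1 := by linarith
        _ ≤ 2 * M * (ε⁻¹ * ‖x - y‖ ^ β) := by gcongr
        _ ≤ _ := by nlinarith [mul_nonneg hεS hp, mul_nonneg (mul_nonneg (inv_nonneg.2 hε.le) hM0) hp]
  obtain ⟨g, hg, hgn⟩ := exists_mk (continuous_ev w) (M := ε * S + 3 * ε⁻¹ * M) (by positivity)
    (fun t x => (hM t x).trans (by nlinarith)) hold (fun t ht x => ev_nonpos w ht x)
  rwa [ext_ev hg] at hgn

theorem le_of_recursion {n : ℕ → ℝ} {H C : ℝ} (h1 : ∀ k, n k ≤ n (k + 1) / 128 + H * 64 ^ k)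
    (h2 : ∀ k, n k ≤ C * 64 ^ k) (k : ℕ) : n k ≤ 2 * H * 64 ^ k := by
  have key (l : ℕ) : ∀ k, n k - 2 * H * 64 ^ k ≤ (C - 2 * H) * 64 ^ k * (1 / 2) ^ l := by
    induction l with
    | zero => intro k; linarith [h2 k, h1 k]
    | succ l ih =>
      intro k
      have h3 := ih (k + 1)
      have h4 := h1 k
      rw [pow_succ] at h3 ⊢
      linear_combination h4 + 1 / 128 * h3
  have : Tendsto (fun l : ℕ => (C - 2 * H) * 64 ^ k * (1 / 2 : ℝ) ^ l) atTop (𝓝 0) := by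
    simpa using (tendsto_pow_atTop_nhds_zero_of_lt_one (by norm_num : (0:ℝ) ≤ 1 / 2)
      (by norm_num)).const_mul ((C - 2 * H) * 64 ^ k)
  linarith [ge_of_tendsto' this fun l => key l k]

theorem Comm_sub (c : ℝ → Sp d → Fin d → Fin d → ℝ) (ζt : ℝ → Sp d → ℝ) (ζ1 : Fin d → ℝ → Sp d → ℝ)
    (ζ2 : Fin d → Fin d → ℝ → Sp d → ℝ) (g h : ℝ → Sp d → ℝ) (g1 h1 : Fin d → ℝ → Sp d → ℝ) (t : ℝ)
    (x : Sp d) : Comm c ζt ζ1 ζ2 (fun t x => g t x - h t x) (fun i t x => g1 i t x - h1 i t x) t x =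
      Comm c ζt ζ1 ζ2 g g1 t x - Comm c ζt ζ1 ζ2 h h1 t x := by
  simp only [Comm]
  rw [sub_sub_sub_comm, ← mul_sub, ← mul_sub, ← Finset.sum_sub_distrib]
  congr 2
  refine Finset.sum_congr rfl fun i _ => ?_
  rw [← Finset.sum_sub_distrib]
  exact Finset.sum_congr rfl fun j _ => by ring

theorem Comm_eq_zero {c : ℝ → Sp d → Fin d → Fin d → ℝ} {ζt : ℝ → Sp d → ℝ}
    {ζ1 : Fin d → ℝ → Sp d → ℝ} {ζ2 : Fin d → Fin d → ℝ → Sp d → ℝ} {t : ℝ} {x : Sp d}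
    (h : ζt t x = 0 ∧ (∀ i, ζ1 i t x = 0) ∧ ∀ i j, ζ2 i j t x = 0) (g : ℝ → Sp d → ℝ)
    (g1 : Fin d → ℝ → Sp d → ℝ) : Comm c ζt ζ1 ζ2 g g1 t x = 0 := by
  simp [Comm, h.1, h.2.1, h.2.2]

theorem Comm_congr (c : ℝ → Sp d → Fin d → Fin d → ℝ) (ζt : ℝ → Sp d → ℝ)
    (ζ1 : Fin d → ℝ → Sp d → ℝ) (ζ2 : Fin d → Fin d → ℝ → Sp d → ℝ) {g h : ℝ → Sp d → ℝ}
    {g1 h1 : Fin d → ℝ → Sp d → ℝ} {t : ℝ} {x : Sp d} (e : g t x = h t x)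
    (e1 : ∀ i, g1 i t x = h1 i t x) : Comm c ζt ζ1 ζ2 g g1 t x = Comm c ζt ζ1 ζ2 h h1 t x := by
  simp only [Comm, e, e1]

theorem cutoff_equation (c : ℝ → Sp d → Fin d → Fin d → ℝ) (ζ ζt : ℝ → Sp d → ℝ)
    (ζ1 : Fin d → ℝ → Sp d → ℝ) (ζ2 : Fin d → Fin d → ℝ → Sp d → ℝ) (u ut : ℝ → Sp d → ℝ)
    (u1 : Fin d → ℝ → Sp d → ℝ) (u2 : Fin d → Fin d → ℝ → Sp d → ℝ) (t : ℝ) (x : Sp d) :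
    ζt t x * u t x + ζ t x * ut t x - Lop c (fun i j t x =>
      (ζ2 i j t x * u t x + ζ1 j t x * u1 i t x) + (ζ1 i t x * u1 j t x + ζ t x * u2 i j t x)) t x =
    Comm c ζt ζ1 ζ2 u u1 t x + ζ t x * (ut t x - Lop c u2 t x) := by
  have : ∑ i, ∑ j, c t x i j * ((ζ2 i j t x * u t x + ζ1 j t x * u1 i t x) +
      (ζ1 i t x * u1 j t x + ζ t x * u2 i j t x)) =
      ∑ i, ∑ j, c t x i j * (ζ2 i j t x * u t x + ζ1 j t x * u1 i t x + ζ1 i t x * u1 j t x) +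
      ζ t x * ∑ i, ∑ j, c t x i j * u2 i j t x := by
    simp only [Finset.mul_sum]
    rw [← Finset.sum_add_distrib]
    refine Finset.sum_congr rfl fun i _ => ?_
    rw [← Finset.sum_add_distrib]
    exact Finset.sum_congr rfl fun j _ => by ring
  simp only [Lop, Comm, this]
  ring

/-- A function with the equation `wₜ - Lw = r` is given by the solution operators. -/
theorem eq_potential {c : ℝ → Sp d → Fin d → Fin d → ℝ} (hm : ∀ i j, Mult β fun t x => c t x i j)
    (hs : ∀ t x i j, c t x i j = c t x j i)
    (hp : ∀ t x, ∀ y : Sp d, 0 ≤ ∑ i, ∑ j, c t x i j * y i * y j) {lam : ℝ} (hlam : 0 ≤ lam)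
    {V0 Vt : HY d β →L[ℝ] HY d β} {V1 : Fin d → HY d β →L[ℝ] HY d β}
    {V2 : Fin d → Fin d → HY d β →L[ℝ] HY d β}
    (hr : ∀ g, HYRep (V0 g) (Vt g) (fun i => V1 i g) fun i j => V2 i j g)
    (he : ∀ g t x, ev (Vt g) t x + lam * ev (V0 g) t x -
      1 / 2 * ∑ i, ∑ j, c t x i j * ev (V2 i j g) t x = ev g t x)
    {w r : HY d β} {w1 : Fin d → HY d β} {wt : ℝ → Sp d → ℝ} {w2 : Fin d → Fin d → ℝ → Sp d → ℝ}
    (hw : Jet univ (ev w) wt (fun i => ev (w1 i)) w2)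
    (hwe : ∀ t x, wt t x - Lop c w2 t x = ev r t x) :
    w = V0 (lam • w + r) ∧ ∀ i, w1 i = V1 i (lam • w + r) := by
  have := eq_of_solution hm hs hp hlam hw ((hr (lam • w + r)).rep univ) fun t x => by
    have h1 := he (lam • w + r) t x
    rw [ev_add, ev_smul] at h1
    simp only [Lop] at hwe ⊢
    linear_combination hwe t x - h1
  exact ⟨this.1, fun i => ext_ev (this.2 i)⟩

theorem norm_le_step (h0 : 0 < β) (h1 : β ≤ 1 / 2) {c : ℝ → Sp d → Fin d → Fin d → ℝ}
    (hm : ∀ i j, Mult β fun t x => c t x i j)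
    (hs : ∀ t x i j, c t x i j = c t x j i)
    (hp : ∀ t x, ∀ y : Sp d, 0 ≤ ∑ i, ∑ j, c t x i j * y i * y j) {C : ℝ} (hC : 0 < C)
    (hV : ∀ lam, 1 ≤ lam → Solv β c C lam) {Θ : ℝ} (hΘ : 1 ≤ Θ) {q n M : ℝ} (hq : 1 ≤ q)
    (hn : 0 ≤ n) {w r : HY d β} {w1 : Fin d → HY d β} {wt : ℝ → Sp d → ℝ}
    {w2 : Fin d → Fin d → ℝ → Sp d → ℝ} (hw : Jet univ (ev w) wt (fun i => ev (w1 i)) w2)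
    (hwe : ∀ t x, wt t x - Lop c w2 t x = ev r t x) (hM : ∀ t x, |ev w t x| ≤ M)
    (hrn : ‖r‖ ≤ Θ * q * n) :
    ‖w‖ + ∑ i, ‖w1 i‖ ≤ n / 128 + 24 * 384 ^ 2 * (d * C + 1) ^ 4 * Θ ^ 2 * (q ^ 2 * M) := by
  obtain ⟨D, hD⟩ : ∃ D, D = d * C + 1 := ⟨_, rfl⟩
  have hd0 : (0 : ℝ) ≤ d * C := by positivity
  have hD1 : 1 ≤ D := by linarith
  obtain ⟨μ, hμ⟩ : ∃ μ, μ = 384 * D * Θ * q := ⟨_, rfl⟩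
  have hM0 : 0 ≤ M := (abs_nonneg _).trans (hM 0 0)
  have hDΘ : 1 ≤ D * Θ * q :=
    one_le_mul_of_one_le_of_one_le (one_le_mul_of_one_le_of_one_le hD1 hΘ) hq
  have hμ1 : 1 ≤ μ := by rw [hμ]; nlinarith
  have hμ0 : 0 < μ := by linarith
  obtain ⟨V0, Vt, V1, V2, hr, he, -, n1, -⟩ := hV (μ ^ 2) (one_le_pow₀ hμ1)
  rw [Real.sqrt_sq hμ0.le] at n1
  obtain ⟨-, e1⟩ := eq_potential hm hs hp (sq_nonneg μ) hr he hw hwe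
  obtain ⟨S, hS⟩ : ∃ S, S = ∑ i, ‖w1 i‖ := ⟨_, rfl⟩
  obtain ⟨m, hmw⟩ : ∃ m, m = ‖w‖ := ⟨_, rfl⟩
  have hm0 : 0 ≤ m := by rw [hmw]; exact norm_nonneg w
  have hε : 0 < (2 * D * μ)⁻¹ := by positivity
  have hε1 : (2 * D * μ)⁻¹ ≤ 1 / 2 := by
    rw [inv_le_comm₀ (by positivity) (by norm_num)]
    nlinarith
  have hInt := norm_le_interpolation h0 h1 (fun t x => hw.dx t x (mem_univ _)) hM hε (by linarith)
  have hS1 : S ≤ D * μ * m + D * Θ * q * n / μ := by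
    have hi (i) : ‖w1 i‖ ≤ C * μ⁻¹ * (μ ^ 2 * m + Θ * q * n) := by
      rw [e1 i]
      refine ((V1 i).le_opNorm _).trans ?_
      refine mul_le_mul (n1 i) ?_ (norm_nonneg _) (by positivity)
      refine (norm_add_le _ _).trans (add_le_add ?_ hrn)
      rw [norm_smul, Real.norm_of_nonneg (sq_nonneg μ), hmw]
    rw [hS]
    refine (Finset.sum_le_sum fun i _ => hi i).trans ?_
    rw [Finset.sum_const, Finset.card_univ, Fintype.card_fin, nsmul_eq_mul]
    have hx : 0 ≤ μ * m + Θ * q * n / μ := by positivity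
    calc (d : ℝ) * (C * μ⁻¹ * (μ ^ 2 * m + Θ * q * n)) = d * C * (μ * m + Θ * q * n / μ) := by
          field_simp
      _ ≤ D * (μ * m + Θ * q * n / μ) := by gcongr; linarith
      _ = _ := by ring
  have hS0 : 0 ≤ S := by rw [hS]; exact Finset.sum_nonneg fun i _ => norm_nonneg _
  rw [← hS, ← hmw] at hInt ⊢
  rw [inv_inv] at hInt
  have h3 : D * Θ * q * n / μ = n / 384 := by
    rw [hμ]; field_simp
  rw [h3] at hS1
  have h4 : D * μ * ((2 * D * μ)⁻¹ * S) = S / 2 := by field_simp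
  have h5 : D * μ * m ≤ S / 2 + 6 * (D * μ) ^ 2 * M := by
    rw [← h4]
    calc D * μ * m ≤ D * μ * ((2 * D * μ)⁻¹ * S + 3 * (2 * D * μ) * M) := by gcongr
      _ = _ := by ring
  have h6 : S ≤ 12 * (D * μ) ^ 2 * M + n / 192 := by linarith
  have hDμ : 1 ≤ D * μ := one_le_mul_of_one_le_of_one_le hD1 hμ1
  have h7 : (2 * D * μ)⁻¹ * S ≤ 1 / 2 * S := by gcongr
  have h8 : D * μ * M ≤ (D * μ) ^ 2 * M := by gcongr; nlinarith
  have h9 : 24 * 384 ^ 2 * (d * C + 1) ^ 4 * Θ ^ 2 * (q ^ 2 * M) = 24 * (D * μ) ^ 2 * M := by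
    rw [hμ, ← hD]; ring
  rw [h9]
  linarith

/-- Interior estimate: a solution near the support of `b` is, where `b ≥ 1`, a potential whose
density is controlled by the supremum of the solution. -/
theorem interior_estimate (h0 : 0 < β) (h1 : β ≤ 1 / 2) {c : ℝ → Sp d → Fin d → Fin d → ℝ}
    (hm : ∀ i j, Mult β fun t x => c t x i j)
    (hs : ∀ t x i j, c t x i j = c t x j i)
    (hp : ∀ t x, ∀ y : Sp d, 0 ≤ ∑ i, ∑ j, c t x i j * y i * y j) {C : ℝ} (hC : 0 < C)
    (hV : ∀ lam, 1 ≤ lam → Solv β c C lam) {b bt : ℝ → Sp d → ℝ} {b1 : Fin d → ℝ → Sp d → ℝ}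
    {b2 : Fin d → Fin d → ℝ → Sp d → ℝ} (hb : Cut β b bt b1 b2) :
    ∃ (V0 Vt : HY d β →L[ℝ] HY d β) (V1 : Fin d → HY d β →L[ℝ] HY d β)
      (V2 : Fin d → Fin d → HY d β →L[ℝ] HY d β) (C0 : ℝ) (ζ ζt : ℝ → Sp d → ℝ)
      (ζ1 : Fin d → ℝ → Sp d → ℝ) (ζ2 : Fin d → Fin d → ℝ → Sp d → ℝ),
      (∀ g, HYRep (V0 g) (Vt g) (fun i => V1 i g) fun i j => V2 i j g) ∧
      (∀ g t x, ev (Vt g) t x + ev (V0 g) t x - Lop c (fun i j => ev (V2 i j g)) t x = ev g t x) ∧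
      (∀ t x, 1 ≤ b t x → ζ t x = 1 ∧ ζt t x = 0 ∧ (∀ i, ζ1 i t x = 0) ∧ ∀ i j, ζ2 i j t x = 0) ∧
      ∀ (U : HY d β) (U1 : Fin d → HY d β) Ut U2, Jet univ (ev U) Ut (fun i => ev (U1 i)) U2 →
        (∀ t x, 0 < b t x → Ut t x = Lop c U2 t x) →
        ∃ G : HY d β, (∀ t x, ev (V0 G) t x = ζ t x * ev U t x) ∧
          (∀ t x, ev G t x = ζ t x * ev U t x +
            Comm c ζt ζ1 ζ2 (ev U) (fun i => ev (U1 i)) t x) ∧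
          ∀ M, 0 ≤ M → (∀ t x, 0 < b t x → |ev U t x| ≤ M) → ‖G‖ ≤ C0 * M := by
  obtain ⟨Q, hQ, hcut⟩ := exists_cutoffs hb
  have hA (k : ℕ) : (1 : ℝ) ≤ 2 ^ (k + 1) := one_le_pow₀ (by norm_num)
  choose ζ ζt ζ1 ζ2 hj mζ mt m1 m2 h01 hlo hhi using fun k : ℕ => hcut _ (hA k)
  obtain ⟨Θ, hΘ, hcomm⟩ := exists_commutator h0 hm
  obtain ⟨q, hqd⟩ : ∃ q : ℕ → ℝ, q = fun k => Q * (2 ^ (k + 1)) ^ 3 := ⟨_, rfl⟩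
  have hqk (k : ℕ) : Q * (2 ^ (k + 1)) ^ 3 = q k := by rw [hqd]
  simp only [hqk] at mζ mt m1 m2
  have hq1 (k) : 1 ≤ q k := by
    rw [← hqk]; exact one_le_mul_of_one_le_of_one_le hQ (one_le_pow₀ (hA k))
  have hq2 (k) : q k ^ 2 = 64 * Q ^ 2 * 64 ^ k := by
    have : (64 : ℝ) ^ k = (2 ^ k) ^ 6 := by rw [← pow_mul, mul_comm, pow_mul]; norm_num
    rw [← hqk, this]; ring
  obtain ⟨H, hH⟩ : ∃ H, H = 24 * 384 ^ 2 * (d * C + 1) ^ 4 * Θ ^ 2 * (64 * Q ^ 2) := ⟨_, rfl⟩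
  obtain ⟨V0, Vt, V1, V2, hr, he, -⟩ := hV 1 le_rfl
  choose T hT hTn using fun k => (mζ k).exists_op h0
  choose T1 hT1 hT1n using fun k i => (m1 k i).exists_op h0
  refine ⟨V0, Vt, V1, V2, 2 * H + Θ * q 0 * (2 * H * 64), ζ 0, ζt 0, ζ1 0, ζ2 0, hr, fun g t x => ?_,
    fun t x hx => hhi 0 t x (by norm_num; linarith), fun U U1 Ut U2 hU hUe => ?_⟩
  · have := he g t x
    simp only [Lop]
    linarith
  obtain ⟨W, hW⟩ : ∃ W : ℕ → HY d β, W = fun k => T k U := ⟨_, rfl⟩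
  obtain ⟨W1, hW1⟩ : ∃ W1 : ℕ → Fin d → HY d β, W1 = fun k i => T1 k i U + T k (U1 i) := ⟨_, rfl⟩
  have eW (k t x) : ev (W k) t x = ζ k t x * ev U t x := by rw [hW]; exact hT k U t x
  have eW1 (k i t x) : ev (W1 k i) t x = ζ1 k i t x * ev U t x + ζ k t x * ev (U1 i) t x := by
    rw [hW1]; simp only [ev_add, hT, hT1]
  have hzero (k t x) : ζ k t x * (Ut t x - Lop c U2 t x) = 0 := by
    rcases le_or_gt (b t x) 0 with hb | hb
    · rw [(hlo k t x ((mul_nonpos_of_nonneg_of_nonpos (by linarith [hA k]) hb).trans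
        zero_le_one)).1, zero_mul]
    · rw [hUe t x hb, sub_self, mul_zero]
  have hcongr (k t x) : Comm c (ζt k) (ζ1 k) (ζ2 k) (ev (W (k + 1))) (fun i => ev (W1 (k + 1) i)) t x =
      Comm c (ζt k) (ζ1 k) (ζ2 k) (ev U) (fun i => ev (U1 i)) t x := by
    rcases le_or_gt ((2 : ℝ) ^ (k + 1) * b t x) 1 with hb | hb
    · rw [Comm_eq_zero (hlo k t x hb).2, Comm_eq_zero (hlo k t x hb).2]
    · obtain ⟨z, -, z1, -⟩ := hhi (k + 1) t x (by rw [pow_succ]; linarith)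
      refine Comm_congr _ _ _ _ (by rw [eW, z, one_mul]) fun i => ?_
      rw [eW1, z, z1, zero_mul, zero_add, one_mul]
  choose r hre hrn using fun k => hcomm (q k) (ζt k) (ζ1 k) (ζ2 k) (mt k) (m1 k) (m2 k) (W (k + 1))
    (W1 (k + 1))
  obtain ⟨n, hn⟩ : ∃ n : ℕ → ℝ, n = fun k => ‖W k‖ + ∑ i, ‖W1 k i‖ := ⟨_, rfl⟩
  have hnk (k) : ‖W k‖ + ∑ i, ‖W1 k i‖ = n k := by rw [hn]
  have hn0 (k) : 0 ≤ n k := by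
    rw [← hnk]; exact add_nonneg (norm_nonneg _) (Finset.sum_nonneg fun i _ => norm_nonneg _)
  simp only [hnk] at hrn
  have hjet (k) := ((hj k).mul hU).congr (v := ev (W k)) isOpen_univ fun t x _ => eW k t x
  have hjet' (k) : Jet univ (ev (W k)) (fun t x => ζt k t x * ev U t x + ζ k t x * Ut t x)
      (fun i => ev (W1 k i)) (fun i j t x => (ζ2 k i j t x * ev U t x + ζ1 k j t x * ev (U1 i) t x) +
        (ζ1 k i t x * ev (U1 j) t x + ζ k t x * U2 i j t x)) := by
    have : (fun i => ev (W1 k i)) = fun i t x => ζ1 k i t x * ev U t x + ζ k t x * ev (U1 i) t x := by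
      funext i t x; exact eW1 k i t x
    rw [this]
    exact hjet k
  have heq (k t x) := (cutoff_equation c (ζ k) (ζt k) (ζ1 k) (ζ2 k) (ev U) Ut
    (fun i => ev (U1 i)) U2 t x).trans (by rw [hzero k t x, add_zero, ← hcongr, ← hre])
  obtain ⟨e0, -⟩ := eq_potential hm hs hp zero_le_one hr he (hjet' 0) (heq 0)
  rw [one_smul] at e0
  refine ⟨W 0 + r 0, fun t x => by rw [← e0, eW], fun t x => by rw [ev_add, eW, hre, hcongr],
    fun M hM hUM => ?_⟩
  have hWM (k t x) : |ev (W k) t x| ≤ M := by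
    rw [eW, abs_mul, abs_of_nonneg (h01 k t x).1]
    rcases le_or_gt (b t x) 0 with hb | hb
    · rw [(hlo k t x ((mul_nonpos_of_nonneg_of_nonpos (by linarith [hA k]) hb).trans
        zero_le_one)).1, zero_mul]
      exact hM
    · exact (mul_le_of_le_one_left (abs_nonneg _) (h01 k t x).2).trans (hUM t x hb)
  have hrec (k) : n k ≤ n (k + 1) / 128 + H * M * 64 ^ k := by
    have := norm_le_step h0 h1 hm hs hp hC hV hΘ (hq1 k) (hn0 (k + 1)) (hjet' k) (heq k) (hWM k)
      (hrn k)
    rw [hnk, hq2] at this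
    refine this.trans_eq ?_
    rw [hH]; ring
  have hcrude (k) : n k ≤ (2 * ‖U‖ + ∑ i, (2 * ‖U‖ + 2 * ‖U1 i‖)) * (64 * Q ^ 2) * 64 ^ k := by
    have hs0 : 0 ≤ 2 * ‖U‖ + ∑ i, (2 * ‖U‖ + 2 * ‖U1 i‖) :=
      add_nonneg (by positivity) (Finset.sum_nonneg fun i _ => by positivity)
    have hqq : q k ≤ q k ^ 2 := by nlinarith [hq1 k]
    rw [mul_assoc, ← hq2, ← hnk, hW, hW1]
    refine le_trans ?_ (mul_le_mul_of_nonneg_left hqq hs0)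
    rw [add_mul, Finset.sum_mul]
    refine add_le_add ?_ (Finset.sum_le_sum fun i _ => ?_)
    · refine ((T k).le_of_opNorm_le (hTn k) U).trans_eq (by ring)
    · refine (norm_add_le _ _).trans ?_
      have := (T1 k i).le_of_opNorm_le (hT1n k i) U
      have := (T k).le_of_opNorm_le (hTn k) (U1 i)
      linarith
  have hfin := le_of_recursion hrec hcrude
  have f0 := hfin 0
  have f1 := hfin 1
  have : ‖W 0‖ ≤ n 0 := by
    rw [← hnk]; exact le_add_of_nonneg_right (Finset.sum_nonneg fun i _ => norm_nonneg _)
  have hq0 := hq1 0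
  have : Θ * q 0 * n 1 ≤ Θ * q 0 * (2 * (H * M) * 64 ^ 1) := by gcongr
  refine (norm_add_le _ _).trans ?_
  have := hrn 0
  rw [zero_add] at this
  simp only [pow_zero, pow_one] at *
  linarith

/-- Classical solutions of `∂ₜu = ½ Σ cᵢⱼ ∂ᵢⱼu` on `O`. -/
structure IsSol (O : Set (ℝ × Sp d)) (c : ℝ → Sp d → Fin d → Fin d → ℝ) (u : ℝ → Sp d → ℝ) :
    Prop where
  jet : Jet O u (fun t x => deriv (fun τ => u τ x) t) (fun i t x => pd1 (u t) i x)
    fun i j t x => pd2 (u t) i j x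
  cont : ContinuousOn (fun X : ℝ × Sp d => u X.1 X.2) O
  contt : ContinuousOn (fun X : ℝ × Sp d => deriv (fun τ => u τ X.2) X.1) O
  cont1 : ∀ i, ContinuousOn (fun X : ℝ × Sp d => pd1 (u X.1) i X.2) O
  cont2 : ∀ i j, ContinuousOn (fun X : ℝ × Sp d => pd2 (u X.1) i j X.2) O
  eq : ∀ t x, (t, x) ∈ O →
    deriv (fun τ => u τ x) t = Lop c (fun i j t x => pd2 (u t) i j x) t x

theorem Jet.congr_all {O : Set (ℝ × Sp d)} {u ut v vt : ℝ → Sp d → ℝ} {u1 v1 : Fin d → ℝ → Sp d → ℝ}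
    {u2 v2 : Fin d → Fin d → ℝ → Sp d → ℝ} (hu : Jet O u ut u1 u2) (hO : IsOpen O)
    (h : ∀ t x, (t, x) ∈ O → v t x = u t x) (ht : ∀ t x, (t, x) ∈ O → vt t x = ut t x)
    (h1 : ∀ i t x, (t, x) ∈ O → v1 i t x = u1 i t x)
    (h2 : ∀ i j t x, (t, x) ∈ O → v2 i j t x = u2 i j t x) : Jet O v vt v1 v2 where
  dt t x hx := by rw [ht t x hx]; exact (hu.congr hO h).dt t x hx
  dx t x hx := by simp only [h1 _ t x hx]; exact (hu.congr hO h).dx t x hx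
  dxx j t x hx := by
    simp only [h2 _ _ t x hx]
    refine (hu.dxx j t x hx).congr_of_eventuallyEq ?_
    have : ContinuousAt (fun y : Sp d => (t, y)) x := by fun_prop
    exact (this.eventually (hO.mem_nhds hx)).mono fun τ hτ => h1 j t τ hτ

theorem Jet.pd1_eq {O : Set (ℝ × Sp d)} {u ut : ℝ → Sp d → ℝ} {u1 : Fin d → ℝ → Sp d → ℝ}
    {u2 : Fin d → Fin d → ℝ → Sp d → ℝ} (hu : Jet O u ut u1 u2) (i : Fin d) {t : ℝ} {x : Sp d}
    (hx : (t, x) ∈ O) : pd1 (u t) i x = u1 i t x := by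
  rw [pd1, (hu.dx t x hx).fderiv, lin_single]

theorem Jet.pd2_eq {O : Set (ℝ × Sp d)} {u ut : ℝ → Sp d → ℝ} {u1 : Fin d → ℝ → Sp d → ℝ}
    {u2 : Fin d → Fin d → ℝ → Sp d → ℝ} (hu : Jet O u ut u1 u2) (hO : IsOpen O) (i j : Fin d) {t : ℝ}
    {x : Sp d} (hx : (t, x) ∈ O) : pd2 (u t) i j x = u2 i j t x := by
  have : ContinuousAt (fun y : Sp d => (t, y)) x := by fun_prop
  have he : (fun y => pd1 (u t) j y) =ᶠ[𝓝 x] u1 j t :=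
    (this.eventually (hO.mem_nhds hx)).mono fun y hy => hu.pd1_eq j hy
  rw [pd2, he.fderiv_eq, (hu.dxx j t x hx).fderiv, lin_single]

theorem Jet.isSol {O : Set (ℝ × Sp d)} {c : ℝ → Sp d → Fin d → Fin d → ℝ} {u ut : ℝ → Sp d → ℝ}
    {u1 : Fin d → ℝ → Sp d → ℝ} {u2 : Fin d → Fin d → ℝ → Sp d → ℝ} (hu : Jet O u ut u1 u2)
    (hO : IsOpen O) (h0 : ContinuousOn (fun X : ℝ × Sp d => u X.1 X.2) O)
    (ht : ContinuousOn (fun X : ℝ × Sp d => ut X.1 X.2) O)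
    (h1 : ∀ i, ContinuousOn (fun X : ℝ × Sp d => u1 i X.1 X.2) O)
    (h2 : ∀ i j, ContinuousOn (fun X : ℝ × Sp d => u2 i j X.1 X.2) O)
    (he : ∀ t x, (t, x) ∈ O → ut t x = Lop c u2 t x) : IsSol O c u where
  jet := hu.congr_all hO (fun _ _ _ => rfl) (fun t x hx => (hu.dt t x hx).deriv)
    (fun i t x hx => hu.pd1_eq i hx) fun i j t x hx => hu.pd2_eq hO i j hx
  cont := h0
  contt := ht.congr fun X hX => (hu.dt X.1 X.2 hX).deriv
  cont1 i := (h1 i).congr fun X hX => hu.pd1_eq i hX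
  cont2 i j := (h2 i j).congr fun X hX => hu.pd2_eq hO i j hX
  eq t x hx := by
    rw [(hu.dt t x hx).deriv, he t x hx]
    simp only [Lop, hu.pd2_eq hO _ _ hx]

namespace IsSol

variable {O O' : Set (ℝ × Sp d)} {c c' : ℝ → Sp d → Fin d → Fin d → ℝ} {u v : ℝ → Sp d → ℝ}

theorem mono (h : IsSol O c u) (hO : O' ⊆ O) : IsSol O' c u :=
  ⟨h.jet.mono hO, h.cont.mono hO, h.contt.mono hO, fun i => (h.cont1 i).mono hO,
    fun i j => (h.cont2 i j).mono hO, fun t x hx => h.eq t x (hO hx)⟩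

theorem congr_coeff (h : IsSol O c u) (hc : ∀ t x, (t, x) ∈ O → c' t x = c t x) : IsSol O c' u :=
  ⟨h.jet, h.cont, h.contt, h.cont1, h.cont2, fun t x hx => by
    rw [h.eq t x hx]; simp only [Lop, hc t x hx]⟩

theorem sub (h : IsSol O c u) (h' : IsSol O c v) (hO : IsOpen O) :
    IsSol O c fun t x => u t x - v t x :=
  (h.jet.sub h'.jet).isSol hO (h.cont.sub h'.cont) (h.contt.sub h'.contt)
    (fun i => (h.cont1 i).sub (h'.cont1 i)) (fun i j => (h.cont2 i j).sub (h'.cont2 i j))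
    fun t x hx => by rw [Lop_sub, h.eq t x hx, h'.eq t x hx]

theorem of_local (h : ∀ X ∈ O, ∃ N ∈ 𝓝 X, IsSol N c u) : IsSol O c u where
  jet := by
    refine ⟨fun t x hx => ?_, fun t x hx => ?_, fun j t x hx => ?_⟩ <;>
      obtain ⟨N, hN, hs⟩ := h _ hx
    · exact hs.jet.dt t x (mem_of_mem_nhds hN)
    · exact hs.jet.dx t x (mem_of_mem_nhds hN)
    · exact hs.jet.dxx j t x (mem_of_mem_nhds hN)
  cont X hX := by
    obtain ⟨N, hN, hs⟩ := h _ hX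
    exact (hs.cont.continuousAt hN).continuousWithinAt
  contt X hX := by
    obtain ⟨N, hN, hs⟩ := h _ hX
    exact (hs.contt.continuousAt hN).continuousWithinAt
  cont1 i X hX := by
    obtain ⟨N, hN, hs⟩ := h _ hX
    exact ((hs.cont1 i).continuousAt hN).continuousWithinAt
  cont2 i j X hX := by
    obtain ⟨N, hN, hs⟩ := h _ hX
    exact ((hs.cont2 i j).continuousAt hN).continuousWithinAt
  eq t x hx := by
    obtain ⟨N, hN, hs⟩ := h _ hx
    exact hs.eq t x (mem_of_mem_nhds hN)

end IsSol

theorem continuous_of_eq_zero_off {O K : Set (ℝ × Sp d)} (hO : IsOpen O) (hK : IsClosed K)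
    (hKO : K ⊆ O) {F : ℝ × Sp d → ℝ} (hF : ContinuousOn F O) (h : ∀ X, X ∉ K → F X = 0) :
    Continuous F := by
  refine continuous_iff_continuousAt.2 fun X => ?_
  by_cases hX : X ∈ O
  · exact hF.continuousAt (hO.mem_nhds hX)
  · refine (continuousAt_const (y := (0 : ℝ))).congr ?_
    exact (eventually_of_mem (hK.isOpen_compl.mem_nhds fun hx => hX (hKO hx)) h).mono
      fun _ => Eq.symm

theorem exists_ev_eq (h0 : 0 < β) (h1 : β ≤ 1) {K : Set (ℝ × Sp d)} (hK : IsCompact K)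
    (hK0 : ∀ X ∈ K, 0 < X.1) {F : ℝ → Sp d → ℝ} {F1 : Fin d → ℝ → Sp d → ℝ}
    (hF : Continuous fun X : ℝ × Sp d => F X.1 X.2)
    (hF1 : ∀ i, Continuous fun X : ℝ × Sp d => F1 i X.1 X.2) (z : ∀ t x, (t, x) ∉ K → F t x = 0)
    (z1 : ∀ i t x, (t, x) ∉ K → F1 i t x = 0)
    (hd : ∀ t x, HasFDerivAt (F t) (lin fun i => F1 i t x) x) :
    ∃ g : HY d β, ∀ t x, ev g t x = F t x := by
  obtain ⟨M, hM⟩ := hF.bounded_above_of_compact_support (HasCompactSupport.intro hK fun X => z X.1 X.2)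
  choose M1 hM1 using fun i => (hF1 i).bounded_above_of_compact_support
    (HasCompactSupport.intro hK fun X => z1 i X.1 X.2)
  have hlip (t x y) : |F t x - F t y| ≤ (∑ i, M1 i) * ‖x - y‖ := by
    refine convex_univ.norm_image_sub_le_of_norm_hasFDerivWithin_le
      (fun z _ => (hd t z).hasFDerivWithinAt) (fun z _ => ?_) (mem_univ y) (mem_univ x)
    exact (norm_lin_le _).trans (Finset.sum_le_sum fun i _ => hM1 i (t, z))
  have := multWith_of_lipschitz h0 h1 hF (fun t x => hM (t, x)) hlip
    (Finset.sum_nonneg fun i _ => (norm_nonneg _).trans (hM1 i 0))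
  obtain ⟨g, hg, -⟩ := exists_mk this.cont this.nonneg this.bound this.holder
    fun t ht x => z t x fun hx => (hK0 _ hx).not_ge ht
  exact ⟨g, hg⟩

/-- Localization of a solution by a cutoff. -/
theorem IsSol.exists_localization (h0 : 0 < β) (h1 : β ≤ 1) {O : Set (ℝ × Sp d)} (hO : IsOpen O)
    {c : ℝ → Sp d → Fin d → Fin d → ℝ} {u : ℝ → Sp d → ℝ} (hu : IsSol O c u) {η : ℝ × Sp d → ℝ}
    (hη : ContDiff ℝ 3 η) (hs : HasCompactSupport η) (hηO : tsupport η ⊆ O)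
    (hη0 : ∀ X ∈ tsupport η, 0 < X.1) :
    ∃ (U : HY d β) (U1 : Fin d → HY d β) (Ut : ℝ → Sp d → ℝ) (U2 : Fin d → Fin d → ℝ → Sp d → ℝ),
      Jet univ (ev U) Ut (fun i => ev (U1 i)) U2 ∧ (∀ t x, ev U t x = η (t, x) * u t x) ∧
      ∀ t x, η =ᶠ[𝓝 (t, x)] (fun _ => 1) → Ut t x = Lop c U2 t x := by
  obtain ⟨ηt, η1, η2, hc, hv⟩ := exists_cut h0 h1 hη hs
  have hz (X) (hX : X ∉ tsupport η) : η X = 0 ∧ ηt X.1 X.2 = 0 ∧ (∀ i, η1 i X.1 X.2 = 0) ∧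
      ∀ i j, η2 i j X.1 X.2 = 0 :=
    ⟨image_eq_zero_of_notMem_tsupport hX, hv X 0 (notMem_tsupport_iff_eventuallyEq.1 hX)⟩
  have hprod := (Jet.mk (O := O) (fun t x _ => hc.dt t x) (fun t x _ => hc.dx t x)
    fun j t x _ => hc.dxx j t x).mul hu.jet
  obtain ⟨U, hU⟩ : ∃ U : ℝ → Sp d → ℝ, U = fun t x => η (t, x) * u t x := ⟨_, rfl⟩
  obtain ⟨Ut, hUt⟩ : ∃ Ut : ℝ → Sp d → ℝ, Ut = fun t x => ηt t x * u t x +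
    η (t, x) * deriv (fun τ => u τ x) t := ⟨_, rfl⟩
  obtain ⟨U1, hU1⟩ : ∃ U1 : Fin d → ℝ → Sp d → ℝ, U1 = fun i t x => η1 i t x * u t x +
    η (t, x) * pd1 (u t) i x := ⟨_, rfl⟩
  obtain ⟨U2, hU2⟩ : ∃ U2 : Fin d → Fin d → ℝ → Sp d → ℝ, U2 = fun i j t x =>
    (η2 i j t x * u t x + η1 j t x * pd1 (u t) i x) + (η1 i t x * pd1 (u t) j x +
      η (t, x) * pd2 (u t) i j x) := ⟨_, rfl⟩
  have z (t x) (hX : (t, x) ∉ tsupport η) : U t x = 0 := by simp [hU, (hz _ hX).1]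
  have z1 (i t x) (hX : (t, x) ∉ tsupport η) : U1 i t x = 0 := by
    have := hz _ hX; simp [hU1, this.1, this.2.2.1]
  have z2 (i j t x) (hX : (t, x) ∉ tsupport η) : U2 i j t x = 0 := by
    have := hz _ hX; simp [hU2, this.1, this.2.2.1, this.2.2.2]
  have jO : Jet O U Ut U1 U2 := by rw [hU, hUt, hU1, hU2]; exact hprod
  have j0 : Jet (tsupport η)ᶜ (fun _ _ => (0 : ℝ)) (fun _ _ => 0) (fun (_ : Fin d) _ (_ : Sp d) => 0)
      fun (_ _ : Fin d) _ (_ : Sp d) => 0 := by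
    have hl : (lin fun _ : Fin d => (0 : ℝ)) = 0 := (lin_eq_of_apply_single (0 : Sp d →L[ℝ] ℝ)).symm
    exact ⟨fun t _ _ => hasDerivAt_const t _, fun _ x _ => hl ▸ hasFDerivAt_const (0 : ℝ) x,
      fun _ _ x _ => hl ▸ hasFDerivAt_const (0 : ℝ) x⟩
  have jz : Jet (tsupport η)ᶜ U Ut U1 U2 := by
    refine j0.congr_all (isClosed_tsupport η).isOpen_compl z (fun t x hX => ?_) z1 z2
    have := hz _ hX; simp [hUt, this.1, this.2.1]
  have hj : Jet univ U Ut U1 U2 := by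
    refine ⟨fun t x _ => ?_, fun t x _ => ?_, fun j t x _ => ?_⟩ <;> by_cases hX : (t, x) ∈ O
    · exact jO.dt t x hX
    · exact jz.dt t x fun h => hX (hηO h)
    · exact jO.dx t x hX
    · exact jz.dx t x fun h => hX (hηO h)
    · exact jO.dxx j t x hX
    · exact jz.dxx j t x fun h => hX (hηO h)
  have cc {F : ℝ × Sp d → ℝ} (hF : ContinuousOn F O) (h : ∀ X, X ∉ tsupport η → F X = 0) :
      Continuous F := continuous_of_eq_zero_off hO (isClosed_tsupport η) hηO hF h
  have ce {m : ℝ → Sp d → ℝ} (h : Mult β m) : ContinuousOn (fun X : ℝ × Sp d => m X.1 X.2) O :=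
    h.choose_spec.cont.continuousOn
  have k0 : Continuous fun X : ℝ × Sp d => U X.1 X.2 := by
    refine cc ?_ fun X => z X.1 X.2
    rw [hU]
    exact hη.continuous.continuousOn.mul hu.cont
  have k1 (i) : Continuous fun X : ℝ × Sp d => U1 i X.1 X.2 := by
    refine cc ?_ fun X => z1 i X.1 X.2
    rw [hU1]
    exact ((ce (hc.m1 i)).mul hu.cont).add (hη.continuous.continuousOn.mul (hu.cont1 i))
  have k2 (i j) : Continuous fun X : ℝ × Sp d => U2 i j X.1 X.2 := by
    refine cc ?_ fun X => z2 i j X.1 X.2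
    rw [hU2]
    exact (((ce (hc.m2 i j)).mul hu.cont).add ((ce (hc.m1 j)).mul (hu.cont1 i))).add
      (((ce (hc.m1 i)).mul (hu.cont1 j)).add (hη.continuous.continuousOn.mul (hu.cont2 i j)))
  obtain ⟨V, hV⟩ := exists_ev_eq h0 h1 hs hη0 k0 k1 z z1 fun t x => hj.dx t x (mem_univ _)
  have h' (j) := exists_ev_eq (β := β) h0 h1 hs hη0 (k1 j) (fun i => k2 i j) (z1 j)
    (fun i => z2 i j) fun t x => hj.dxx j t x (mem_univ _)
  choose V1 hV1 using h'
  refine ⟨V, V1, Ut, U2, ?_, fun t x => by rw [hV, hU], fun t x h => ?_⟩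
  · rwa [show ev V = U from funext fun t => funext (hV t),
      show (fun i => ev (V1 i)) = U1 from funext fun i => funext fun t => funext (hV1 i t)]
  · obtain ⟨e0, e1, e2⟩ := hv (t, x) 1 h
    have hX : (t, x) ∈ O := hηO (subset_tsupport η (by simp [h.eq_of_nhds]))
    simp only [hUt, hU2, e0, e1, e2, h.eq_of_nhds, hu.eq t x hX, Lop]
    simp

theorem tendsto_ev {g : ℕ → HY d β} {G : HY d β} (h : Tendsto g atTop (𝓝 G)) (t : ℝ) (x : Sp d) :
    Tendsto (fun n => ev (g n) t x) atTop (𝓝 (ev G t x)) := by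
  rw [tendsto_iff_norm_sub_tendsto_zero] at h ⊢
  refine squeeze_zero (fun _ => norm_nonneg _) (fun n => ?_) h
  rw [← ev_sub]
  exact abs_ev_le _ _ _

/-- Solutions are stable under locally uniform convergence. -/
theorem IsSol.limit {α : ℝ} (h0 : 0 < α) (hα : α ≤ 1)
    {c : ℝ → Sp d → Fin d → Fin d → ℝ} (hs : ∀ t x i j, c t x i j = c t x j i)
    (hp : ∀ t x, ∀ y : Sp d, y ≠ 0 → 0 < ∑ i, ∑ j, c t x i j * y i * y j) {X : ℝ × Sp d}
    (hX : 0 < X.1) (hc : HolAt c α X) {N : Set (ℝ × Sp d)} (hN : N ∈ 𝓝 X) {u : ℕ → ℝ → Sp d → ℝ}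
    {v : ℝ → Sp d → ℝ} (hu : ∀ n, IsSol N c (u n))
    (hcau : ∀ ε > 0, ∃ n₀, ∀ n ≥ n₀, ∀ m ≥ n₀, ∀ Y ∈ N, |u n Y.1 Y.2 - u m Y.1 Y.2| ≤ ε)
    (hv : ∀ Y ∈ N, Tendsto (fun n => u n Y.1 Y.2) atTop (𝓝 (v Y.1 Y.2))) :
    ∃ N' ∈ 𝓝 X, IsSol N' c v := by
  obtain ⟨β, hβ⟩ : ∃ β, β = α / 2 := ⟨_, rfl⟩
  have hβ0 : 0 < β := by linarith
  have hβ1 : β ≤ 1 / 2 := by linarith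
  obtain ⟨δ, C, hδ, hC, c', hcc, hcz, hm, hV⟩ := exists_local_solv hβ0 (by linarith) hα
    (hs X.1 X.2) (hp X.1 X.2) hc
  have hs' (t x i j) : c' t x i j = c' t x j i := by
    obtain ⟨Z, hZ⟩ := hcz (t, x)
    simp only at hZ
    rw [hZ, hs]
  have hp' (t x) (y : Sp d) : 0 ≤ ∑ i, ∑ j, c' t x i j * y i * y j := by
    obtain ⟨Z, hZ⟩ := hcz (t, x)
    simp only at hZ
    rw [hZ]
    rcases eq_or_ne y 0 with rfl | hy
    · simp
    · exact (hp _ _ y hy).le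
  obtain ⟨O, hOd⟩ : ∃ O : Set (ℝ × Sp d), O = interior N ∩ {Y | 0 < Y.1} ∩ Metric.ball X δ := ⟨_, rfl⟩
  have hO : IsOpen O := by
    rw [hOd]
    exact (isOpen_interior.inter (isOpen_lt continuous_const continuous_fst)).inter
        Metric.isOpen_ball
  have hXO : X ∈ O := by
    rw [hOd]; exact ⟨⟨mem_interior_iff_mem_nhds.2 hN, hX⟩, Metric.mem_ball_self hδ⟩
  have hON : O ⊆ N := by rw [hOd]; exact fun Y hY => interior_subset hY.1.1
  have hO0 (Y) (hY : Y ∈ O) : 0 < Y.1 := by rw [hOd] at hY; exact hY.1.2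
  have hOc (t x) (hY : (t, x) ∈ O) : c' t x = c t x := by
    rw [hOd] at hY; exact hcc (t, x) (Metric.mem_ball.1 hY.2).le
  obtain ⟨b, hb, hbs, hbO, hb01, W, hW, hXW, hbW⟩ := exists_bump isCompact_singleton hO
    (Set.singleton_subset_iff.2 hXO)
  obtain ⟨η, hη, hηs, hηO, hη01, W', hW', hbW', hηW'⟩ := exists_bump hbs hO hbO
  obtain ⟨bt, b1, b2, hbc, -⟩ := exists_cut hβ0 (by linarith) hb hbs
  have hbpos (t x) (h : 0 < b (t, x)) : (t, x) ∈ tsupport b :=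
    subset_tsupport b (by simpa using h.ne')
  have hη1 (t x) (h : 0 < b (t, x)) : η =ᶠ[𝓝 (t, x)] fun _ => 1 :=
    eventually_of_mem (hW'.mem_nhds (hbW' (hbpos t x h))) hηW'
  obtain ⟨V0, Vt, V1, V2, C0, ζ, ζt, ζ1, ζ2, hr, he, hζ, hest⟩ :=
    interior_estimate hβ0 hβ1 hm hs' hp' hC hV hbc
  choose U U1 Ut U2 hj hU hUe using fun n => ((hu n).mono hON |>.congr_coeff
      hOc).exists_localization
    hβ0 (by linarith) hO hη hηs hηO fun Y hY => hO0 Y (hηO hY)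
  choose G hG hGe hGn using fun n => hest (U n) (U1 n) (Ut n) (U2 n) (hj n) fun t x h =>
    hUe n t x (hη1 t x h)
  have hGcau : CauchySeq G := by
    refine Metric.cauchySeq_iff'.2 fun ε hε => ?_
    have hC0 : 0 < |C0| + 1 := by positivity
    obtain ⟨n₀, hn₀⟩ := hcau (ε / (2 * (|C0| + 1))) (by positivity)
    refine ⟨n₀, fun n hn => ?_⟩
    have hjd := (hj n).sub (hj n₀)
    obtain ⟨D, -, hDe, hDn⟩ := hest (U n - U n₀) (fun i => U1 n i - U1 n₀ i) _ _ hjd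
      fun t x h => by rw [Lop_sub, hUe n t x (hη1 t x h), hUe n₀ t x (hη1 t x h)]
    have hD : G n - G n₀ = D := by
      refine ext_ev fun t x => ?_
      rw [ev_sub, hGe, hGe, hDe, ev_sub]
      have := Comm_sub c' ζt ζ1 ζ2 (ev (U n)) (ev (U n₀)) (fun i => ev (U1 n i))
        (fun i => ev (U1 n₀ i)) t x
      have h2 : Comm c' ζt ζ1 ζ2 (ev (U n - U n₀)) (fun i => ev (U1 n i - U1 n₀ i)) t x = _ := this
      rw [h2]
      ring
    rw [dist_eq_norm, hD]
    refine (hDn (ε / (2 * (|C0| + 1))) (by positivity) fun t x h => ?_).trans_lt ?_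
    · have hX := hbO (hbpos t x h)
      rw [ev_sub, hU, hU, (hη1 t x h).eq_of_nhds, one_mul, one_mul]
      exact hn₀ n hn n₀ le_rfl (t, x) (hON hX)
    · calc C0 * (ε / (2 * (|C0| + 1))) ≤ (|C0| + 1) * (ε / (2 * (|C0| + 1))) := by
            gcongr; linarith [le_abs_self C0]
        _ = ε / 2 := by field_simp
        _ < ε := by linarith
  obtain ⟨G₀, hG₀⟩ := cauchySeq_tendsto_of_complete hGcau
  have hWO : ∀ t x, (t, x) ∈ W → 0 < b (t, x) := fun t x h => by rw [hbW _ h]; exact one_pos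
  have hval (n t x) (h : (t, x) ∈ W) : ev (V0 (G n)) t x = u n t x ∧ ev (G n) t x = u n t x := by
    have hz := hζ t x (hbW _ h).ge
    have : ev (U n) t x = u n t x := by
      rw [hU, (hη1 t x (hWO t x h)).eq_of_nhds, one_mul]
    rw [hG, hGe, Comm_eq_zero hz.2, hz.1, this]
    simp
  have hWN (t x) (h : (t, x) ∈ W) : (t, x) ∈ N := hON (hbO (hbpos t x (hWO t x h)))
  have hlim (t x) (h : (t, x) ∈ W) : v t x = ev (V0 G₀) t x ∧ v t x = ev G₀ t x := by
    have hl := hv _ (hWN t x h)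
    refine ⟨tendsto_nhds_unique hl ?_, tendsto_nhds_unique hl ?_⟩
    · exact (tendsto_ev ((V0.continuous.tendsto G₀).comp hG₀) t x).congr fun n => (hval n t x h).1
    · exact (tendsto_ev hG₀ t x).congr fun n => (hval n t x h).2
  refine ⟨W, hW.mem_nhds (hXW rfl), ?_⟩
  have hsol : IsSol W c' v := by
    refine (((hr G₀).rep W).congr hW fun t x h => (hlim t x h).1).isSol hW ?_
      (continuous_ev _).continuousOn (fun i => (continuous_ev _).continuousOn)
      (fun i j => (continuous_ev _).continuousOn) fun t x h => ?_
    · exact (continuous_ev (V0 G₀)).continuousOn.congr fun Y hY => (hlim Y.1 Y.2 hY).1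
    · have := he G₀ t x
      have h1 := hlim t x h
      linarith
  exact hsol.congr_coeff fun t x h => (hOc t x (hbO (hbpos t x (hWO t x h)))).symm

/-- Admissible coefficients for the forward Cauchy problem on `(0, ∞)`. -/
structure Coef (K : ℝ) (c : ℝ → Sp d → Fin d → Fin d → ℝ) : Prop where
  symm : ∀ t x i j, c t x i j = c t x j i
  pd : ∀ t x, ∀ y : Sp d, y ≠ 0 → 0 < ∑ i, ∑ j, c t x i j * y i * y j
  growth : ∀ t x i j, |c t x i j| ≤ K * qw x
  hol : ∀ X : ℝ × Sp d, 0 < X.1 → ∃ α, 0 < α ∧ α ≤ 1 ∧ HolAt c α X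

theorem Coef.psd {K : ℝ} {c : ℝ → Sp d → Fin d → Fin d → ℝ} (hc : Coef K c) (t : ℝ) (x y : Sp d) :
    0 ≤ ∑ i, ∑ j, c t x i j * y i * y j := by
  rcases eq_or_ne y 0 with rfl | hy
  · simp
  · exact (hc.pd t x y hy).le

theorem HolAt.exists_ball {c : ℝ → Sp d → Fin d → Fin d → ℝ} {α : ℝ} {X : ℝ × Sp d}
    (h : HolAt c α X) : ∃ r, 0 < r ∧ r ≤ 1 / 2 ∧ ∃ C, 0 ≤ C ∧ ∀ i j, ∀ q ∈ Metric.ball X r,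
      ∀ q' ∈ Metric.ball X r, dist q q' ≤ 1 ∧
        |c q.1 q.2 i j - c q'.1 q'.2 i j| ≤ C * dist q q' ^ α := by
  obtain ⟨U, hU, C, hC, h⟩ := h
  obtain ⟨r, hr, hrU⟩ := Metric.mem_nhds_iff.1 hU
  refine ⟨min r (1 / 2), by positivity, min_le_right _ _, C, hC, fun i j q hq q' hq' => ⟨?_, ?_⟩⟩
  · have h1 := Metric.mem_ball.1 hq
    have h2 := Metric.mem_ball'.1 hq'
    have := dist_triangle q X q'
    have := min_le_right r (1 / 2 : ℝ)
    linarith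
  · exact h i j q (hrU (Metric.ball_subset_ball (min_le_left _ _) hq)) q'
      (hrU (Metric.ball_subset_ball (min_le_left _ _) hq'))

theorem HolAt.mono {c : ℝ → Sp d → Fin d → Fin d → ℝ} {α α' : ℝ} {X : ℝ × Sp d} (h : HolAt c α X)
    (h0 : 0 < α') (hα : α' ≤ α) : HolAt c α' X := by
  obtain ⟨r, hr, -, C, hC, h⟩ := h.exists_ball
  refine ⟨_, Metric.ball_mem_nhds X hr, C, hC, fun i j q hq q' hq' => ?_⟩
  obtain ⟨h1, h2⟩ := h i j q hq q' hq'
  refine h2.trans (mul_le_mul_of_nonneg_left ?_ hC)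
  exact Real.rpow_le_rpow_of_exponent_ge_of_imp dist_nonneg h1 hα
    fun _ h => absurd h (h0.trans_le hα).ne'

theorem HolAt.eventually {c : ℝ → Sp d → Fin d → Fin d → ℝ} {α : ℝ} {X : ℝ × Sp d}
    (h : HolAt c α X) : ∀ᶠ Y in 𝓝 X, HolAt c α Y := by
  obtain ⟨U, hU, C, hC, h⟩ := h
  exact (eventually_mem_nhds_iff.2 hU).mono fun Y hY => ⟨U, hY, C, hC, h⟩

theorem HolAt.interpolate {c : ℝ → Sp d → Fin d → Fin d → ℝ} {α : ℝ} {X : ℝ × Sp d}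
    (h : HolAt c α X) (h0 : 0 < α) (hα : α ≤ 1) {θ : ℝ × Sp d → ℝ} (hθ : ContDiff ℝ 3 θ)
    (A : Fin d → Fin d → ℝ) :
    HolAt (fun t x i j => θ (t, x) * c t x i j + (1 - θ (t, x)) * A i j) α X := by
  obtain ⟨r, hr, -, C, hC, h⟩ := h.exists_ball
  obtain ⟨k, W, hW, hk⟩ := ((hθ.of_le (by norm_num)).contDiffAt (x := X)).exists_lipschitzOnWith
  have hb : ∀ᶠ Y in 𝓝 X, |θ Y| < |θ X| + 1 :=
    (hθ.continuous.abs.tendsto X).eventually (gt_mem_nhds (by linarith))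
  obtain ⟨B, hB⟩ : ∃ B, B = C + ∑ i, ∑ j, |c X.1 X.2 i j - A i j| := ⟨_, rfl⟩
  have hBs (i j) : |c X.1 X.2 i j - A i j| ≤ ∑ i, ∑ j, |c X.1 X.2 i j - A i j| :=
    (Finset.single_le_sum (f := fun j => |c X.1 X.2 i j - A i j|) (fun _ _ => abs_nonneg _)
      (Finset.mem_univ j)).trans (Finset.single_le_sum
        (f := fun i => ∑ j, |c X.1 X.2 i j - A i j|)
        (fun _ _ => Finset.sum_nonneg fun _ _ => abs_nonneg _) (Finset.mem_univ i))
  have hB0 : 0 ≤ B := by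
    rw [hB]; exact add_nonneg hC (Finset.sum_nonneg fun _ _ => Finset.sum_nonneg fun _ _ =>
        abs_nonneg _)
  refine ⟨_, inter_mem (inter_mem (Metric.ball_mem_nhds X hr) hW) hb, (|θ X| + 1) * C + k * B,
    by positivity, fun i j q hq q' hq' => ?_⟩
  obtain ⟨hd, hh⟩ := h i j q hq.1.1 q' hq'.1.1
  have hpow : dist q q' ≤ dist q q' ^ α := by
    simpa using Real.rpow_le_rpow_of_exponent_ge_of_imp (dist_nonneg (x := q) (y := q')) hd hα
      fun _ h => absurd h one_ne_zero
  have hcA : |c q'.1 q'.2 i j - A i j| ≤ B := by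
    obtain ⟨hd', hh'⟩ := h i j q' hq'.1.1 X (Metric.mem_ball_self hr)
    have := Real.rpow_le_one dist_nonneg hd' h0.le
    have : |c q'.1 q'.2 i j - c X.1 X.2 i j| ≤ C :=
      hh'.trans (mul_le_of_le_one_right hC this)
    rw [hB]
    linarith [hBs i j, abs_sub_le (c q'.1 q'.2 i j) (c X.1 X.2 i j) (A i j)]
  have hl : |θ q - θ q'| ≤ k * dist q q' ^ α :=
    (hk.dist_le_mul q hq.1.2 q' hq'.1.2).trans (by gcongr)
  have e : θ (q.1, q.2) * c q.1 q.2 i j + (1 - θ (q.1, q.2)) * A i j -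
      (θ (q'.1, q'.2) * c q'.1 q'.2 i j + (1 - θ (q'.1, q'.2)) * A i j) =
      θ q * (c q.1 q.2 i j - c q'.1 q'.2 i j) + (θ q - θ q') * (c q'.1 q'.2 i j - A i j) := by
    simp only [Prod.mk.eta]; ring
  rw [e]
  calc _ ≤ |θ q| * |c q.1 q.2 i j - c q'.1 q'.2 i j| + |θ q - θ q'| * |c q'.1 q'.2 i j - A i j| := by
        rw [← abs_mul, ← abs_mul]; exact abs_add_le _ _
    _ ≤ (|θ X| + 1) * (C * dist q q' ^ α) + k * dist q q' ^ α * B := by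
        gcongr
        exact hq.2.le
    _ = _ := by ring

theorem Coef.exists_exponent {K : ℝ} {c : ℝ → Sp d → Fin d → Fin d → ℝ} (hc : Coef K c)
    {S : Set (ℝ × Sp d)} (hS : IsCompact S) (hS0 : ∀ X ∈ S, 0 < X.1) :
    ∃ α, 0 < α ∧ α ≤ 1 ∧ ∀ X ∈ S, HolAt c α X := by
  refine IsCompact.induction_on hS
    (p := fun S => ∃ α, 0 < α ∧ α ≤ 1 ∧ ∀ X ∈ S, HolAt c α X) ⟨1, one_pos, le_rfl, by simp⟩
    (fun s t hst ⟨α, h0, h1, h⟩ => ⟨α, h0, h1, fun X hX => h X (hst hX)⟩) ?_ fun X hX => ?_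
  · rintro s t ⟨α, h0, h1, h⟩ ⟨α', h0', h1', h'⟩
    refine ⟨min α α', lt_min h0 h0', (min_le_left _ _).trans h1, fun X hX => ?_⟩
    rcases hX with hX | hX
    · exact (h X hX).mono (lt_min h0 h0') (min_le_left _ _)
    · exact (h' X hX).mono (lt_min h0 h0') (min_le_right _ _)
  · obtain ⟨α, h0, h1, h⟩ := hc.hol X (hS0 X hX)
    exact ⟨_, mem_nhdsWithin_of_mem_nhds h.eventually, α, h0, h1, fun Y hY => hY⟩

/-- Coefficients agreeing with `c` on a compact set, for which the Cauchy problem is solvable. -/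
theorem Coef.exists_approx {K : ℝ} {c : ℝ → Sp d → Fin d → Fin d → ℝ} (hc : Coef K c)
    {S : Set (ℝ × Sp d)} (hS : IsCompact S) (hS0 : ∀ X ∈ S, 0 < X.1) :
    ∃ β, 0 < β ∧ β ≤ 1 ∧ ∃ c' : ℝ → Sp d → Fin d → Fin d → ℝ, Coef (max K 1) c' ∧
      (∀ X ∈ S, c' X.1 X.2 = c X.1 X.2) ∧ (∀ i j, Mult β fun t x => c' t x i j) ∧
      ∃ lam : ℝ, ∀ g : HY d β, ∃ (u ut : HY d β) (u1 : Fin d → HY d β) (u2 : Fin d → Fin d → HY d β),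
        HYRep u ut u1 u2 ∧ ∀ t x, ev ut t x + lam * ev u t x -
          1 / 2 * ∑ i, ∑ j, c' t x i j * ev (u2 i j) t x = ev g t x := by
  obtain ⟨θ, hθ, hθs, hθ0, h01, V, -, hSV, hV⟩ := exists_bump hS
    (isOpen_lt continuous_const continuous_fst : IsOpen {X : ℝ × Sp d | 0 < X.1}) hS0
  obtain ⟨α, hα0, hα1, hα⟩ := hc.exists_exponent hθs hθ0
  obtain ⟨A, hA⟩ : ∃ A : Fin d → Fin d → ℝ, A = fun i j => if i = j then 1 else 0 := ⟨_, rfl⟩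
  obtain ⟨c', hc'⟩ : ∃ c' : ℝ → Sp d → Fin d → Fin d → ℝ,
    c' = fun t x i j => θ (t, x) * c t x i j + (1 - θ (t, x)) * A i j := ⟨_, rfl⟩
  have hs (t x i j) : c' t x i j = c' t x j i := by
    simp only [hc', hc.symm t x i j, hA, eq_comm (a := i)]
  have hoff (X) (hX : X ∉ tsupport θ) : c' X.1 X.2 = A := by
    have : θ X = 0 := image_eq_zero_of_notMem_tsupport hX
    simp [hc', this]
  have hhol (X) : HolAt c' α X := by
    by_cases hX : X ∈ tsupport θ
    · rw [hc']; exact (hα X hX).interpolate hα0 hα1 hθ A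
    · refine ⟨_, (isClosed_tsupport θ).isOpen_compl.mem_nhds hX, 0, le_rfl, fun i j q hq q' hq' => ?_⟩
      rw [hoff q hq, hoff q' hq']; simp
  have hpd (t x) (y : Sp d) (hy : y ≠ 0) : 0 < ∑ i, ∑ j, c' t x i j * y i * y j := by
    have e : ∑ i, ∑ j, c' t x i j * y i * y j = θ (t, x) * ∑ i, ∑ j, c t x i j * y i * y j +
        (1 - θ (t, x)) * ∑ i, y i ^ 2 := by
      have : ∑ i, y i ^ 2 = ∑ i, ∑ j, A i j * y i * y j := by
        simp [hA, sq]
      rw [this, Finset.mul_sum, Finset.mul_sum, ← Finset.sum_add_distrib]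
      refine Finset.sum_congr rfl fun i _ => ?_
      rw [Finset.mul_sum, Finset.mul_sum, ← Finset.sum_add_distrib]
      exact Finset.sum_congr rfl fun j _ => by rw [hc']; ring
    have hy2 : 0 < ∑ i, y i ^ 2 := by
      obtain ⟨i, hi⟩ := Function.ne_iff.1 hy
      exact Finset.sum_pos' (fun i _ => sq_nonneg _) ⟨i, Finset.mem_univ i, by
        have : y i ≠ 0 := hi
        positivity⟩
    have h1 := hc.pd t x y hy
    have ⟨h2, h3⟩ := h01 (t, x)
    rw [e]
    rcases h2.eq_or_lt with h | h
    · rw [← h]; simpa using hy2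
    · exact add_pos_of_pos_of_nonneg (mul_pos h h1) (mul_nonneg (by linarith) hy2.le)
  have hg (t x i j) : |c' t x i j| ≤ max K 1 * qw x := by
    have ⟨h2, h3⟩ := h01 (t, x)
    have hA1 : |A i j| ≤ max K 1 * qw x := by
      refine le_trans ?_ (one_le_mul_of_one_le_of_one_le (le_max_right K 1) (one_le_qw x))
      simp only [hA]; split_ifs <;> simp
    have hK : |c t x i j| ≤ max K 1 * qw x :=
      (hc.growth t x i j).trans (mul_le_mul_of_nonneg_right (le_max_left _ _) (qw_pos x).le)
    rw [hc']
    calc _ ≤ |θ (t, x) * c t x i j| + |(1 - θ (t, x)) * A i j| := abs_add_le _ _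
      _ = θ (t, x) * |c t x i j| + (1 - θ (t, x)) * |A i j| := by
          rw [abs_mul, abs_mul, abs_of_nonneg h2, abs_of_nonneg (sub_nonneg.2 h3)]
      _ ≤ θ (t, x) * (max K 1 * qw x) + (1 - θ (t, x)) * (max K 1 * qw x) := by
          gcongr
      _ = _ := by ring
  obtain ⟨hm, hsolv⟩ := exists_global_solv (β := α / 2) (by linarith) (by linarith) hα1 hs hpd hhol hθs
    hoff
  refine ⟨α / 2, by linarith, by linarith, c', ⟨hs, hpd, hg, fun X _ => ⟨α, hα0, hα1, hhol X⟩⟩,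
    fun X hX => ?_, hm, hsolv⟩
  simp [hc', hV X (hSV hX)]

theorem exists_jet_of_smooth (h0 : 0 < β) (h1 : β ≤ 1) {f : Sp d → ℝ} (hf : ContDiff ℝ 3 f)
    (hs : HasCompactSupport f) : ∃ (f1 : Fin d → Sp d → ℝ) (f2 : Fin d → Fin d → Sp d → ℝ),
      (∀ O, Jet O (fun _ x => f x) (fun _ _ => 0) (fun i _ x => f1 i x) fun i j _ x => f2 i j x) ∧
      (∀ i, Continuous (f1 i)) ∧ ∀ i j, Mult β fun _ x => f2 i j x := by
  obtain ⟨θ, hθ, hθs, -, -, V, -, hV, hθV⟩ := exists_bump (isCompact_singleton (x := (0 : ℝ)))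
    isOpen_univ (Set.subset_univ _)
  obtain ⟨χt, χ1, χ2, hχ, -⟩ := exists_cut h0 h1 (χ := fun X : ℝ × Sp d => θ X.1 * f X.2)
    (by fun_prop) (HasCompactSupport.intro (K := tsupport θ ×ˢ tsupport f) (hθs.prod hs)
      fun X hX => by
        by_contra h
        exact hX ⟨subset_tsupport θ (left_ne_zero_of_mul h),
          subset_tsupport f (right_ne_zero_of_mul h)⟩)
  have e : θ 0 = 1 := hθV 0 (hV rfl)
  refine ⟨fun i => χ1 i 0, fun i j => χ2 i j 0, fun O => ⟨fun t x _ => hasDerivAt_const t _,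
    fun _ x _ => ?_, fun j _ x _ => hχ.dxx j 0 x⟩, fun i => ?_, fun i j => ?_⟩
  · simpa only [e, one_mul] using hχ.dx 0 x
  · obtain ⟨M, hM⟩ := hχ.m1 i
    exact hM.cont.comp (continuous_const.prodMk continuous_id)
  · obtain ⟨M, hM⟩ := hχ.m2 i j
    exact ⟨M, hM.cont.comp (continuous_const.prodMk continuous_snd), fun _ => hM.bound 0,
      fun _ => hM.holder 0⟩

theorem multWith_time {θ : ℝ → ℝ} (hθ : Continuous θ) (hs : HasCompactSupport θ) :
    Mult β fun t (_ : Sp d) => θ t := by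
  obtain ⟨M, hM⟩ := hθ.bounded_above_of_compact_support hs
  have hM0 : 0 ≤ M := (norm_nonneg _).trans (hM 0)
  exact ⟨M, hθ.comp continuous_fst, fun t _ => hM t, fun t x y => by
    rw [sub_self, abs_zero]; positivity⟩

theorem qw_le_bar {l : ℝ} (hl : 0 ≤ l) (m : ℕ) {t : ℝ} (ht : 0 ≤ t) (x : Sp d) :
    qw x ^ (m + 2) ≤ bar l m t x :=
  le_mul_of_one_le_left (pow_pos (qw_pos x) _).le (Real.one_le_exp (by positivity))

theorem abs_Lop_le {c : ℝ → Sp d → Fin d → Fin d → ℝ} {u2 : Fin d → Fin d → ℝ → Sp d → ℝ} {t : ℝ}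
    {x : Sp d} {K F : ℝ} (hc : ∀ i j, |c t x i j| ≤ K) (hu : ∀ i j, |u2 i j t x| ≤ F) :
    |Lop c u2 t x| ≤ d * d * (K * F) := by
  have : |∑ i, ∑ j, c t x i j * u2 i j t x| ≤ ∑ _i : Fin d, ∑ _j : Fin d, K * F := by
    refine (Finset.abs_sum_le_sum_abs _ _).trans (Finset.sum_le_sum fun i _ => ?_)
    refine (Finset.abs_sum_le_sum_abs _ _).trans (Finset.sum_le_sum fun j _ => ?_)
    rw [abs_mul]
    exact mul_le_mul (hc i j) (hu i j) (abs_nonneg _) ((abs_nonneg _).trans (hc i j))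
  have h2 : ∑ _i : Fin d, ∑ _j : Fin d, K * F = d * d * (K * F) := by simp [mul_assoc]
  rw [Lop, abs_mul, abs_of_nonneg (by norm_num : (0 : ℝ) ≤ 1 / 2)]
  linarith [abs_nonneg (∑ i, ∑ j, c t x i j * u2 i j t x)]

theorem Mult.of_one (h0 : 0 < β) (h1 : β ≤ 1) {m : ℝ → Sp d → ℝ} (h : Mult 1 m) : Mult β m := by
  obtain ⟨M, hM⟩ := h
  exact ⟨_, multWith_of_lipschitz h0 h1 hM.cont hM.bound
    (fun t x y => by simpa using hM.holder t x y) hM.nonneg⟩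

theorem Mult.sum {ι : Type*} (s : Finset ι) {m : ι → ℝ → Sp d → ℝ} (h : ∀ i, Mult β (m i)) :
    Mult β fun t x => ∑ i ∈ s, m i t x := by
  classical
  induction s using Finset.induction with
  | empty => simpa using mult_const 0
  | insert i s hi ih =>
    simp only [Finset.sum_insert hi]
    exact (h i).add ih

/-- Approximate solutions for smooth data, uniformly close to the data for small times. -/
theorem Coef.exists_approx_solution {K : ℝ} {c : ℝ → Sp d → Fin d → Fin d → ℝ} (hc : Coef K c)
    {f : Sp d → ℝ} (hf : ContDiff ℝ 3 f) (hs : HasCompactSupport f) (T : ℝ) :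
    ∃ C l, 0 ≤ C ∧ 0 ≤ l ∧ ∀ S : Set (ℝ × Sp d), IsCompact S → (∀ X ∈ S, 0 < X.1) →
      ∃ u : ℝ → Sp d → ℝ, Continuous (fun X : ℝ × Sp d => u X.1 X.2) ∧ IsSol (interior S) c u ∧
        ∀ t ∈ Set.Icc 0 T, ∀ x, |u t x - f x| ≤ C * (t * bar l 0 t x) := by
  obtain ⟨l, hl0, hl⟩ := exists_barrier (d := d) (max K 1) 0
  obtain ⟨b1, b2, hb, hbl⟩ := hl l le_rfl
  obtain ⟨f1, f2, hfj, hf1, hf2⟩ := exists_jet_of_smooth one_pos le_rfl hf hs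
  choose F hF using fun i j => hf2 i j
  have hF0 (i j) : 0 ≤ F i j := (hF i j).nonneg
  obtain ⟨F', hF'⟩ : ∃ F', F' = ∑ i, ∑ j, F i j := ⟨_, rfl⟩
  have hFF (i j) : F i j ≤ F' := by
    rw [hF']
    exact (Finset.single_le_sum (f := fun j => F i j) (fun j _ => hF0 i j)
      (Finset.mem_univ j)).trans (Finset.single_le_sum (f := fun i => ∑ j, F i j)
        (fun i _ => Finset.sum_nonneg fun j _ => hF0 i j) (Finset.mem_univ i))
  have hF0' : 0 ≤ F' := by
    rw [hF']; exact Finset.sum_nonneg fun i _ => Finset.sum_nonneg fun j _ => hF0 i j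
  obtain ⟨C, hC⟩ : ∃ C, C = d * d * (max K 1 * F') := ⟨_, rfl⟩
  have hC0 : 0 ≤ C := by rw [hC]; positivity
  refine ⟨C, l, hC0, hl0, fun S hS hS0 => ?_⟩
  obtain ⟨β, h0, h1, c', hc', hcS, hm, lam, hsolv⟩ := hc.exists_approx hS hS0
  obtain ⟨θ, hθ, hθs, hθ0, h01, V, -, hSV, hV⟩ := exists_bump (hS.image continuous_fst)
    (isOpen_Ioi (a := (0 : ℝ))) (by rintro _ ⟨X, hX, rfl⟩; exact hS0 X hX)
  have hθz (t : ℝ) (ht : t ≤ 0) : θ t = 0 :=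
    image_eq_zero_of_notMem_tsupport fun h => absurd (hθ0 h) (not_lt.2 ht)
  have hg : Mult β fun t x => (θ t * Real.exp (-lam * t)) *
      Lop c' (fun i j _ x => f2 i j x) t x :=
    (multWith_time (by have := hθ.continuous; fun_prop) hθs.mul_right).mul
      ((mult_const _).mul (Mult.sum _ fun i => Mult.sum _ fun j =>
        (hm i j).mul ((hf2 i j).of_one h0 h1)))
  obtain ⟨M, hM⟩ := hg
  obtain ⟨g, hg, -⟩ := exists_mk hM.cont hM.nonneg hM.bound hM.holder
    fun t ht x => by rw [hθz t ht, zero_mul, zero_mul]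
  obtain ⟨u, ut, u1, u2, hr, hu⟩ := hsolv g
  have hexp : Jet univ (fun t (_ : Sp d) => Real.exp (lam * t)) (fun t _ => lam * Real.exp (lam * t))
      (fun _ _ _ => 0) fun _ _ _ _ => 0 := by
    refine ⟨fun t x _ => ?_, fun t x _ => ?_, fun j t x _ => ?_⟩
    · simpa [mul_comm] using ((hasDerivAt_id t).const_mul lam).exp
    · rw [show lin (fun _ : Fin d => (0 : ℝ)) = 0 from (lin_eq_of_apply_single 0).symm]
      exact hasFDerivAt_const _ _
    · rw [show lin (fun _ : Fin d => (0 : ℝ)) = 0 from (lin_eq_of_apply_single 0).symm]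
      exact hasFDerivAt_const _ _
  have hw := hexp.mul (hr.rep univ)
  have hweq (t x) : lam * Real.exp (lam * t) * ev u t x + Real.exp (lam * t) * ev ut t x -
      Lop c' (fun i j t x => Real.exp (lam * t) * ev (u2 i j) t x) t x =
        θ t * Lop c' (fun i j _ x => f2 i j x) t x := by
    have e := hu t x
    rw [hg] at e
    have e2 : Lop c' (fun i j t x => Real.exp (lam * t) * ev (u2 i j) t x) t x =
        Real.exp (lam * t) * (1 / 2 * ∑ i, ∑ j, c' t x i j * ev (u2 i j) t x) := by
      simp only [Lop, Finset.mul_sum]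
      exact Finset.sum_congr rfl fun i _ => Finset.sum_congr rfl fun j _ => by ring
    have e3 : Real.exp (lam * t) * Real.exp (-lam * t) = 1 := by
      rw [← Real.exp_add]; simp
    rw [e2]
    linear_combination Real.exp (lam * t) * e + θ t * Lop c' (fun i j _ x => f2 i j x) t x * e3
  simp only [zero_mul, zero_add] at hw
  have hwc : Continuous fun X : ℝ × Sp d => Real.exp (lam * X.1) * ev u X.1 X.2 := by
    have := continuous_ev u
    fun_prop
  refine ⟨fun t x => f x + Real.exp (lam * t) * ev u t x, ?_, ?_, fun t ht x => ?_⟩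
  · have := hf.continuous
    exact (this.comp continuous_snd).add hwc
  · refine IsSol.congr_coeff (c := c') (((hfj univ).add hw).mono (subset_univ _) |>.isSol
      isOpen_interior ?_ ?_ ?_ ?_ ?_) fun t x hX => (hcS _ (interior_subset hX)).symm
    · have := hf.continuous
      exact ((this.comp continuous_snd).add hwc).continuousOn
    · have := continuous_ev u
      have := continuous_ev ut
      exact Continuous.continuousOn (by fun_prop)
    · intro i
      have := continuous_ev (u1 i)
      have := hf1 i
      exact Continuous.continuousOn (by fun_prop)
    · intro i j
      have := continuous_ev (u2 i j)
      obtain ⟨M, hM⟩ := hf2 i j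
      exact (hM.cont.add (by fun_prop)).continuousOn
    · intro t x hX
      have e : θ t = 1 := hV t (hSV ⟨_, interior_subset hX, rfl⟩)
      have := hweq t x
      rw [Lop_add]
      simp only [e, zero_add] at this ⊢
      linarith
  · rw [add_sub_cancel_left]
    have hbt : Jet univ (fun t x => C * (t * bar l 0 t x))
        (fun t x => C * (1 * bar l 0 t x + t * (l * bar l 0 t x)))
        (fun i t x => C * (t * b1 i t x)) fun i j t x => C * (t * b2 i j t x) := by
      refine Jet.smul ⟨fun t x _ => ?_, fun t x _ => ?_, fun j t x _ => ?_⟩ C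
      · exact (hasDerivAt_id t).mul ((hb univ).dt t x trivial)
      · rw [lin_smul]; exact ((hb univ).dx t x trivial).const_mul t
      · rw [lin_smul]; exact ((hb univ).dxx j t x trivial).const_mul t
    obtain ⟨B, hB⟩ : ∃ B, ∀ t ∈ Set.Icc 0 T, ∀ x, |Real.exp (lam * t) * ev u t x| ≤ B * qw x ^ 0 := by
      refine ⟨Real.exp (|lam| * T) * ‖u‖, fun t ht x => ?_⟩
      rw [pow_zero, mul_one, abs_mul, Real.abs_exp]
      have : lam * t ≤ |lam| * T := mul_le_mul (le_abs_self _) ht.2 ht.1 (abs_nonneg _)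
      exact mul_le_mul (Real.exp_le_exp.2 this) (abs_ev_le u t x) (abs_nonneg _) (Real.exp_pos _).le
    refine abs_le_of_growth (c := c') (s := 0) (T := T) (lam := 0) (K := max K 1) (C := B) (m := 0)
      le_rfl (fun t _ x => hc'.symm t x) (fun t _ x => hc'.psd t x) (fun t _ x => hc'.growth t x)
      (hw.mono (subset_univ _)) (hbt.mono (subset_univ _)) hwc.continuousOn
      (Continuous.continuousOn ?_) (fun t ht x => ?_) hB (fun t ht x => ?_) (fun x => ?_) t ht x
    · have := continuous_bar (d := d) l 0
      fun_prop
    · exact mul_nonneg hC0 (mul_nonneg ht.1 (bar_pos _ _ _ _).le)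
    · simp only [zero_mul, add_zero]
      rw [hweq, Lop_smul]
      have e1 : Lop c' (fun i j t x => t * b2 i j t x) t x = t * Lop c' b2 t x := by
        simp only [Lop, Finset.mul_sum]
        exact Finset.sum_congr rfl fun i _ => Finset.sum_congr rfl fun j _ => by ring
      rw [e1]
      have h2 := (hbl c' t x (hc'.growth t x)).le
      have h3 : |Lop c' (fun i j _ x => f2 i j x) t x| ≤ C * qw x := by
        refine (abs_Lop_le (F := F') (hc'.growth t x) fun i j =>
          ((hF i j).bound t x).trans (hFF i j)).trans_eq ?_
        rw [hC]; ring
      have h4 : qw x ≤ bar l 0 t x := by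
        refine le_trans ?_ (qw_le_bar hl0 0 ht.1.le x)
        exact le_self_pow₀ (one_le_qw x) (by norm_num)
      have h5 := mul_le_mul (h01 t).2 h3 (abs_nonneg _) zero_le_one
      rw [abs_mul, abs_of_nonneg (h01 t).1]
      nlinarith [mul_nonneg hC0 (sub_nonneg.2 h4), mul_nonneg (mul_nonneg hC0 ht.1.le)
        (sub_nonneg.2 h2)]
    · rw [ev_nonpos u le_rfl]; simp

theorem Coef.exists_limit {K : ℝ} {c : ℝ → Sp d → Fin d → Fin d → ℝ} (hc : Coef K c) {T : ℝ}
    {u : ℕ → ℝ → Sp d → ℝ}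
    (hu : ∀ n, ContinuousOn (fun X : ℝ × Sp d => u n X.1 X.2) (Set.Icc 0 T ×ˢ univ))
    (hs : ∀ X ∈ Set.Ioo 0 T ×ˢ (univ : Set (Sp d)), ∃ N ∈ 𝓝 X, ∀ᶠ n in atTop, IsSol N c (u n))
    (hcau : ∀ R, ∀ ε > 0, ∃ n₀, ∀ n ≥ n₀, ∀ m ≥ n₀, ∀ t ∈ Set.Icc 0 T, ∀ x, qw x ≤ R →
      |u n t x - u m t x| ≤ ε) :
    ∃ v : ℝ → Sp d → ℝ, ContinuousOn (fun X : ℝ × Sp d => v X.1 X.2) (Set.Icc 0 T ×ˢ univ) ∧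
      IsSol (Set.Ioo 0 T ×ˢ univ) c v ∧
      ∀ t ∈ Set.Icc 0 T, ∀ x, Tendsto (fun n => u n t x) atTop (𝓝 (v t x)) := by
  have hlim (t : ℝ) (ht : t ∈ Set.Icc 0 T) (x : Sp d) :
      Tendsto (fun n => u n t x) atTop (𝓝 (limUnder atTop fun n => u n t x)) := by
    refine CauchySeq.tendsto_limUnder (Metric.cauchySeq_iff.2 fun ε hε => ?_)
    obtain ⟨n₀, h⟩ := hcau (qw x) (ε / 2) (half_pos hε)
    refine ⟨n₀, fun m hm n hn => ?_⟩
    rw [Real.dist_eq]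
    linarith [h m hm n hn t ht x le_rfl]
  refine ⟨fun t x => limUnder atTop fun n => u n t x, ?_, ?_, hlim⟩
  · intro X hX
    have hun : TendstoUniformlyOn (fun n (X : ℝ × Sp d) => u n X.1 X.2)
        (fun X => limUnder atTop fun n => u n X.1 X.2) atTop
        (Set.Icc 0 T ×ˢ {x | qw x < qw X.2 + 1}) := by
      refine Metric.tendstoUniformlyOn_iff.2 fun ε hε => ?_
      obtain ⟨n₀, h⟩ := hcau (qw X.2 + 1) (ε / 2) (half_pos hε)
      filter_upwards [eventually_ge_atTop n₀] with n hn Y hY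
      have h1 := (((hlim Y.1 hY.1 Y.2).sub_const (u n Y.1 Y.2)).abs)
      have h2 := le_of_tendsto h1 ((eventually_ge_atTop n₀).mono fun k hk =>
        h k hk n hn Y.1 hY.1 Y.2 (le_of_lt hY.2))
      rw [Real.dist_eq]
      linarith
    refine ((hun.continuousOn (Eventually.frequently (Eventually.of_forall fun n => (hu n).mono
      (Set.prod_mono_right (subset_univ _))))) X ⟨hX.1, lt_add_one (qw
        X.2)⟩).mono_of_mem_nhdsWithin ?_
    refine mem_nhdsWithin.2 ⟨univ ×ˢ {x | qw x < qw X.2 + 1}, isOpen_univ.prod (isOpen_qw_lt _),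
      ⟨trivial, lt_add_one (qw X.2)⟩, fun Y hY => ⟨hY.2.1, hY.1.2⟩⟩
  · refine IsSol.of_local fun X hX => ?_
    obtain ⟨N, hN, hsN⟩ := hs X hX
    obtain ⟨n₁, hn₁⟩ := eventually_atTop.1 hsN
    obtain ⟨α, hα0, hα1, hα⟩ := hc.hol X hX.1.1
    have hN' : N ∩ (Set.Ioo 0 T ×ˢ {x | qw x < qw X.2 + 1}) ∈ 𝓝 X :=
      inter_mem hN ((isOpen_Ioo.prod (isOpen_qw_lt _)).mem_nhds ⟨hX.1, lt_add_one (qw X.2)⟩)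
    refine IsSol.limit hα0 hα1 hc.symm hc.pd hX.1.1 hα hN' (u := fun n => u (n + n₁))
      (fun n => (hn₁ _ (Nat.le_add_left _ _)).mono inter_subset_left) (fun ε hε => ?_)
      fun Y hY => (hlim Y.1 (Ioo_subset_Icc_self hY.2.1) Y.2).comp (tendsto_add_atTop_nat n₁)
    obtain ⟨n₀, h⟩ := hcau (qw X.2 + 1) ε hε
    exact ⟨n₀, fun n hn m hm Y hY => h _ (by omega) _ (by omega) Y.1 (Ioo_subset_Icc_self hY.2.1) Y.2
      (le_of_lt hY.2.2)⟩

theorem bar_mono {l l' : ℝ} {m m' : ℕ} {t : ℝ} (hl : l ≤ l') (hm : m ≤ m') (ht : 0 ≤ t) (x : Sp d) :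
    bar l m t x ≤ bar l' m' t x := by
  have := qw_pos x
  refine mul_le_mul (Real.exp_le_exp.2 (by gcongr)) (pow_le_pow_right₀ (one_le_qw x) (by omega))
    (by positivity) (Real.exp_pos _).le

theorem Lop_const_mul (c : ℝ → Sp d → Fin d → Fin d → ℝ) (k : ℝ) (b2 : Fin d → Fin d → ℝ → Sp d → ℝ)
    (t : ℝ) (x : Sp d) : Lop c (fun i j t x => k * b2 i j t x) t x = k * Lop c b2 t x := by
  simp only [Lop, Finset.mul_sum]
  exact Finset.sum_congr rfl fun i _ => Finset.sum_congr rfl fun j _ => by ring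

theorem Coef.exists_cylinder_bound (d : ℕ) (K : ℝ) (m : ℕ) : ∃ l0 : ℝ, 0 ≤ l0 ∧ ∀ l, l0 ≤ l →
    ∀ c : ℝ → Sp d → Fin d → Fin d → ℝ, Coef K c → ∀ s T R δ : ℝ, 0 < δ → ∀ u : ℝ → Sp d → ℝ,
      IsSol (Set.Ioo s T ×ˢ {x | qw x < R}) c u →
      ContinuousOn (fun X : ℝ × Sp d => u X.1 X.2) (Set.Icc s T ×ˢ univ) →
      (∀ x, qw x ≤ R → |u s x| ≤ δ * bar l m s x) →
      (∀ t ∈ Set.Icc s T, ∀ x, qw x = R → |u t x| ≤ δ * bar l m t x) →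
      ∀ t ∈ Set.Icc s T, ∀ x, qw x < R → |u t x| ≤ δ * bar l m t x := by
  obtain ⟨l0, hl0, h⟩ := exists_barrier (d := d) K m
  refine ⟨l0, hl0, fun l hl c hc s T R δ hδ u hu huc h0 hR t ht x hx => ?_⟩
  obtain ⟨b1, b2, hb, hbl⟩ := h l hl
  refine abs_le_of_cylinder (c := c) (s := s) (T := T) (lam := 0) le_rfl (isOpen_qw_lt R)
    (isCompact_closure_qw_lt R) (fun t _ x _ => hc.symm t x) (fun t _ x _ => hc.psd t x) hu.jet
    ((hb _).smul δ) (huc.mono (Set.prod_mono_right (subset_univ _)))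
    (((continuous_bar l m).const_mul δ).continuousOn) (fun t ht x hx => ?_)
    (fun x hx => h0 x (closure_qw_lt_subset R hx)) (fun t ht x hx => hR t ht x (frontier_qw_lt hx))
    t ht x (subset_closure hx)
  rw [hu.eq t x ⟨ht, hx⟩, Lop_const_mul]
  have := hbl c t x (hc.growth t x)
  simp only [zero_mul, add_zero, sub_self, abs_zero]
  nlinarith

/-- Solvability of the Cauchy problem for smooth compactly supported data. -/
theorem Coef.exists_of_smooth {K : ℝ} {c : ℝ → Sp d → Fin d → Fin d → ℝ} (hc : Coef K c)
    {f : Sp d → ℝ} (hf : ContDiff ℝ 3 f) (hs : HasCompactSupport f) {T : ℝ} (hT : 0 < T) :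
    ∃ (v : ℝ → Sp d → ℝ) (C l : ℝ), 0 ≤ C ∧
      ContinuousOn (fun X : ℝ × Sp d => v X.1 X.2) (Set.Icc 0 T ×ˢ univ) ∧
      IsSol (Set.Ioo 0 T ×ˢ univ) c v ∧
      ∀ t ∈ Set.Icc 0 T, ∀ x, |v t x - f x| ≤ C * (t * bar l 0 t x) := by
  obtain ⟨C, l, hC, hl, hsol⟩ := hc.exists_approx_solution hf hs T
  obtain ⟨l0, hl0, hcyl⟩ := exists_cylinder_bound d K 1
  obtain ⟨L, hL⟩ : ∃ L, L = max l l0 := ⟨_, rfl⟩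
  have hlL : l ≤ L := hL ▸ le_max_left _ _
  have hL0 : 0 ≤ L := hl.trans hlL
  obtain ⟨ρ, hρ⟩ : ∃ ρ : ℕ → ℝ, ρ = fun n : ℕ => (n : ℝ) + 2 := ⟨_, rfl⟩
  have hρ0 (n) : 0 < ρ n := by simp only [hρ]; positivity
  have hρm {n m : ℕ} (h : n ≤ m) : ρ n ≤ ρ m := by simp only [hρ]; gcongr
  have hρt : Tendsto ρ atTop atTop := by
    rw [hρ]; exact tendsto_atTop_add_const_right _ _ tendsto_natCast_atTop_atTop
  choose u huc hus hub using fun n : ℕ => hsol (Set.Icc (1 / ρ n) T ×ˢ {x | qw x ≤ ρ n})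
    (isCompact_Icc.prod (isCompact_qw_le _)) fun X hX => (one_div_pos.2 (hρ0 n)).trans_le hX.1.1
  have hB {n m : ℕ} (h : n ≤ m) : IsSol (Set.Ioo (1 / ρ n) T ×ˢ {x | qw x < ρ n}) c (u m) := by
    refine (hus m).mono (interior_maximal ?_ (isOpen_Ioo.prod (isOpen_qw_lt _)))
    exact Set.prod_mono (Ioo_subset_Icc_self.trans (Set.Icc_subset_Icc_left
      (one_div_le_one_div_of_le (hρ0 n) (hρm h)))) fun x (hx : qw x < _) => hx.le.trans (hρm h)
  have hdiff {n m : ℕ} (t) (ht : t ∈ Set.Icc 0 T) (x) :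
      |u n t x - u m t x| ≤ 2 * C * t * bar l 0 t x := by
    have e : u n t x - u m t x = (u n t x - f x) - (u m t x - f x) := by ring
    rw [e]
    refine (abs_sub _ _).trans ?_
    linarith [hub n t ht x, hub m t ht x]
  obtain ⟨δ, hδ⟩ : ∃ δ : ℕ → ℝ, δ = fun n => 2 * (C + 1) * (1 + T) / ρ n := ⟨_, rfl⟩
  have hδ0 (n) : 0 < δ n := by
    have := hρ0 n
    simp only [hδ]; positivity
  have hδt : Tendsto δ atTop (𝓝 0) := by
    rw [hδ]; exact hρt.const_div_atTop _
  have hsmall {n m : ℕ} (t) (ht : t ∈ Set.Icc 0 T) (x) (h : t ≤ 1 / ρ n) :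
      |u n t x - u m t x| ≤ δ n * bar L 1 t x := by
    refine (hdiff t ht x).trans (mul_le_mul ?_ (bar_mono hlL (by omega) ht.1 x) (bar_pos _ _ _ _).le
      (hδ0 n).le)
    have : δ n = 2 * (C + 1) * (1 + T) * (1 / ρ n) := by simp only [hδ]; ring
    rw [this]
    have h1 : 0 ≤ 1 / ρ n := (one_div_pos.2 (hρ0 n)).le
    nlinarith [mul_nonneg hC (sub_nonneg.2 h), mul_nonneg (mul_nonneg hC hT.le) h1,
      mul_nonneg hT.le h1]
  have hcmp {n m : ℕ} (h : n ≤ m) (t) (ht : t ∈ Set.Icc 0 T) (x) (hx : qw x < ρ n) :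
      |u n t x - u m t x| ≤ δ n * bar L 1 t x := by
    rcases le_or_gt t (1 / ρ n) with hts | hts
    · exact hsmall t ht x hts
    have hn0 : 0 ≤ 1 / ρ n := (one_div_pos.2 (hρ0 n)).le
    refine hcyl L (hL ▸ le_max_right _ _) c hc (1 / ρ n) T (ρ n) (δ n) (hδ0 n)
      (fun t x => u n t x - u m t x) ((hB le_rfl).sub (hB h) (isOpen_Ioo.prod (isOpen_qw_lt _)))
      ((huc n).sub (huc m)).continuousOn (fun x _ => hsmall _ ⟨hn0, hts.le.trans ht.2⟩ x le_rfl)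
      (fun t ht x hx => (hdiff t ⟨hn0.trans ht.1, ht.2⟩ x).trans ?_) t ⟨hts.le, ht.2⟩ x hx
    have ht0 : 0 ≤ t := hn0.trans ht.1
    have e : δ n * bar L 1 t x = 2 * (C + 1) * (1 + T) * bar L 0 t x := by
      have := (hρ0 n).ne'
      simp only [hδ, bar, hx]
      field_simp
      ring
    rw [e]
    refine mul_le_mul ?_ (bar_mono hlL le_rfl ht0 x) (bar_pos _ _ _ _).le (by positivity)
    nlinarith [mul_nonneg hC (sub_nonneg.2 ht.2)]
  have hcau (R ε : ℝ) (hε : 0 < ε) : ∃ n₀, ∀ n ≥ n₀, ∀ m ≥ n, ∀ t ∈ Set.Icc 0 T, ∀ x, qw x ≤ R →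
      |u n t x - u m t x| ≤ ε := by
    obtain ⟨M, hM⟩ : ∃ M, M = Real.exp (L * T) * |R| ^ 3 := ⟨_, rfl⟩
    have h1 : Tendsto (fun n => δ n * M) atTop (𝓝 0) := by simpa using hδt.mul_const M
    obtain ⟨n₀, h⟩ := eventually_atTop.1 ((h1.eventually (gt_mem_nhds hε)).and
      (hρt.eventually_gt_atTop R))
    refine ⟨n₀, fun n hn m hm t ht x hx => ?_⟩
    refine (hcmp hm t ht x (hx.trans_lt (h n hn).2)).trans (le_trans ?_ (h n hn).1.le)
    refine mul_le_mul_of_nonneg_left ?_ (hδ0 n).le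
    rw [hM]
    exact mul_le_mul (Real.exp_le_exp.2 (mul_le_mul_of_nonneg_left ht.2 hL0))
      (pow_le_pow_left₀ (qw_pos x).le (hx.trans (le_abs_self R)) _) (pow_pos (qw_pos x) _).le
      (Real.exp_pos _).le
  have hloc : ∀ X ∈ Set.Ioo 0 T ×ˢ (univ : Set (Sp d)), ∃ N ∈ 𝓝 X, ∀ᶠ n in atTop,
      IsSol N c (u n) := by
    intro X hX
    have hX1 : 0 < X.1 := hX.1.1
    refine ⟨Set.Ioo (X.1 / 2) T ×ˢ {x | qw x < qw X.2 + 1}, (isOpen_Ioo.prod (isOpen_qw_lt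
        _)).mem_nhds
      ⟨⟨by linarith, hX.1.2⟩, lt_add_one (qw X.2)⟩, ?_⟩
    filter_upwards [hρt.eventually_ge_atTop (qw X.2 + 1), hρt.eventually_ge_atTop (2 / X.1)]
      with n h1 h2
    refine (hB (le_refl n)).mono (Set.prod_mono (Set.Ioo_subset_Ioo_left ?_) fun x hx =>
      lt_of_lt_of_le hx h1)
    rw [div_le_iff₀ (hρ0 n)]
    rw [div_le_iff₀ hX1] at h2
    linarith
  have hcau' (R ε : ℝ) (hε : 0 < ε) : ∃ n₀, ∀ n ≥ n₀, ∀ m ≥ n₀, ∀ t ∈ Set.Icc 0 T, ∀ x,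
      qw x ≤ R → |u n t x - u m t x| ≤ ε := by
    obtain ⟨n₀, h⟩ := hcau R ε hε
    refine ⟨n₀, fun n hn m hm t ht x hx => ?_⟩
    rcases le_total n m with hnm | hnm
    · exact h n hn m hnm t ht x hx
    · rw [abs_sub_comm]; exact h m hm n hnm t ht x hx
  obtain ⟨v, hvc, hvs, hvl⟩ := hc.exists_limit (T := T) (u := u) (fun n => (huc n).continuousOn)
    hloc hcau'
  refine ⟨v, C, l, hC, hvc, hvs, fun t ht x => ?_⟩
  exact le_of_tendsto (((hvl t ht x).sub_const (f x)).abs) (Eventually.of_forall fun n =>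
    hub n t ht x)

theorem bar_le {l : ℝ} (hl : 0 ≤ l) (m : ℕ) {t T : ℝ} (ht : t ≤ T) (x : Sp d) :
    bar l m t x ≤ Real.exp (l * T) * qw x ^ (m + 2) :=
  mul_le_mul_of_nonneg_right (Real.exp_le_exp.2 (mul_le_mul_of_nonneg_left ht hl))
    (pow_pos (qw_pos x) _).le

/-- A priori bound for solutions of polynomial growth in terms of their initial values. -/
theorem Coef.exists_bound (d : ℕ) (K : ℝ) (m : ℕ) : ∃ l : ℝ, 0 ≤ l ∧
    ∀ c : ℝ → Sp d → Fin d → Fin d → ℝ, Coef K c → ∀ (T B C : ℝ) (m' : ℕ) (u : ℝ → Sp d → ℝ),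
      0 ≤ B → IsSol (Set.Ioo 0 T ×ˢ univ) c u →
      ContinuousOn (fun X : ℝ × Sp d => u X.1 X.2) (Set.Icc 0 T ×ˢ univ) →
      (∀ t ∈ Set.Icc 0 T, ∀ x, |u t x| ≤ C * qw x ^ m') → (∀ x, |u 0 x| ≤ B * qw x ^ (m + 2)) →
      ∀ t ∈ Set.Icc 0 T, ∀ x, |u t x| ≤ B * bar l m t x := by
  obtain ⟨l, hl0, h⟩ := exists_barrier (d := d) K m
  obtain ⟨b1, b2, hb, hbl⟩ := h l le_rfl
  refine ⟨l, hl0, fun c hc T B C m' u hB hu huc hg h0 => ?_⟩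
  refine abs_le_of_growth (c := c) (lam := 0) le_rfl (fun t _ x => hc.symm t x)
    (fun t _ x => hc.psd t x) (fun t _ x => hc.growth t x) hu.jet ((hb _).smul B) huc
    ((continuous_bar l m).const_mul B).continuousOn
    (fun t _ x => mul_nonneg hB (bar_pos _ _ _ _).le) hg (fun t ht x => ?_) fun x => ?_
  · rw [hu.eq t x ⟨ht, trivial⟩, Lop_const_mul]
    have := hbl c t x (hc.growth t x)
    simp only [zero_mul, add_zero, sub_self, abs_zero]
    nlinarith
  · simpa [bar] using h0 x

theorem exists_smooth_approx {f : Sp d → ℝ} (hf : Continuous f) {F : ℝ} {m : ℕ}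
    (hF : ∀ x, |f x| ≤ F * qw x ^ m) {ε : ℝ} (hε : 0 < ε) :
    ∃ g : Sp d → ℝ, ContDiff ℝ 3 g ∧ HasCompactSupport g ∧
      ∀ x, |g x - f x| ≤ (1 + F) * ε * qw x ^ (m + 2) := by
  have hF0 : 0 ≤ F := by
    by_contra hn
    have := hF 0
    have h1 := pow_pos (qw_pos (0 : Sp d)) m
    nlinarith [abs_nonneg (f 0)]
  obtain ⟨g, hg, hgf⟩ := hf.exists_contDiff_approx 3 (ε := fun _ => ε) continuous_const fun _ => hε
  obtain ⟨χ, hχ, hχs, -, h01, V, -, hSV, hV⟩ := exists_bump (isCompact_qw_le (d := d) (1 / ε))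
    isOpen_univ (Set.subset_univ _)
  refine ⟨fun x => χ x * g x, hχ.mul hg, hχs.mul_right, fun x => ?_⟩
  have h1 := one_le_qw x
  have e : χ x * g x - f x = χ x * (g x - f x) - (1 - χ x) * f x := by ring
  have h2 : |χ x * (g x - f x)| ≤ ε * qw x ^ (m + 2) := by
    rw [abs_mul, abs_of_nonneg (h01 x).1]
    have h3 : |g x - f x| ≤ ε := (hgf.1 x).le
    calc χ x * |g x - f x| ≤ 1 * ε := mul_le_mul (h01 x).2 h3 (abs_nonneg _) zero_le_one
      _ ≤ ε * qw x ^ (m + 2) := by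
        rw [one_mul]; exact le_mul_of_one_le_right hε.le (one_le_pow₀ h1)
  have h4 : |(1 - χ x) * f x| ≤ F * ε * qw x ^ (m + 2) := by
    rcases le_or_gt (qw x) (1 / ε) with hx | hx
    · rw [hV x (hSV hx), sub_self, zero_mul, abs_zero]; positivity
    · rw [div_lt_iff₀ hε] at hx
      rw [abs_mul, abs_of_nonneg (sub_nonneg.2 (h01 x).2)]
      have h5 : (1 - χ x) * |f x| ≤ 1 * (F * qw x ^ m) :=
        mul_le_mul (by linarith [(h01 x).1]) (hF x) (abs_nonneg _) zero_le_one
      have h6 : 1 ≤ ε * qw x ^ 2 := by nlinarith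
      have h7 : 0 ≤ F * qw x ^ m := by positivity
      calc (1 - χ x) * |f x| ≤ (F * qw x ^ m) * 1 := by linarith
        _ ≤ (F * qw x ^ m) * (ε * qw x ^ 2) := mul_le_mul_of_nonneg_left h6 h7
        _ = F * ε * qw x ^ (m + 2) := by ring
  rw [e]
  refine (abs_sub _ _).trans ?_
  linarith

/-- Solvability of the Cauchy problem for continuous data of polynomial growth. -/
theorem Coef.exists_cauchy {K : ℝ} {c : ℝ → Sp d → Fin d → Fin d → ℝ} (hc : Coef K c)
    {f : Sp d → ℝ} (hf : Continuous f) {F : ℝ} {m : ℕ} (hF : ∀ x, |f x| ≤ F * qw x ^ m)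
    {T : ℝ} (hT : 0 < T) :
    ∃ v : ℝ → Sp d → ℝ, ContinuousOn (fun X : ℝ × Sp d => v X.1 X.2) (Set.Icc 0 T ×ˢ univ) ∧
      IsSol (Set.Ioo 0 T ×ˢ univ) c v ∧ (∀ x, v 0 x = f x) ∧
      ∃ (C : ℝ) (k : ℕ), 0 ≤ C ∧ ∀ t ∈ Set.Icc 0 T, ∀ x, |v t x| ≤ C * qw x ^ k := by
  have hF0 : 0 ≤ F := by
    by_contra hn
    have := hF 0
    have h1 := pow_pos (qw_pos (0 : Sp d)) m
    nlinarith [abs_nonneg (f 0)]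
  obtain ⟨l, hl, hbd⟩ := exists_bound d K m
  choose g hg hgs hgf using fun n : ℕ => exists_smooth_approx hf hF (ε := 1 / ((n : ℝ) + 1))
    (by positivity)
  obtain ⟨ε, hε⟩ : ∃ ε : ℕ → ℝ, ε = fun n : ℕ => (1 + F) * (1 / ((n : ℝ) + 1)) := ⟨_, rfl⟩
  have hε0 (n) : 0 ≤ ε n := by simp only [hε]; positivity
  have hε1 (n) : ε n ≤ 1 + F := by
    simp only [hε]
    refine mul_le_of_le_one_right (by positivity) ?_
    rw [div_le_one (by positivity)]
    linarith [n.cast_nonneg (α := ℝ)]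
  have hεt : Tendsto ε atTop (𝓝 0) := by
    rw [hε]; simpa using tendsto_one_div_add_atTop_nhds_zero_nat.const_mul (1 + F)
  have hgε (n x) : |g n x - f x| ≤ ε n * qw x ^ (m + 2) := by simpa only [hε] using hgf n x
  have hgb (n x) : |g n x| ≤ (1 + 2 * F) * qw x ^ (m + 2) := by
    have h1 := hgε n x
    have h2 := mul_le_mul_of_nonneg_right (hε1 n) (pow_pos (qw_pos x) (m + 2)).le
    have h3 := (hF x).trans (mul_le_mul_of_nonneg_left
      (pow_le_pow_right₀ (one_le_qw x) (by omega : m ≤ m + 2)) hF0)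
    have e : g n x = (g n x - f x) + f x := by ring
    rw [e]
    refine (abs_add_le _ _).trans ?_
    linarith
  choose u C l' hC huc hus hub using fun n => hc.exists_of_smooth (hg n) (hgs n) hT
  have hu0 (n x) : u n 0 x = g n x := by
    have := hub n 0 ⟨le_rfl, hT.le⟩ x
    rw [zero_mul, mul_zero] at this
    exact sub_eq_zero.1 (abs_nonpos_iff.1 this)
  have hgr (n) : ∃ A, ∀ t ∈ Set.Icc 0 T, ∀ x, |u n t x| ≤ A * qw x ^ (m + 2) := by
    refine ⟨C n * (T * Real.exp (|l' n| * T)) + (1 + 2 * F), fun t ht x => ?_⟩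
    have h1 := hub n t ht x
    have h2 : bar (l' n) 0 t x ≤ Real.exp (|l' n| * T) * qw x ^ (m + 2) :=
      (bar_mono (le_abs_self _) (Nat.zero_le m) ht.1 x).trans (bar_le (abs_nonneg _) m ht.2 x)
    have h3 : C n * (t * bar (l' n) 0 t x) ≤
        C n * (T * (Real.exp (|l' n| * T) * qw x ^ (m + 2))) :=
      mul_le_mul_of_nonneg_left (mul_le_mul ht.2 h2 (bar_pos _ _ _ _).le hT.le) (hC n)
    have e : u n t x = (u n t x - g n x) + g n x := by ring
    rw [e]
    refine (abs_add_le _ _).trans ?_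
    linarith [hgb n x]
  choose A hA using hgr
  have hdiff (n k t) (ht : t ∈ Set.Icc 0 T) (x) :
      |u n t x - u k t x| ≤ (ε n + ε k) * bar l m t x := by
    refine hbd c hc T (ε n + ε k) (A n + A k) (m + 2) (fun t x => u n t x - u k t x)
      (add_nonneg (hε0 n) (hε0 k)) ((hus n).sub (hus k) (isOpen_Ioo.prod isOpen_univ))
      ((huc n).sub (huc k)) (fun t ht x => ?_) (fun x => ?_) t ht x
    · refine (abs_sub _ _).trans ?_
      linarith [hA n t ht x, hA k t ht x]
    · have e : u n 0 x - u k 0 x = (g n x - f x) - (g k x - f x) := by rw [hu0, hu0]; ring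
      rw [e]
      refine (abs_sub _ _).trans ?_
      linarith [hgε n x, hgε k x]
  obtain ⟨v, hvc, hvs, hvl⟩ := hc.exists_limit (T := T) (u := u) huc
    (fun X hX => ⟨_, (isOpen_Ioo.prod isOpen_univ).mem_nhds hX, Eventually.of_forall hus⟩)
    fun R δ hδ => by
      obtain ⟨M, hM⟩ : ∃ M, M = Real.exp (l * T) * |R| ^ (m + 2) := ⟨_, rfl⟩
      have h1 : Tendsto (fun n => ε n * M) atTop (𝓝 0) := by simpa using hεt.mul_const M
      obtain ⟨n₀, h⟩ := eventually_atTop.1 (h1.eventually (gt_mem_nhds (half_pos hδ)))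
      refine ⟨n₀, fun n hn k hk t ht x hx => (hdiff n k t ht x).trans ?_⟩
      have h2 : bar l m t x ≤ M := by
        rw [hM]
        exact (bar_le hl m ht.2 x).trans (mul_le_mul_of_nonneg_left
          (pow_le_pow_left₀ (qw_pos x).le (hx.trans (le_abs_self R)) _) (Real.exp_pos _).le)
      have h3 := mul_le_mul_of_nonneg_left h2 (add_nonneg (hε0 n) (hε0 k))
      linarith [h n hn, h k hk]
  refine ⟨v, hvc, hvs, fun x => ?_, (1 + 2 * F) * Real.exp (l * T), m + 2, by positivity,
    fun t ht x => le_of_tendsto (hvl t ht x).abs (Eventually.of_forall fun n => ?_)⟩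
  · refine tendsto_nhds_unique (hvl 0 ⟨le_rfl, hT.le⟩ x) ?_
    simp only [hu0]
    refine tendsto_iff_norm_sub_tendsto_zero.2 (squeeze_zero (fun _ => norm_nonneg _)
      (fun n => hgε n x) ?_)
    simpa using hεt.mul_const (qw x ^ (m + 2))
  · refine (hbd c hc T (1 + 2 * F) (A n) (m + 2) (u n) (by positivity) (hus n) (huc n) (hA n)
      (fun x => by rw [hu0]; exact hgb n x) t ht x).trans ?_
    rw [mul_assoc]
    exact mul_le_mul_of_nonneg_left (bar_le hl m ht.2 x) (by positivity)

theorem IsSol.differentiableAt {O : Set (ℝ × Sp d)} (hO : IsOpen O)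
    {c : ℝ → Sp d → Fin d → Fin d → ℝ} {u : ℝ → Sp d → ℝ} (hu : IsSol O c u) {X : ℝ × Sp d}
    (hX : X ∈ O) : DifferentiableAt ℝ (fun X : ℝ × Sp d => u X.1 X.2) X := by
  have hN := hO.mem_nhds hX
  refine (hasStrictFDerivAt_uncurry_coprod (𝕜 := ℝ) (u := X) (f := u)
    (f₁ := fun t x => ContinuousLinearMap.toSpanSingleton ℝ (deriv (fun τ => u τ x) t))
    (f₂ := fun t x => lin fun i => pd1 (u t) i x)
    (eventually_of_mem hN fun Y hY => (hu.jet.dt Y.1 Y.2 hY).hasFDerivAt)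
    (eventually_of_mem hN fun Y hY => hu.jet.dx Y.1 Y.2 hY) ?_ ?_).hasFDerivAt.differentiableAt
  · exact ((ContinuousLinearMap.toSpanSingletonCLE (𝕜 := ℝ) (E := ℝ)).continuous.continuousAt).comp
      (hu.contt.continuousAt hN)
  · exact (continuous_lin (X := Sp d) (c := id) fun i => continuous_apply i).continuousAt.comp
      (continuousAt_pi.2 fun i => (hu.cont1 i).continuousAt hN)

/-- Admissible volatilities for the backward problem on `[0, T]`. -/
structure Vol (T K : ℝ) (a : ℝ → Sp d → Fin d → Fin d → ℝ) : Prop where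
  symm : ∀ t ∈ Set.Icc 0 T, ∀ x i j, a t x i j = a t x j i
  pd : ∀ t ∈ Set.Icc 0 T, ∀ x, ∀ y : Sp d, y ≠ 0 → 0 < ∑ i, ∑ j, a t x i j * y i * y j
  growth : ∀ t ∈ Set.Icc 0 T, ∀ x i j, |a t x i j| ≤ K * qw x
  hol : ∀ i j, LocallyHolderOn (fun X : ℝ × Sp d => a X.1 X.2 i j) (Set.Ico 0 T ×ˢ univ)

theorem Vol.coef {T K r : ℝ} {a : ℝ → Sp d → Fin d → Fin d → ℝ} (ha : Vol T K a) (hr0 : 0 < r)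
    (hr : r ≤ T) : Coef K fun t x => a (max 0 (r - max t 0)) x := by
  have hmem (t : ℝ) : max 0 (r - max t 0) ∈ Set.Icc 0 T :=
    ⟨le_max_left _ _, max_le (hr0.le.trans hr) (by linarith [le_max_right t 0])⟩
  refine ⟨fun t => ha.symm _ (hmem t), fun t => ha.pd _ (hmem t), fun t => ha.growth _ (hmem t),
    fun X hX => ?_⟩
  obtain ⟨φ, hφ⟩ : ∃ φ : ℝ × Sp d → ℝ × Sp d, φ = fun X => (max 0 (r - max X.1 0), X.2) := ⟨_, rfl⟩
  have hφl (X Y : ℝ × Sp d) : dist (φ X) (φ Y) ≤ dist X Y := by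
    rw [hφ, Prod.dist_eq, Prod.dist_eq]
    refine max_le_max_right _ ?_
    simp only [Real.dist_eq]
    refine (abs_max_sub_max_le_max _ _ _ _).trans (max_le (by simp) ?_)
    rw [sub_sub_sub_cancel_left, abs_sub_comm]
    exact (abs_max_sub_max_le_max _ _ _ _).trans (max_le le_rfl (by simp))
  have hφc : Continuous φ := by rw [hφ]; fun_prop
  have hφm (Y : ℝ × Sp d) (hY : 0 < Y.1) : φ Y ∈ Set.Ico 0 T ×ˢ (univ : Set (Sp d)) := by
    rw [hφ]
    refine ⟨⟨le_max_left _ _, max_lt (hr0.trans_le hr) ?_⟩, trivial⟩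
    have := hY.trans_le (le_max_left Y.1 0)
    linarith
  choose U hU α C hα0 hα1 hC hUh using fun i j => ha.hol i j (φ X) (hφm X hX)
  have hα : ∃ α' : ℝ, 0 < α' ∧ α' ≤ 1 ∧ ∀ i j, α' ≤ α i j := by
    have h1 : ∀ᶠ y in 𝓝[>] (0 : ℝ), ∀ i j, y ≤ α i j :=
      eventually_all.2 fun i => eventually_all.2 fun j =>
        nhdsWithin_le_nhds (eventually_le_nhds (hα0 i j))
    have h2 : ∀ᶠ y in 𝓝[>] (0 : ℝ), y ≤ 1 := nhdsWithin_le_nhds (eventually_le_nhds one_pos)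
    obtain ⟨y, hy, hy1, hy0⟩ := (h1.and (h2.and eventually_mem_nhdsWithin)).exists
    exact ⟨y, hy0, hy1, hy⟩
  obtain ⟨α', hα'0, hα'1, hα'⟩ := hα
  have hC' : ∃ C', 0 ≤ C' ∧ ∀ i j, C i j ≤ C' := by
    have h1 : ∀ᶠ y in atTop, ∀ i j, C i j ≤ y :=
      eventually_all.2 fun i => eventually_all.2 fun j => eventually_ge_atTop _
    obtain ⟨y, hy⟩ := (h1.and (eventually_ge_atTop 0)).exists
    exact ⟨y, hy.2, hy.1⟩
  obtain ⟨C', hC'0, hC'⟩ := hC'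
  have hW : ∀ᶠ Y in 𝓝 X, ∀ i j, φ Y ∈ U i j := by
    refine eventually_all.2 fun i => eventually_all.2 fun j => ?_
    have h1 : Tendsto φ (𝓝 X) (𝓝[Set.Ico 0 T ×ˢ Set.univ] (φ X)) :=
      tendsto_nhdsWithin_iff.2 ⟨hφc.tendsto X,
        (continuous_fst.tendsto X |>.eventually (lt_mem_nhds hX)).mono hφm⟩
    exact h1 (hU i j)
  refine ⟨α', hα'0, hα'1, _, inter_mem hW (Metric.ball_mem_nhds X one_half_pos), C', hC'0,
    fun i j q hq q' hq' => ?_⟩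
  have h1 := hUh i j (φ q) (hq.1 i j) (φ q') (hq'.1 i j)
  have hd : dist q q' ≤ 1 := by
    have := dist_triangle_right q q' X
    have h2 := Metric.mem_ball.1 hq.2
    have h3 := Metric.mem_ball.1 hq'.2
    linarith
  have e : |a (φ q).1 (φ q).2 i j - a (φ q').1 (φ q').2 i j| ≤ C' * dist q q' ^ α' := by
    refine h1.trans (mul_le_mul (hC' i j) ?_ (by positivity) hC'0)
    refine (Real.rpow_le_rpow dist_nonneg (hφl q q') (hα0 i j).le).trans ?_
    exact Real.rpow_le_rpow_of_exponent_ge_of_imp dist_nonneg hd (hα' i j)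
      fun _ h => absurd h (hα0 i j).ne'
  simpa only [hφ] using e

/-- `w` is a classical solution of polynomial growth of the backward equation on `[s, r]` with
terminal value `f`. -/
def IsTVP (a : ℝ → Sp d → Fin d → Fin d → ℝ) (s r : ℝ) (f : Sp d → ℝ) (w : ℝ → Sp d → ℝ) : Prop :=
  ContinuousOn (fun pr : ℝ × (Fin d → ℝ) => w pr.1 pr.2)
      (Set.Icc s r ×ˢ (Set.univ : Set (Fin d → ℝ))) ∧
    IsC12 (Set.Ico s r) (Set.univ : Set (Fin d → ℝ)) w ∧
    (∀ τ ∈ Set.Ico s r, ∀ x : Fin d → ℝ,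
      tderiv (Set.Icc s r) w τ x
        + (1 / 2) * ∑ i, ∑ j, a τ x i j * pd2 (w τ) i j x = 0) ∧
    (∀ x : Fin d → ℝ, w r x = f x) ∧
    (∃ C q : ℝ, 0 < C ∧ 0 < q ∧ ∀ τ ∈ Set.Icc s r, ∀ x : Fin d → ℝ,
      |w τ x| ≤ C * (1 + ‖x‖ ^ q))

theorem norm_le_qw (x : Sp d) : ‖x‖ ≤ qw x := by
  nlinarith [norm_sq_le_qw x, sq_nonneg (‖x‖ - 1), sq_nonneg ‖x‖]

theorem rpow_growth_le {C q : ℝ} (hC : 0 ≤ C) (hq : 0 ≤ q) {m : ℕ} (hm : q ≤ m) (x : Sp d) :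
    C * (1 + ‖x‖ ^ q) ≤ 2 * C * qw x ^ m := by
  have h1 : ‖x‖ ^ q ≤ qw x ^ m := by
    rw [← Real.rpow_natCast]
    exact (Real.rpow_le_rpow (norm_nonneg _) (norm_le_qw x) hq).trans
      (Real.rpow_le_rpow_of_exponent_le (one_le_qw x) hm)
  have h2 : 1 ≤ qw x ^ m := one_le_pow₀ (one_le_qw x)
  nlinarith

theorem exists_rpow_growth {C : ℝ} (hC : 0 ≤ C) (m : ℕ) :
    ∃ C' q : ℝ, 0 < C' ∧ 0 < q ∧ ∀ x : Sp d, C * qw x ^ m ≤ C' * (1 + ‖x‖ ^ q) := by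
  refine ⟨(C + 1) * ((d + 1) ^ (m + 1) * 2 ^ (m + 1)), (2 * (m + 1) : ℕ), by positivity,
    by positivity, fun x => ?_⟩
  rw [Real.rpow_natCast, pow_mul]
  have h1 : qw x ^ m ≤ qw x ^ (m + 1) := pow_le_pow_right₀ (one_le_qw x) (Nat.le_succ m)
  have h2 : qw x ^ (m + 1) ≤ (d + 1) ^ (m + 1) * (1 + ‖x‖ ^ 2) ^ (m + 1) := by
    rw [← mul_pow]
    exact pow_le_pow_left₀ (qw_pos x).le (qw_le x) _
  have h3 : (1 + ‖x‖ ^ 2) ^ (m + 1) ≤ 2 ^ (m + 1) * (1 + (‖x‖ ^ 2) ^ (m + 1)) := by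
    refine (add_pow_le (zero_le_one' ℝ) (sq_nonneg ‖x‖) (m + 1)).trans ?_
    rw [one_pow]
    gcongr
    · norm_num
    · simp
  calc C * qw x ^ m ≤ (C + 1) * qw x ^ m := by
        have := pow_pos (qw_pos x) m
        nlinarith
    _ ≤ (C + 1) * ((d + 1) ^ (m + 1) * (2 ^ (m + 1) * (1 + (‖x‖ ^ 2) ^ (m + 1)))) := by
        gcongr
        exact h1.trans (h2.trans (by gcongr))
    _ = _ := by ring

theorem IsTVP.reverse {a : ℝ → Sp d → Fin d → Fin d → ℝ} {s r : ℝ} {f : Sp d → ℝ}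
    {w : ℝ → Sp d → ℝ} (hs : 0 ≤ s) (hw : IsTVP a s r f w) :
    IsSol (Set.Ioo 0 (r - s) ×ˢ univ) (fun t x => a (max 0 (r - max t 0)) x)
      fun t x => w (r - t) x := by
  obtain ⟨-, hw, hpde, -⟩ := hw
  obtain ⟨gt, gx, gxx, hgt, hgx, hgxx, hg⟩ := hw.derivs_extend
  have hi : interior (Set.Ico s r) = Set.Ioo s r := interior_Ico
  have hdiff := hw.diff
  have hdiff2 := hw.diff2
  rw [hi] at hg hdiff hdiff2
  have hmem {t : ℝ} {x : Sp d} (h : (t, x) ∈ Set.Ioo 0 (r - s) ×ˢ (univ : Set (Sp d))) :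
      r - t ∈ Set.Ioo s r := ⟨by linarith [h.1.2], by linarith [h.1.1]⟩
  have hmap : MapsTo (fun X : ℝ × Sp d => (r - X.1, X.2)) (Set.Ioo 0 (r - s) ×ˢ univ)
      (Set.Ico s r ×ˢ univ) := fun X hX => ⟨Set.Ioo_subset_Ico_self (hmem (x := X.2) hX), trivial⟩
  have hcm : ContinuousOn (fun X : ℝ × Sp d => (r - X.1, X.2)) (Set.Ioo 0 (r - s) ×ˢ univ) := by
    fun_prop
  have hdt (t : ℝ) (x : Sp d) (h : t ∈ Set.Ioo s r) :
      HasDerivAt (fun τ => w τ x) (deriv (fun τ => w τ x) t) t := by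
    have h1 : DifferentiableAt ℝ (fun τ : ℝ => (τ, x)) t := by fun_prop
    exact (DifferentiableAt.comp t (hdiff t h x trivial) h1).hasDerivAt
  have hj : Jet (Set.Ioo 0 (r - s) ×ˢ univ) (fun t x => w (r - t) x)
      (fun t x => -deriv (fun τ => w τ x) (r - t)) (fun i t x => pd1 (w (r - t)) i x)
      fun i j t x => pd2 (w (r - t)) i j x := by
    refine ⟨fun t x h => ?_, fun t x h => ?_, fun j t x h => ?_⟩
    · exact (hdt _ x (hmem h)).comp_const_sub r t
    · have h1 : DifferentiableAt ℝ (fun y : Sp d => (r - t, y)) x := by fun_prop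
      have h2 := (DifferentiableAt.comp x (hdiff _ (hmem h) x trivial) h1).hasFDerivAt
      convert! h2 using 1
      exact (lin_eq_of_apply_single _).symm
    · have h2 := (hdiff2 _ (hmem h) x trivial j).hasFDerivAt
      convert! h2 using 1
      exact (lin_eq_of_apply_single _).symm
  refine hj.isSol (isOpen_Ioo.prod isOpen_univ) (hw.cont.comp hcm hmap) ?_ (fun i => ?_)
    (fun i j => ?_) fun t x h => ?_
  · exact (hgt.comp hcm hmap).neg.congr fun X hX =>
      congrArg Neg.neg (hg _ (hmem (x := X.2) hX) X.2 trivial).1.symm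
  · exact ((hgx i).comp hcm hmap).congr fun X hX =>
      ((hg _ (hmem (x := X.2) hX) X.2 trivial).2.1 i).symm
  · exact ((hgxx i j).comp hcm hmap).congr fun X hX =>
      ((hg _ (hmem (x := X.2) hX) X.2 trivial).2.2 i j).symm
  · have hm := hmem h
    have h1 := hpde _ (Set.Ioo_subset_Ico_self hm) x
    have h2 : tderiv (Set.Icc s r) w (r - t) x = deriv (fun τ => w τ x) (r - t) :=
      derivWithin_of_mem_nhds (Icc_mem_nhds hm.1 hm.2)
    rw [h2] at h1
    have h3 : max 0 (r - max t 0) = r - t := by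
      rw [max_eq_left h.1.1.le, max_eq_right (hs.trans hm.1.le)]
    simp only [Lop, h3]
    linarith

theorem Vol.exists_comparison {T K : ℝ} (m : ℕ) :
    ∃ l, 0 ≤ l ∧ ∀ a : ℝ → Sp d → Fin d → Fin d → ℝ, Vol T K a → ∀ s r B (f g : Sp d → ℝ) w w',
      0 ≤ s → s < r → r ≤ T → 0 ≤ B → IsTVP a s r f w → IsTVP a s r g w' →
      (∀ x, |f x - g x| ≤ B * qw x ^ (m + 2)) → ∀ τ ∈ Set.Icc s r, ∀ x,
      |w τ x - w' τ x| ≤ B * Real.exp (l * T) * qw x ^ (m + 2) := by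
  obtain ⟨l, hl, H⟩ := Coef.exists_bound d K m
  refine ⟨l, hl, fun a ha s r B f g w w' hs hsr hr hB hw hw' hfg τ hτ x => ?_⟩
  have hS : IsSol (Set.Ioo 0 (r - s) ×ˢ univ) (fun t x => a (max 0 (r - max t 0)) x)
      fun t x => w (r - t) x - w' (r - t) x :=
    (hw.reverse hs).sub (hw'.reverse hs) (isOpen_Ioo.prod isOpen_univ)
  have hmap : MapsTo (fun X : ℝ × Sp d => (r - X.1, X.2)) (Set.Icc 0 (r - s) ×ˢ univ)
      (Set.Icc s r ×ˢ univ) := fun X hX => ⟨⟨by linarith [hX.1.2], by linarith [hX.1.1]⟩, trivial⟩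
  have hcm : ContinuousOn (fun X : ℝ × Sp d => (r - X.1, X.2)) (Set.Icc 0 (r - s) ×ˢ univ) := by
    fun_prop
  obtain ⟨C, q, hC, hq, hb⟩ := hw.2.2.2.2
  obtain ⟨C', q', hC', hq', hb'⟩ := hw'.2.2.2.2
  obtain ⟨n, hn⟩ := exists_nat_ge (max q q')
  have := H _ (ha.coef (hs.trans_lt hsr) hr) (r - s) B (2 * C + 2 * C') n _ hB hS
    ((hw.1.comp hcm hmap).sub (hw'.1.comp hcm hmap)) ?_ ?_ (r - τ)
    ⟨by linarith [hτ.2], by linarith [hτ.1]⟩ x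
  · rw [sub_sub_cancel] at this
    refine this.trans ?_
    rw [mul_assoc]
    exact mul_le_mul_of_nonneg_left (bar_le hl m (by linarith [hτ.1]) x) hB
  · intro t ht y
    have hm : r - t ∈ Set.Icc s r := ⟨by linarith [ht.2], by linarith [ht.1]⟩
    rw [add_mul]
    exact (abs_sub _ _).trans (add_le_add
      ((hb _ hm y).trans (rpow_growth_le hC.le hq.le ((le_max_left _ _).trans hn) y))
      ((hb' _ hm y).trans (rpow_growth_le hC'.le hq'.le ((le_max_right _ _).trans hn) y)))
  · intro y
    rw [sub_zero, hw.2.2.2.1, hw'.2.2.2.1]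
    exact hfg y

theorem Vol.exists_tvp {T K s r F : ℝ} {a : ℝ → Sp d → Fin d → Fin d → ℝ} (ha : Vol T K a)
    (hs : 0 ≤ s) (hsr : s < r) (hr : r ≤ T) {f : Sp d → ℝ} (hf : Continuous f) {m : ℕ}
    (hF : ∀ x, |f x| ≤ F * qw x ^ m) : ∃ w, IsTVP a s r f w := by
  obtain ⟨v, hvc, hv, hv0, C, k, hC, hb⟩ :=
    (ha.coef (hs.trans_lt hsr) hr).exists_cauchy hf hF (T := r - s + 1) (by linarith)
  refine ⟨fun τ x => v (r - τ) x, ?_, ?_, fun τ hτ x => ?_, fun x => ?_, ?_⟩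
  · refine hvc.comp (f := fun X : ℝ × Sp d => (r - X.1, X.2)) (by fun_prop) fun X hX => ?_
    exact ⟨⟨by linarith [hX.1.2], by linarith [hX.1.1]⟩, trivial⟩
  · have hmap : MapsTo (fun X : ℝ × Sp d => (r - X.1, X.2)) (Set.Ico s r ×ˢ univ)
      (Set.Ioo 0 (r - s + 1) ×ˢ univ) :=
      fun X hX => ⟨⟨by linarith [hX.1.2], by linarith [hX.1.1]⟩, trivial⟩
    have hcm : ContinuousOn (fun X : ℝ × Sp d => (r - X.1, X.2)) (Set.Ico s r ×ˢ univ) := by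
      fun_prop
    refine ⟨hv.cont.comp hcm hmap, fun t ht x _ => ?_, fun t ht x _ j => ?_,
      fun X => -deriv (fun τ => v τ X.2) (r - X.1), fun i X => pd1 (v (r - X.1)) i X.2,
      fun i j X => pd2 (v (r - X.1)) i j X.2, (hv.contt.comp hcm hmap).neg,
      fun i => (hv.cont1 i).comp hcm hmap, fun i j => (hv.cont2 i j).comp hcm hmap,
      fun t ht x _ => ⟨?_, fun i => rfl, fun i j => rfl⟩⟩
    · have h1 := hmap (x := (t, x)) ⟨interior_subset ht, trivial⟩
      have h2 := hv.differentiableAt (isOpen_Ioo.prod isOpen_univ) h1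
      exact h2.comp (t, x) (f := fun X : ℝ × Sp d => (r - X.1, X.2)) (by fun_prop)
    · have h1 := hmap (x := (t, x)) ⟨interior_subset ht, trivial⟩
      exact (hv.jet.dxx j _ _ h1).differentiableAt
    · exact (deriv_comp_const_sub (f := fun τ => v τ x) r t).symm
  · have hm : (r - τ, x) ∈ Set.Ioo 0 (r - s + 1) ×ˢ (univ : Set (Sp d)) :=
      ⟨⟨by linarith [hτ.2], by linarith [hτ.1]⟩, trivial⟩
    have h1 : HasDerivAt (fun τ => v (r - τ) x) (-deriv (fun τ => v τ x) (r - τ)) τ :=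
      (hv.jet.dt _ _ hm).comp_const_sub r τ
    have h2 : tderiv (Set.Icc s r) (fun τ x => v (r - τ) x) τ x =
        -deriv (fun τ => v τ x) (r - τ) :=
      h1.hasDerivWithinAt.derivWithin (uniqueDiffOn_Icc hsr τ ⟨hτ.1, hτ.2.le⟩)
    have h3 : max 0 (r - max (r - τ) 0) = τ := by
      rw [max_eq_left (sub_nonneg.2 hτ.2.le), sub_sub_cancel, max_eq_right (hs.trans hτ.1)]
    rw [h2, hv.eq _ _ hm]
    simp only [Lop, h3]
    ring
  · simp only [sub_self, hv0]
  · obtain ⟨C', q, hC', hq, h⟩ := exists_rpow_growth (d := d) hC k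
    exact ⟨C', q, hC', hq, fun τ hτ x =>
      (hb _ ⟨by linarith [hτ.2], by linarith [hτ.1]⟩ x).trans (h x)⟩

theorem isTVP_zero (a : ℝ → Sp d → Fin d → Fin d → ℝ) (s r : ℝ) :
    IsTVP a s r (fun _ => 0) fun _ _ => 0 := by
  have h1 (j : Fin d) : pd1 (fun _ : Fin d → ℝ => (0 : ℝ)) j = fun _ => 0 := by
    funext x; simp [pd1]
  have h2 (i j : Fin d) (x : Fin d → ℝ) : pd2 (fun _ : Fin d → ℝ => (0 : ℝ)) i j x = 0 := by
    simp [pd2, h1]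
  refine ⟨continuousOn_const, ⟨continuousOn_const, fun t _ x _ => differentiableAt_const _,
    fun t _ x _ j => ?_, fun _ => 0, fun _ _ => 0, fun _ _ _ => 0, continuousOn_const,
    fun _ => continuousOn_const, fun _ _ => continuousOn_const, fun t _ x _ =>
      ⟨by simp, fun i => by simp [h1], fun i j => (h2 i j x).symm⟩⟩,
    fun τ _ x => by simp [tderiv, h2], fun _ => rfl, 1, 1, one_pos, one_pos, fun τ _ x => ?_⟩
  · rw [h1]; exact differentiableAt_const _
  · rw [abs_zero]; positivity

theorem exists_backward_sequence {α : Type*} (N : ℕ) (Q : ℕ → α → Prop) (R : ℕ → α → α → Prop)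
    (a : α) (ha : Q N a) (step : ∀ k < N, ∀ b, Q (k + 1) b → ∃ c, Q k c ∧ R k c b) :
    ∃ v : ℕ → α, v N = a ∧ ∀ k < N, R k (v k) (v (k + 1)) := by
  induction N generalizing a with
  | zero => exact ⟨fun _ => a, rfl, fun k hk => absurd hk k.not_lt_zero⟩
  | succ N ih =>
    obtain ⟨c, hc, hR⟩ := step N N.lt_succ_self a ha
    obtain ⟨v, hv, hvR⟩ := ih c hc fun k hk => step k (hk.trans N.lt_succ_self)
    refine ⟨Function.update v (N + 1) a, Function.update_self .., fun k hk => ?_⟩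
    rw [Function.update_of_ne hk.ne]
    obtain rfl | hkN := eq_or_ne k N
    · rwa [Function.update_self, hv]
    · rw [Function.update_of_ne (by omega)]
      exact hvR k (by omega)

/-- The size of the first `k + 1` points of a path. -/
def pathSize (k : ℕ) (xs : ℕ → Sp d) : ℝ := 1 + ∑ i ∈ Finset.range (k + 1), ‖xs i‖

/-- The distance of the first `k + 1` points of two paths. -/
def pathDist (k : ℕ) (xs ys : ℕ → Sp d) : ℝ := ∑ i ∈ Finset.range (k + 1), ‖xs i - ys i‖

theorem one_le_pathSize (k : ℕ) (xs : ℕ → Sp d) : 1 ≤ pathSize k xs :=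
  le_add_of_nonneg_right (Finset.sum_nonneg fun _ _ => norm_nonneg _)

theorem pathDist_nonneg (k : ℕ) (xs ys : ℕ → Sp d) : 0 ≤ pathDist k xs ys :=
  Finset.sum_nonneg fun _ _ => norm_nonneg _

theorem pathSize_update (k : ℕ) (xs : ℕ → Sp d) (x : Sp d) :
    pathSize (k + 1) (Function.update xs (k + 1) x) = pathSize k xs + ‖x‖ := by
  have : ∑ i ∈ Finset.range (k + 1), ‖Function.update xs (k + 1) x i‖ =
      ∑ i ∈ Finset.range (k + 1), ‖xs i‖ :=
    Finset.sum_congr rfl fun i hi => by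
      rw [Function.update_of_ne (Finset.mem_range.1 hi).ne]
  rw [pathSize, Finset.sum_range_succ, this, Function.update_self, pathSize, add_assoc]

theorem pathDist_update (k : ℕ) (xs ys : ℕ → Sp d) (x y : Sp d) :
    pathDist (k + 1) (Function.update xs (k + 1) x) (Function.update ys (k + 1) y) =
      pathDist k xs ys + ‖x - y‖ := by
  have : ∑ i ∈ Finset.range (k + 1),
      ‖Function.update xs (k + 1) x i - Function.update ys (k + 1) y i‖ =
      ∑ i ∈ Finset.range (k + 1), ‖xs i - ys i‖ :=
    Finset.sum_congr rfl fun i hi => by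
      rw [Function.update_of_ne (Finset.mem_range.1 hi).ne,
        Function.update_of_ne (Finset.mem_range.1 hi).ne]
  rw [pathDist, Finset.sum_range_succ, this, Function.update_self, Function.update_self, pathDist]

theorem pathDist_self (k : ℕ) (xs : ℕ → Sp d) : pathDist k xs xs = 0 := by simp [pathDist]

/-- Functions of the first `k + 1` points of a path and a space variable which are continuous in
space, locally Lipschitz in the path, and of polynomial growth. -/
structure Payoff (k : ℕ) (K : ℝ) (m n : ℕ) (V : (ℕ → Sp d) → Sp d → ℝ) : Prop where
  cont : ∀ xs, Continuous (V xs)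
  lip : ∀ xs ys x, |V xs x - V ys x| ≤
    K * (pathSize k xs + pathSize k ys) ^ m * pathDist k xs ys * qw x ^ (n + 2)
  growth : ∀ xs x, |V xs x| ≤ K * pathSize k xs ^ m * qw x ^ (n + 2)

theorem Payoff.continuous_diag {k m n : ℕ} {K : ℝ} {V : (ℕ → Sp d) → Sp d → ℝ}
    (hV : Payoff (k + 1) K m n V) (xs : ℕ → Sp d) :
    Continuous fun x => V (Function.update xs (k + 1) x) x := by
  refine continuous_iff_continuousAt.2 fun y => ?_
  have h1 : Tendsto (fun x => V (Function.update xs (k + 1) y) x) (𝓝 y)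
      (𝓝 (V (Function.update xs (k + 1) y) y)) := (hV.cont _).tendsto y
  have h2 : Tendsto (fun x => V (Function.update xs (k + 1) x) x -
      V (Function.update xs (k + 1) y) x) (𝓝 y) (𝓝 0) := by
    have hb (x : Sp d) := hV.lip (Function.update xs (k + 1) x) (Function.update xs (k + 1) y) x
    simp only [pathSize_update, pathDist_update, pathDist_self] at hb
    refine squeeze_zero_norm hb ?_
    have : Continuous fun x : Sp d => K * (pathSize k xs + ‖x‖ + (pathSize k xs + ‖y‖)) ^ m *
        (0 + ‖x - y‖) * qw x ^ (n + 2) := by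
      have := continuous_qw (d := d)
      fun_prop
    simpa using this.tendsto y
  simpa [ContinuousAt] using h2.add h1

theorem pow_add_norm_le {A c : ℝ} (hA : c ≤ A) (hc : 0 ≤ c) (x : Sp d) (m : ℕ) :
    (A + c * ‖x‖) ^ m ≤ A ^ m * (2 ^ m * qw x ^ m) := by
  rw [← mul_pow, ← mul_pow]
  refine pow_le_pow_left₀ (by have := hc.trans hA; positivity) ?_ m
  have h1 := norm_le_qw x
  have h2 := one_le_qw x
  have h3 : c * ‖x‖ ≤ A * qw x := mul_le_mul hA h1 (norm_nonneg x) (hc.trans hA)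
  nlinarith

theorem Payoff.nonneg {k m n : ℕ} {K : ℝ} {V : (ℕ → Sp d) → Sp d → ℝ} (hV : Payoff k K m n V) :
    0 ≤ K := by
  have h := (abs_nonneg _).trans (hV.growth 0 0)
  rw [mul_assoc] at h
  refine nonneg_of_mul_nonneg_left h ?_
  have := qw_pos (0 : Sp d)
  have := one_pos.trans_le (one_le_pathSize k (0 : ℕ → Sp d))
  positivity

theorem Payoff.diag_growth {k m n : ℕ} {K : ℝ} {V : (ℕ → Sp d) → Sp d → ℝ}
    (hV : Payoff (k + 1) K m n V) (xs : ℕ → Sp d) (x : Sp d) :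
    |V (Function.update xs (k + 1) x) x| ≤
      K * 2 ^ m * pathSize k xs ^ m * qw x ^ (n + m + 2) := by
  have h := hV.growth (Function.update xs (k + 1) x) x
  rw [pathSize_update] at h
  have h1 := pow_add_norm_le (one_le_pathSize k xs) zero_le_one x m
  rw [one_mul] at h1
  refine h.trans ?_
  have := qw_pos x
  have := hV.nonneg
  calc K * (pathSize k xs + ‖x‖) ^ m * qw x ^ (n + 2)
      ≤ K * (pathSize k xs ^ m * (2 ^ m * qw x ^ m)) * qw x ^ (n + 2) := by gcongr
    _ = _ := by ring

theorem Payoff.diag_lip {k m n : ℕ} {K : ℝ} {V : (ℕ → Sp d) → Sp d → ℝ}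
    (hV : Payoff (k + 1) K m n V) (xs ys : ℕ → Sp d) (x : Sp d) :
    |V (Function.update xs (k + 1) x) x - V (Function.update ys (k + 1) x) x| ≤
      K * 2 ^ m * (pathSize k xs + pathSize k ys) ^ m * pathDist k xs ys *
        qw x ^ (n + m + 2) := by
  have h := hV.lip (Function.update xs (k + 1) x) (Function.update ys (k + 1) x) x
  rw [pathSize_update, pathSize_update, pathDist_update, sub_self, norm_zero, add_zero] at h
  have h1 := pow_add_norm_le (A := pathSize k xs + pathSize k ys) (c := 2)
    (by linarith [one_le_pathSize k xs, one_le_pathSize k ys]) zero_le_two x m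
  refine h.trans ?_
  have := qw_pos x
  have := hV.nonneg
  have := pathDist_nonneg k xs ys
  calc K * (pathSize k xs + ‖x‖ + (pathSize k ys + ‖x‖)) ^ m * pathDist k xs ys * qw x ^ (n + 2)
      = K * (pathSize k xs + pathSize k ys + 2 * ‖x‖) ^ m * pathDist k xs ys *
        qw x ^ (n + 2) := by ring
    _ ≤ K * ((pathSize k xs + pathSize k ys) ^ m * (2 ^ m * qw x ^ m)) * pathDist k xs ys *
        qw x ^ (n + 2) := by gcongr
    _ = _ := by ring

theorem exists_payoff_of_lipschitz {N : ℕ} {h : (Fin (N + 1) → Fin d → ℝ) → ℝ} {p L : ℝ}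
    (hL : 0 ≤ L)
    (hh : ∀ m : ℝ, ∀ x y : Fin (N + 1) → Fin d → ℝ,
      (∀ i, ‖x i‖ ≤ m) → (∀ i, ‖y i‖ ≤ m) →
      |h x - h y| ≤ (1 + m ^ p) * L * ∑ i, ‖x i - y i‖) :
    ∃ K m n, Payoff N K m n fun xs (_ : Sp d) => h fun i : Fin (N + 1) => xs i := by
  obtain ⟨q, hq⟩ := exists_nat_ge p
  have hpow {M : ℝ} (hM : 1 ≤ M) : 1 + M ^ p ≤ 2 * M ^ q := by
    have h1 : M ^ p ≤ M ^ q := by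
      rw [← Real.rpow_natCast]; exact Real.rpow_le_rpow_of_exponent_le hM hq
    have h2 : 1 ≤ M ^ q := one_le_pow₀ hM
    linarith
  have hle (xs : ℕ → Sp d) (i : Fin (N + 1)) : ‖xs i‖ ≤ pathSize N xs := by
    have : ‖xs i‖ ≤ ∑ j ∈ Finset.range (N + 1), ‖xs j‖ :=
      Finset.single_le_sum (f := fun j => ‖xs j‖) (fun _ _ => norm_nonneg _)
        (Finset.mem_range.2 i.2)
    rw [pathSize]; linarith
  have hD (xs ys : ℕ → Sp d) : ∑ i : Fin (N + 1), ‖xs i - ys i‖ = pathDist N xs ys :=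
    Fin.sum_univ_eq_sum_range (fun i => ‖xs i - ys i‖) (N + 1)
  have hl (xs ys : ℕ → Sp d) : |h (fun i : Fin (N + 1) => xs i) - h fun i : Fin (N + 1) => ys i| ≤
      2 * L * (pathSize N xs + pathSize N ys) ^ q * pathDist N xs ys := by
    have h1 := one_le_pathSize N xs
    have h2 := one_le_pathSize N ys
    refine (hh (pathSize N xs + pathSize N ys) _ _ (fun i => (hle xs i).trans (by linarith))
      fun i => (hle ys i).trans (by linarith)).trans ?_
    rw [hD]
    have := pathDist_nonneg N xs ys
    calc _ ≤ 2 * (pathSize N xs + pathSize N ys) ^ q * L * pathDist N xs ys := by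
          gcongr; exact hpow (by linarith)
      _ = _ := by ring
  refine ⟨|h fun _ => 0| + 2 * L * 2 ^ q, q + 1, 0, fun _ => continuous_const, fun xs ys x => ?_,
    fun xs x => ?_⟩
  · have h1 := one_le_pathSize N xs
    have h2 := one_le_pathSize N ys
    have h3 := pathDist_nonneg N xs ys
    have h4 : 1 ≤ qw x ^ (0 + 2) := one_le_pow₀ (one_le_qw x)
    have h5 : (1 : ℝ) ≤ 2 ^ q := one_le_pow₀ one_le_two
    refine (hl xs ys).trans (le_trans ?_ (le_mul_of_one_le_right (by positivity) h4))
    gcongr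
    · nlinarith [abs_nonneg (h fun _ => 0), mul_nonneg hL (sub_nonneg.2 h5)]
    · linarith
    · exact Nat.le_succ q
  · have h1 := one_le_pathSize N xs
    have h4 : 1 ≤ qw x ^ (0 + 2) := one_le_pow₀ (one_le_qw x)
    refine le_trans ?_ (le_mul_of_one_le_right (by positivity) h4)
    have h6 := hl xs 0
    have h7 : pathSize N (0 : ℕ → Sp d) = 1 := by simp [pathSize]
    have h8 : pathDist N xs 0 ≤ pathSize N xs := by simp [pathDist, pathSize]
    have h9 := pathDist_nonneg N xs 0
    rw [h7] at h6
    have h10 : |h fun i : Fin (N + 1) => xs i| ≤ |h fun _ => 0| +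
        |h (fun i : Fin (N + 1) => xs i) - h fun i : Fin (N + 1) => (0 : ℕ → Sp d) i| := by
      have := abs_add_le (h fun _ => 0)
        (h (fun i : Fin (N + 1) => xs i) - h fun i : Fin (N + 1) => (0 : ℕ → Sp d) i)
      rwa [show (fun i : Fin (N + 1) => (0 : ℕ → Sp d) i) = fun _ => 0 from rfl,
        add_sub_cancel] at this
    have h11 : (1 : ℝ) ≤ pathSize N xs ^ (q + 1) := one_le_pow₀ h1
    calc _ ≤ |h fun _ => 0| + 2 * L * (pathSize N xs + 1) ^ q * pathDist N xs 0 :=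
          h10.trans (by gcongr)
      _ ≤ |h fun _ => 0| * pathSize N xs ^ (q + 1) +
          2 * L * (2 * pathSize N xs) ^ q * pathSize N xs := by
        gcongr
        · exact le_mul_of_one_le_right (abs_nonneg _) h11
        · linarith
      _ = _ := by ring

theorem Vol.exists_step {T K₀ s r : ℝ} {a : ℝ → Sp d → Fin d → Fin d → ℝ} (ha : Vol T K₀ a)
    (hs : 0 ≤ s) (hsr : s < r) (hr : r ≤ T) {k m n : ℕ} {K : ℝ} {V : (ℕ → Sp d) → Sp d → ℝ}
    (hV : Payoff (k + 1) K m n V) :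
    ∃ w : ℝ → (ℕ → Sp d) → Sp d → ℝ, (∃ K' n', Payoff k K' m n' (w s)) ∧ ∀ xs,
      IsTVP a s r (fun x => V (Function.update xs (k + 1) x) x) (fun τ x => w τ xs x) ∧
      ∀ w', IsTVP a s r (fun x => V (Function.update xs (k + 1) x) x) w' →
        ∀ τ ∈ Set.Icc s r, ∀ x, w' τ x = w τ xs x := by
  choose w hw using fun xs => ha.exists_tvp hs hsr hr (hV.continuous_diag xs) (hV.diag_growth xs)
  obtain ⟨l, hl, H⟩ := Vol.exists_comparison (d := d) (T := T) (K := K₀) (n + m)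
  have hK := hV.nonneg
  refine ⟨fun τ xs x => w xs τ x, ⟨K * 2 ^ m * Real.exp (l * T), n + m, fun xs => ?_,
    fun xs ys x => ?_, fun xs x => ?_⟩, fun xs => ⟨hw xs, fun w' hw' τ hτ x => ?_⟩⟩
  · refine continuousOn_univ.1 ((hw xs).1.comp (f := fun x : Sp d => (s, x)) (by fun_prop) ?_)
    exact fun x _ => ⟨⟨le_rfl, hsr.le⟩, trivial⟩
  · have h1 := one_le_pathSize k xs
    have h2 := one_le_pathSize k ys
    have h3 := pathDist_nonneg k xs ys
    refine (H a ha s r _ _ _ _ _ hs hsr hr (by positivity) (hw xs) (hw ys) (hV.diag_lip xs ys) s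
      ⟨le_rfl, hsr.le⟩ x).trans (le_of_eq (by ring))
  · have h1 := one_le_pathSize k xs
    have := H a ha s r (K * 2 ^ m * pathSize k xs ^ m) _ _ _ _ hs hsr hr (by positivity) (hw xs)
      (isTVP_zero a s r) (fun x => by rw [sub_zero]; exact hV.diag_growth xs x) s ⟨le_rfl, hsr.le⟩ x
    rw [sub_zero] at this
    exact this.trans (le_of_eq (by ring))
  · have := H a ha s r 0 _ _ _ _ hs hsr hr le_rfl hw' (hw xs) (fun x => by simp) τ hτ x
    rw [zero_mul, zero_mul] at this
    exact sub_eq_zero.1 (abs_nonpos_iff.1 this)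

end

/-- Theorem 2.6 for (TVP): the recursive scheme of terminal-value problems associated with an
exotic payoff `h` is well-defined: each terminal condition `f_{k+1}` is continuous with
polynomial growth, and each Cauchy problem has a unique polynomial-growth solution `v_k`. -/
theorem stmt6 (T : ℝ) (hT : 0 < T) (d N : ℕ) (hN : 0 < N)
    (a : ℝ → (Fin d → ℝ) → Fin d → Fin d → ℝ)
    (ha_cont : ∀ i j, ContinuousOn (fun p : ℝ × (Fin d → ℝ) => a p.1 p.2 i j)
      (Set.Icc 0 T ×ˢ (Set.univ : Set (Fin d → ℝ))))
    (ha_symm : ∀ t ∈ Set.Icc (0 : ℝ) T, ∀ x : Fin d → ℝ, ∀ i j, a t x i j = a t x j i)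
    (ha_pd : ∀ t ∈ Set.Icc (0 : ℝ) T, ∀ x : Fin d → ℝ, ∀ y : Fin d → ℝ, y ≠ 0 →
      0 < ∑ i, ∑ j, a t x i j * y i * y j)
    (ha_holder : ∀ i j, LocallyHolderOn (fun p : ℝ × (Fin d → ℝ) => a p.1 p.2 i j)
      (Set.Ico 0 T ×ˢ (Set.univ : Set (Fin d → ℝ))))
    (c₁ : ℝ) (hc₁ : 0 ≤ c₁)
    (ha_growth : ∀ t ∈ Set.Icc (0 : ℝ) T, ∀ x : Fin d → ℝ, ∀ i j,
      |a t x i j| ≤ c₁ * (1 + ‖x‖ ^ 2))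
    (t : ℕ → ℝ) (ht0 : t 0 = 0) (htN : t N = T) (htm : ∀ k < N, t k < t (k + 1))
    (h : (Fin (N + 1) → Fin d → ℝ) → ℝ)
    (p L : ℝ) (hp : 0 ≤ p) (hL : 0 ≤ L)
    (hh : ∀ m : ℝ, ∀ x y : Fin (N + 1) → Fin d → ℝ,
      (∀ i, ‖x i‖ ≤ m) → (∀ i, ‖y i‖ ≤ m) →
      |h x - h y| ≤ (1 + m ^ p) * L * ∑ i, ‖x i - y i‖) :
    ∃ v : ℕ → ℝ → (ℕ → Fin d → ℝ) → (Fin d → ℝ) → ℝ,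
      (∀ τ : ℝ, ∀ xs : ℕ → Fin d → ℝ, ∀ x : Fin d → ℝ,
        v N τ xs x = h fun i : Fin (N + 1) => xs i) ∧
      ∀ k < N, ∀ xs : ℕ → Fin d → ℝ,
        -- the terminal condition `f_{k+1}` is continuous with polynomial growth
        (Continuous (fun x : Fin d → ℝ =>
            v (k + 1) (t (k + 1)) (Function.update xs (k + 1) x) x) ∧
          ∃ C q : ℝ, 0 < C ∧ 0 < q ∧ ∀ x : Fin d → ℝ,
            |v (k + 1) (t (k + 1)) (Function.update xs (k + 1) x) x| ≤ C * (1 + ‖x‖ ^ q)) ∧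
        -- `v_k` solves the corresponding terminal-value problem ...
        (ContinuousOn (fun pr : ℝ × (Fin d → ℝ) => v k pr.1 xs pr.2)
            (Set.Icc (t k) (t (k + 1)) ×ˢ (Set.univ : Set (Fin d → ℝ))) ∧
          IsC12 (Set.Ico (t k) (t (k + 1))) (Set.univ : Set (Fin d → ℝ))
            (fun τ x => v k τ xs x) ∧
          (∀ τ ∈ Set.Ico (t k) (t (k + 1)), ∀ x : Fin d → ℝ,
            tderiv (Set.Icc (t k) (t (k + 1))) (fun σ y => v k σ xs y) τ x
              + (1 / 2) * ∑ i, ∑ j, a τ x i j * pd2 (fun y => v k τ xs y) i j x = 0) ∧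
          (∀ x : Fin d → ℝ,
            v k (t (k + 1)) xs x = v (k + 1) (t (k + 1)) (Function.update xs (k + 1) x) x) ∧
          (∃ C q : ℝ, 0 < C ∧ 0 < q ∧ ∀ τ ∈ Set.Icc (t k) (t (k + 1)), ∀ x : Fin d → ℝ,
            |v k τ xs x| ≤ C * (1 + ‖x‖ ^ q))) ∧
        -- ... and is the unique such solution with polynomial growth uniformly in `t`
        (∀ w : ℝ → (Fin d → ℝ) → ℝ,
          (ContinuousOn (fun pr : ℝ × (Fin d → ℝ) => w pr.1 pr.2)
              (Set.Icc (t k) (t (k + 1)) ×ˢ (Set.univ : Set (Fin d → ℝ))) ∧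
            IsC12 (Set.Ico (t k) (t (k + 1))) (Set.univ : Set (Fin d → ℝ)) w ∧
            (∀ τ ∈ Set.Ico (t k) (t (k + 1)), ∀ x : Fin d → ℝ,
              tderiv (Set.Icc (t k) (t (k + 1))) w τ x
                + (1 / 2) * ∑ i, ∑ j, a τ x i j * pd2 (w τ) i j x = 0) ∧
            (∀ x : Fin d → ℝ,
              w (t (k + 1)) x = v (k + 1) (t (k + 1)) (Function.update xs (k + 1) x) x) ∧
            (∃ C q : ℝ, 0 < C ∧ 0 < q ∧ ∀ τ ∈ Set.Icc (t k) (t (k + 1)), ∀ x : Fin d → ℝ,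
              |w τ x| ≤ C * (1 + ‖x‖ ^ q))) →
          ∀ τ ∈ Set.Icc (t k) (t (k + 1)), ∀ x : Fin d → ℝ, w τ x = v k τ xs x) := by
  have ha : Vol T c₁ a := ⟨ha_symm, ha_pd, fun t ht x i j => (ha_growth t ht x i j).trans
    (mul_le_mul_of_nonneg_left (norm_sq_le_qw x) hc₁), ha_holder⟩
  have ht_mono {i j : ℕ} (hij : i ≤ j) (hj : j ≤ N) : t i ≤ t j := by
    induction j, hij using Nat.le_induction with
    | base => exact le_rfl
    | succ j hij ih => exact (ih (by omega)).trans (htm j (by omega)).le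
  obtain ⟨v, hv, H⟩ := exists_backward_sequence (α := ℝ → (ℕ → Fin d → ℝ) → (Fin d → ℝ) → ℝ) N
    (fun k V => ∃ K m n, Payoff k K m n (V (t k)))
    (fun k c b => ∀ xs, (Continuous (fun x => b (t (k + 1)) (Function.update xs (k + 1) x) x) ∧
      ∃ C q : ℝ, 0 < C ∧ 0 < q ∧ ∀ x,
        |b (t (k + 1)) (Function.update xs (k + 1) x) x| ≤ C * (1 + ‖x‖ ^ q)) ∧
      IsTVP a (t k) (t (k + 1)) (fun x => b (t (k + 1)) (Function.update xs (k + 1) x) x)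
        (fun τ x => c τ xs x) ∧
      ∀ w, IsTVP a (t k) (t (k + 1))
          (fun x => b (t (k + 1)) (Function.update xs (k + 1) x) x) w →
        ∀ τ ∈ Set.Icc (t k) (t (k + 1)), ∀ x, w τ x = c τ xs x)
    (fun _ xs _ => h fun i : Fin (N + 1) => xs i) (exists_payoff_of_lipschitz hL hh)
    fun k hk b ⟨K, m, n, hb⟩ => by
      obtain ⟨w, ⟨K', n', hw⟩, hwt⟩ := ha.exists_step (ht0.symm.le.trans (ht_mono k.zero_le hk.le))
        (htm k hk) ((ht_mono hk le_rfl).trans htN.le) hb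
      refine ⟨w, ⟨K', m, n', hw⟩, fun xs => ⟨⟨hb.continuous_diag xs, ?_⟩, hwt xs⟩⟩
      have hK := hb.nonneg
      have := one_pos.trans_le (one_le_pathSize k xs)
      obtain ⟨C, q, hC, hq, hg⟩ := exists_rpow_growth (d := d)
        (C := K * 2 ^ m * pathSize k xs ^ m) (by positivity) (n + m + 2)
      exact ⟨C, q, hC, hq, fun x => (hb.diag_growth xs x).trans (hg x)⟩
  exact ⟨v, fun τ xs x => by rw [hv], H⟩
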